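/- arXiv:1010.5311 — 5 statements merged into one kernel-verified Lean document; each statement's English description precedes it below -/
import Mathlib

section
/- Let n ≥ 1, let m be a positive integer, and let F be a family of subsets of [n] with Lubell function h̄(F) ≤ m. Then |F| ≤ Σ(n,m). -/
open Finset

/-- The Lubell function of a family `F` of subsets of `[n]`. -/
noncomputable def lubell (n : ℕ) (F : Finset (Finset (Fin n))) : ℝ :=
  ∑ A ∈ F, (1 : ℝ) / (n.choose A.card)

/-- `Σ(n,m)`: the sum of the `m` largest binomial coefficients `C(n,i)`,
i.e. `Σ_{i=0}^{m-1} C(n, ⌊(n-m+1)/2⌋ + i)`. -/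
def middleBinomSum (n m : ℕ) : ℕ :=
  ∑ i ∈ Finset.range m, n.choose ((n - m + 1) / 2 + i)

lemma choose_mono_half (n i j : ℕ) (hij : i ≤ j) (hj : 2 * j ≤ n) :
    n.choose i ≤ n.choose j := by
  induction j, hij using Nat.le_induction with
  | base => exact le_rfl
  | succ k hk ih =>
    exact (ih (by omega)).trans (Nat.choose_le_succ_of_lt_half_left (by omega))

lemma choose_le_left (n a k : ℕ) (ha : 2 * a ≤ n) (hk : k < a ∨ n ≤ a + k) :
    n.choose k ≤ n.choose a := by
  rcases hk with hk | hk
  · exact choose_mono_half n k a hk.le ha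
  · by_cases hkn : k ≤ n
    · rw [← Nat.choose_symm hkn]
      exact choose_mono_half n _ a (by omega) ha
    · rw [Nat.choose_eq_zero_of_lt (by omega)]
      exact Nat.zero_le _

lemma choose_le_mid (n a k : ℕ) (hk : a ≤ k) (hk' : k + a ≤ n) :
    n.choose a ≤ n.choose k := by
  by_cases h : 2 * k ≤ n
  · exact choose_mono_half n a k hk h
  · rw [← Nat.choose_symm (by omega : k ≤ n)]
    exact choose_mono_half n _ _ (by omega) (by omega)

/-- If the Lubell function of `F` is at most a positive integer `m`,
then `|F| ≤ Σ(n,m)`. -/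
theorem card_le_middleBinomSum_of_lubell_le (n : ℕ) (hn : 1 ≤ n) (m : ℕ) (hm : 0 < m)
    (F : Finset (Finset (Fin n))) (h : lubell n F ≤ m) :
    F.card ≤ middleBinomSum n m := by
  unfold middleBinomSum
  by_cases hmn : n < m
  · have ha : (n - m + 1) / 2 = 0 := by omega
    rw [ha]
    calc F.card ≤ 2 ^ n := by
            have := Finset.card_le_univ F
            simpa using this
      _ = ∑ i ∈ range (n + 1), n.choose i := (Nat.sum_range_choose n).symm
      _ ≤ ∑ i ∈ range m, n.choose i :=
            Finset.sum_le_sum_of_subset (Finset.range_mono (by omega))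
      _ = _ := by simp
  · obtain ⟨a, ha⟩ : ∃ a, a = (n - m + 1) / 2 := ⟨_, rfl⟩
    rw [← ha]
    set c : ℝ := (n.choose a : ℝ) with hc
    let g : ℕ → ℝ := fun k => if k ∈ Finset.Ico a (a + m) then 1 - c / n.choose k else 0
    have hpos : ∀ k, k ≤ n → (0 : ℝ) < n.choose k := fun k hk => by
      exact_mod_cast Nat.choose_pos hk
    have hg0 : ∀ k, k ≤ n → 0 ≤ g k := by
      intro k hk
      simp only [g]
      split_ifs with hkm
      · rw [Finset.mem_Ico] at hkm
        rw [sub_nonneg, div_le_one (hpos k hk)]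
        exact Nat.cast_le.mpr (choose_le_mid n a k hkm.1 (by omega))
      · exact le_rfl
    have hg1 : ∀ k, k ≤ n → 1 - c / n.choose k ≤ g k := by
      intro k hk
      simp only [g]
      split_ifs with hkm
      · exact le_rfl
      · rw [Finset.mem_Ico] at hkm
        rw [sub_nonpos, one_le_div (hpos k hk)]
        exact Nat.cast_le.mpr (choose_le_left n a k (by omega) (by omega))
    have hcard : ∀ A : Finset (Fin n), A.card ≤ n := fun A => by
      simpa using Finset.card_le_univ A
    have h1 : (F.card : ℝ) - c * lubell n F ≤ ∑ A : Finset (Fin n), g A.card := by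
      calc (F.card : ℝ) - c * lubell n F = ∑ A ∈ F, (1 - c / n.choose A.card) := by
            rw [Finset.sum_sub_distrib, lubell, Finset.mul_sum]
            simp [div_eq_mul_inv]
        _ ≤ ∑ A ∈ F, g A.card := Finset.sum_le_sum fun A _ => hg1 _ (hcard A)
        _ ≤ _ := Finset.sum_le_sum_of_subset_of_nonneg (Finset.subset_univ F)
              fun A _ _ => hg0 _ (hcard A)
    have h2 : ∑ A : Finset (Fin n), g A.card
        = ∑ i ∈ range m, (n.choose (a + i) : ℝ) - m * c := by
      have e := Finset.sum_powerset_apply_card g (x := (Finset.univ : Finset (Fin n)))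
      rw [Finset.powerset_univ, Finset.card_univ, Fintype.card_fin] at e
      rw [e]
      have hs : Finset.Ico a (a + m) ⊆ range (n + 1) := by
        intro k hk
        rw [Finset.mem_Ico] at hk
        rw [Finset.mem_range]
        omega
      rw [← Finset.sum_subset hs (fun k _ hk => by simp only [g, if_neg hk, smul_zero])]
      rw [Finset.sum_Ico_eq_sum_range, Nat.add_sub_cancel_left]
      have : ∀ i ∈ range m, n.choose (a + i) • g (a + i) = (n.choose (a + i) : ℝ) - c := by
        intro i hi
        rw [Finset.mem_range] at hi
        have hp := hpos (a + i) (by omega)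
        have hmem : a + i ∈ Finset.Ico a (a + m) := by
          rw [Finset.mem_Ico]; omega
        simp only [g, if_pos hmem, nsmul_eq_mul]
        field_simp
      rw [Finset.sum_congr rfl this, Finset.sum_sub_distrib]
      simp
    have h3 : c * lubell n F ≤ c * m := mul_le_mul_of_nonneg_left h (Nat.cast_nonneg _)
    have h4 : (F.card : ℝ) ≤ ∑ i ∈ range m, (n.choose (a + i) : ℝ) := by linarith
    exact_mod_cast h4
end

section
/- Let n ≥ 1 and let F be a diamond-free family of subsets of [n]. Then the Lubell function satisfies h̄(F) ≤ 5/2. -/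
open Finset

/-- `F` is `D_k`-free: there are no pairwise distinct `A, B_1, …, B_k, C ∈ F`
with `A ⊆ B_i ⊆ C` for all `i`. -/
def DkFree (n k : ℕ) (F : Finset (Finset (Fin n))) : Prop :=
  ¬ ∃ (A C : Finset (Fin n)) (B : Fin k → Finset (Fin n)),
      A ∈ F ∧ C ∈ F ∧ (∀ i, B i ∈ F) ∧
      Function.Injective B ∧ (∀ i, B i ≠ A ∧ B i ≠ C) ∧ A ≠ C ∧
      (∀ i, A ⊆ B i ∧ B i ⊆ C)

lemma card_numb (n : ℕ) : Fintype.card (Numbering (Fin n)) = n.factorial :=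
  Fintype.card_numbering.trans (congrArg Nat.factorial (Fintype.card_fin n))

/-- Swap the entries of a numbering at positions `b - 1` and `b`. -/
def swapAt {n : ℕ} (b : ℕ) (f : Numbering (Fin n)) : Numbering (Fin n) :=
  if h : 1 ≤ b ∧ b < Fintype.card (Fin n) then
    f.trans (Equiv.swap ⟨b - 1, by omega⟩ ⟨b, h.2⟩) else f

lemma swapAt_swapAt {n : ℕ} (b : ℕ) (f : Numbering (Fin n)) : swapAt b (swapAt b f) = f := by
  unfold swapAt
  split_ifs with h
  · ext x; simp
  · rfl

lemma swapAt_prefix {n : ℕ} {b : ℕ} {f : Numbering (Fin n)} {s : Finset (Fin n)}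
    (hs : f.IsPrefix s) (hb : #s ≠ b) : (swapAt b f).IsPrefix s := by
  unfold swapAt
  split_ifs with h
  · intro x
    rw [hs x]
    simp only [Equiv.trans_apply]
    rw [Equiv.swap_apply_def]
    split_ifs with h1 h2
    · rw [h1]; simp; omega
    · rw [h2]; simp; omega
    · rfl
  · exact hs

lemma swapAt_not_prefix {n : ℕ} {f : Numbering (Fin n)} {s : Finset (Fin n)}
    (hs : f.IsPrefix s) (h1 : 1 ≤ #s) (h2 : #s < Fintype.card (Fin n)) :
    ¬ (swapAt #s f).IsPrefix s := by
  intro hp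
  have h : 1 ≤ #s ∧ #s < Fintype.card (Fin n) := ⟨h1, h2⟩
  have a := hs (f.symm ⟨#s, h2⟩)
  have b := hp (f.symm ⟨#s, h2⟩)
  rw [a, swapAt, dif_pos h] at b
  simp only [Equiv.trans_apply, Equiv.apply_symm_apply, Equiv.swap_apply_right] at b
  omega

lemma prefix_cmp {n : ℕ} {f : Numbering (Fin n)} {s t : Finset (Fin n)}
    (hs : f.IsPrefix s) (ht : f.IsPrefix t) : s ⊂ t ∨ s = t ∨ t ⊂ s := by
  rcases le_total #s #t with h | h
  · rcases (hs.subset_of_card_le_card ht h).eq_or_ssubset with h | h <;> simp [h]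
  · rcases (ht.subset_of_card_le_card hs h).eq_or_ssubset with h | h <;> simp [h]

/-- `F` contains no strict diamond. -/
def NoDia {n : ℕ} (F : Finset (Finset (Fin n))) : Prop :=
  ∀ A ∈ F, ∀ B ∈ F, ∀ B' ∈ F, ∀ C ∈ F, A ⊂ B → B ⊂ C → A ⊂ B' → B' ⊂ C → B = B'

lemma noDia_of {n : ℕ} {F : Finset (Finset (Fin n))} (hF : DkFree n 2 F) : NoDia F := by
  intro A hA B hB B' hB' C hC h1 h2 h3 h4
  by_contra hne
  apply hF
  refine ⟨A, C, ![B, B'], hA, hC, ?_, ?_, ?_, (h1.trans h2).ne, ?_⟩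
  · intro i; fin_cases i <;> simpa
  · intro i j hij
    fin_cases i <;> fin_cases j <;> simp_all [eq_comm]
  · intro i; fin_cases i
    · exact ⟨h1.ne', h2.ne⟩
    · exact ⟨h3.ne', h4.ne⟩
  · intro i; fin_cases i
    · exact ⟨h1.subset, h2.subset⟩
    · exact ⟨h3.subset, h4.subset⟩

lemma noDia_chain {n : ℕ} {F : Finset (Finset (Fin n))} (hF : NoDia F)
    {A B C D : Finset (Fin n)} (hA : A ∈ F) (hB : B ∈ F) (hC : C ∈ F) (hD : D ∈ F)
    (h1 : A ⊂ B) (h2 : B ⊂ C) (h3 : C ⊂ D) : False :=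
  h2.ne (hF A hA B hB C hC D hD h1 (h2.trans h3) (h1.trans h2) h3)

/-- A chain of three members of `F`. -/
def Tri {n : ℕ} (F : Finset (Finset (Fin n))) (A B C : Finset (Fin n)) : Prop :=
  A ∈ F ∧ B ∈ F ∧ C ∈ F ∧ A ⊂ B ∧ B ⊂ C

lemma tri_unique {n : ℕ} {F : Finset (Finset (Fin n))} (hF : NoDia F) {g : Numbering (Fin n)}
    {A B C A' B' C' : Finset (Fin n)} (h : Tri F A B C) (h' : Tri F A' B' C')
    (pA : g.IsPrefix A) (pC : g.IsPrefix C) (pA' : g.IsPrefix A') (pC' : g.IsPrefix C') :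
    B = B' := by
  obtain ⟨hA, hB, hC, h1, h2⟩ := h
  obtain ⟨hA', hB', hC', h1', h2'⟩ := h'
  have eA : A = A' := by
    rcases prefix_cmp pA pA' with e | e | e
    · exact (noDia_chain hF hA hA' hB' hC' e h1' h2').elim
    · exact e
    · exact (noDia_chain hF hA' hA hB hC e h1 h2).elim
  have eC : C = C' := by
    rcases prefix_cmp pC pC' with e | e | e
    · exact (noDia_chain hF hA hB hC hC' h1 h2 e).elim
    · exact e
    · exact (noDia_chain hF hA' hB' hC' hC h1' h2' e).elim
  subst eA eC
  have res := hF A hA B hB B' hB' C hC h1 h2 h1' h2'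
  exact res

/-- The chain of the numbering meets `F` in a chain of three sets. -/
def Full {n : ℕ} (F : Finset (Finset (Fin n))) (f : Numbering (Fin n)) : Prop :=
  ∃ A B C, Tri F A B C ∧ f.IsPrefix A ∧ f.IsPrefix B ∧ f.IsPrefix C

open Classical in
lemma two_mul_full {n : ℕ} {F : Finset (Finset (Fin n))} (hF : NoDia F) :
    2 * #{f : Numbering (Fin n) | Full F f} ≤ n.factorial := by
  have ch : ∀ f : Numbering (Fin n), ∃ A B C, Full F f →
      Tri F A B C ∧ f.IsPrefix A ∧ f.IsPrefix B ∧ f.IsPrefix C := by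
    intro f
    by_cases h : Full F f
    · obtain ⟨A, B, C, h⟩ := h
      exact ⟨A, B, C, fun _ => h⟩
    · exact ⟨∅, ∅, ∅, fun h' => (h h').elim⟩
  choose A B C hABC using ch
  have pA : ∀ f, Full F f → (swapAt #(B f) f).IsPrefix (A f) := fun f hf => by
    obtain ⟨⟨_, _, _, h1, h2⟩, a, b, c⟩ := hABC f hf
    exact swapAt_prefix a (card_lt_card h1).ne
  have pC : ∀ f, Full F f → (swapAt #(B f) f).IsPrefix (C f) := fun f hf => by
    obtain ⟨⟨_, _, _, h1, h2⟩, a, b, c⟩ := hABC f hf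
    exact swapAt_prefix c (card_lt_card h2).ne'
  have key : #{f : Numbering (Fin n) | Full F f} ≤ #{f : Numbering (Fin n) | ¬ Full F f} := by
    apply card_le_card_of_injOn (fun f => swapAt #(B f) f)
    · intro f hf
      replace hf : Full F f := by simpa using hf
      suffices ¬ Full F (swapAt #(B f) f) by simpa using this
      rintro ⟨A', B', C', ht, a', b', c'⟩
      obtain ⟨ht0, a, b, c⟩ := hABC f hf
      have e := tri_unique hF ht0 ht (pA f hf) (pC f hf) a' c'
      rw [← e] at b'
      refine swapAt_not_prefix b ?_ ?_ b'
      · have := card_lt_card ht0.2.2.2.1; omega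
      · exact (card_lt_card ht0.2.2.2.2).trans_le (card_le_univ _)
    · intro f hf g hg hfg
      replace hf : Full F f := by simpa using hf
      replace hg : Full F g := by simpa using hg
      replace hfg : swapAt #(B f) f = swapAt #(B g) g := hfg
      have e : B f = B g := tri_unique hF (hABC f hf).1 (hABC g hg).1 (pA f hf) (pC f hf)
        (hfg ▸ pA g hg) (hfg ▸ pC g hg)
      rw [← swapAt_swapAt #(B f) f, hfg, e, swapAt_swapAt]
  have tot : #{f : Numbering (Fin n) | Full F f} + #{f : Numbering (Fin n) | ¬ Full F f} =
      #(univ : Finset (Numbering (Fin n))) := card_filter_add_card_filter_not (Full F)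
  rw [card_univ, card_numb] at tot
  omega

open Classical in
lemma count_le {n : ℕ} {F : Finset (Finset (Fin n))} (hF : NoDia F) (f : Numbering (Fin n)) :
    #{A ∈ F | f.IsPrefix A} ≤ 2 + if Full F f then 1 else 0 := by
  split_ifs with h
  · obtain ⟨A, B, C, ⟨hA, hB, hC, h1, h2⟩, a, b, c⟩ := h
    refine (card_le_card (t := {A, B, C}) ?_).trans card_le_three
    intro D hD
    obtain ⟨hD, d⟩ := mem_filter.1 hD
    simp only [mem_insert, mem_singleton]
    rcases prefix_cmp a d with e | e | e
    · rcases prefix_cmp c d with e' | e' | e'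
      · exact (noDia_chain hF hA hB hC hD h1 h2 e').elim
      · exact .inr (.inr e'.symm)
      · exact .inr (.inl (hF A hA D hD B hB C hC e e' h1 h2))
    · exact .inl e.symm
    · exact (noDia_chain hF hD hA hB hC e h1 h2).elim
  · by_contra hc
    have hc : 2 < #{A ∈ F | f.IsPrefix A} := by omega
    obtain ⟨A, B, C, hA, hB, hC, ab, ac, bc⟩ := two_lt_card_iff.1 hc
    obtain ⟨hA, a⟩ := mem_filter.1 hA
    obtain ⟨hB, b⟩ := mem_filter.1 hB
    obtain ⟨hC, c⟩ := mem_filter.1 hC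
    apply h
    rcases prefix_cmp a b with e | e | e <;> rcases prefix_cmp b c with e' | e' | e' <;>
      rcases prefix_cmp a c with e'' | e'' | e'' <;> try contradiction
    · exact ⟨A, B, C, ⟨hA, hB, hC, e, e'⟩, a, b, c⟩
    · exact ⟨A, B, C, ⟨hA, hB, hC, e, e'⟩, a, b, c⟩
    · exact ⟨A, C, B, ⟨hA, hC, hB, e'', e'⟩, a, c, b⟩
    · exact ⟨C, A, B, ⟨hC, hA, hB, e'', e⟩, c, a, b⟩
    · exact ⟨B, A, C, ⟨hB, hA, hC, e, e''⟩, b, a, c⟩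
    · exact ⟨B, C, A, ⟨hB, hC, hA, e', e''⟩, b, c, a⟩
    · exact ⟨C, B, A, ⟨hC, hB, hA, e', e⟩, c, b, a⟩
    · exact ⟨C, B, A, ⟨hC, hB, hA, e', e⟩, c, b, a⟩

lemma lubell_mul {n : ℕ} (F : Finset (Finset (Fin n))) :
    lubell n F * n.factorial =
      ((∑ f : Numbering (Fin n), #{A ∈ F | f.IsPrefix A} : ℕ) : ℝ) := by
  have h := sum_card_bipartiteAbove_eq_sum_card_bipartiteBelow
    (s := (univ : Finset (Numbering (Fin n)))) (t := F) (fun f A => f.IsPrefix A)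
  simp only [bipartiteAbove, bipartiteBelow] at h
  rw [h, lubell, sum_mul, Nat.cast_sum]
  refine sum_congr rfl fun A _ => ?_
  have h2 : #{f : Numbering (Fin n) | f.IsPrefix A} = (#A).factorial * (n - #A).factorial :=
    (Numbering.card_prefixed A).trans
      (congrArg (fun k => (#A).factorial * (k - #A).factorial) (Fintype.card_fin n))
  have hle : #A ≤ n := by simpa using A.card_le_univ
  rw [h2, ← Nat.choose_mul_factorial_mul_factorial hle]
  have : (n.choose #A : ℝ) ≠ 0 := by exact_mod_cast (Nat.choose_pos hle).ne'
  push_cast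
  field_simp

/-- Every diamond-free (`D_2`-free) family has Lubell function at most `5/2`. -/
theorem lubell_le_of_diamondFree (n : ℕ) (hn : 1 ≤ n)
    (F : Finset (Finset (Fin n))) (hF : DkFree n 2 F) :
    lubell n F ≤ 5 / 2 := by
  classical
  have hD := noDia_of hF
  have h1 : ∑ f : Numbering (Fin n), #{A ∈ F | f.IsPrefix A} ≤
      2 * n.factorial + #{f : Numbering (Fin n) | Full F f} := by
    refine (sum_le_sum fun f _ => count_le hD f).trans ?_
    rw [sum_add_distrib, sum_const, card_univ, card_numb,
      card_filter, smul_eq_mul, mul_comm]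
  have h2 := two_mul_full hD
  have h3 : 2 * ∑ f : Numbering (Fin n), #{A ∈ F | f.IsPrefix A} ≤ 5 * n.factorial := by
    have : #{f : Numbering (Fin n) | Full F f} * 2 ≤ n.factorial := by
      rw [mul_comm]; convert h2
    omega
  have h4 := lubell_mul F
  have h5 : (2 : ℝ) * ((∑ f : Numbering (Fin n), #{A ∈ F | f.IsPrefix A} : ℕ) : ℝ) ≤
      5 * n.factorial := by exact_mod_cast h3
  rw [← h4] at h5
  have pos : (0 : ℝ) < n.factorial := by exact_mod_cast n.factorial_pos
  refine le_of_mul_le_mul_right ?_ pos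
  linarith
end

section
/- Let n ≥ 1 and let F be a butterfly-free family of subsets of [n] with ∅ ∉ F and [n] ∉ F. Then the Lubell function satisfies h̄(F) ≤ 2. -/
open Finset

/-- `F` is butterfly-free: there are no pairwise distinct `A, B, C, D ∈ F`
with `A ⊆ C`, `A ⊆ D`, `B ⊆ C`, `B ⊆ D`. -/
def ButterflyFree (n : ℕ) (F : Finset (Finset (Fin n))) : Prop :=
  ¬ ∃ A B C D : Finset (Fin n),
      A ∈ F ∧ B ∈ F ∧ C ∈ F ∧ D ∈ F ∧
      A ≠ B ∧ A ≠ C ∧ A ≠ D ∧ B ≠ C ∧ B ≠ D ∧ C ≠ D ∧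
      A ⊆ C ∧ A ⊆ D ∧ B ⊆ C ∧ B ⊆ D

open Numbering in
lemma two_mul_prefixed_le {n : ℕ} (S T : Finset (Fin n)) (x y : Fin n) (hx : x ∈ S) (hy : y ∉ S)
    (hT : x ∈ T ↔ y ∈ T) :
    2 * (prefixed T ∩ prefixed S).card ≤ (prefixed T).card := by
  have h1 : (prefixed T ∩ prefixed S).card ≤ (prefixed T \ prefixed S).card := by
    refine Finset.card_le_card_of_injOn (fun f => (Equiv.swap x y).trans f) ?_ ?_
    · intro f hf
      simp only [Finset.coe_inter, Set.mem_inter_iff, Finset.mem_coe, mem_prefixed] at hf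
      simp only [Finset.coe_sdiff, Set.mem_sdiff, Finset.mem_coe, mem_prefixed]
      obtain ⟨hfT, hfS⟩ := hf
      refine ⟨?_, ?_⟩
      · intro z
        rw [Equiv.trans_apply, ← hfT]
        by_cases hzx : z = x
        · subst hzx; rw [Equiv.swap_apply_left]; exact hT
        by_cases hzy : z = y
        · subst hzy; rw [Equiv.swap_apply_right]; exact hT.symm
        rw [Equiv.swap_apply_of_ne_of_ne hzx hzy]
      · intro h
        have := (h x).1 hx
        rw [Equiv.trans_apply, Equiv.swap_apply_left, ← hfS] at this
        exact hy this
    · intro f _ g _ hfg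
      ext z
      have := congrArg (fun e : Fin n ≃ _ => e (Equiv.swap x y z)) hfg
      simp at this
      rw [this]
  have h2 := Finset.card_inter_add_card_sdiff (prefixed T) (prefixed S)
  omega

/-- The pointwise inequality along a chain (the sets satisfying `P`). -/
lemma chain_bound {n : ℕ} (F M : Finset (Finset (Fin n))) (hF : ButterflyFree n F)
    (hM : ∀ B, B ∈ M ↔ B ∈ F ∧ (∃ A ∈ F, A ⊂ B) ∧ ∃ C ∈ F, B ⊂ C)
    (a c : Finset (Fin n) → Finset (Fin n))
    (ha : ∀ B ∈ M, a B ∈ F ∧ a B ⊂ B) (hc : ∀ B ∈ M, c B ∈ F ∧ B ⊂ c B)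
    (P : Finset (Fin n) → Prop) [DecidablePred P]
    (hP : ∀ A B, P A → P B → A ⊆ B ∨ B ⊆ A) :
    ∑ A ∈ F, (if P A then (1 : ℤ) else 0) ≤
      2 + ∑ B ∈ M, ((if P B ∧ P (a B) then (1 : ℤ) else 0) + (if P B ∧ P (c B) then 1 else 0)
        - (if P B then 1 else 0)) := by
  have hP' : ∀ A B, P A → P B → A ≠ B → A ⊂ B ∨ B ⊂ A := by
    intro A B hA hB hne
    rcases hP A B hA hB with h | h
    · exact Or.inl (h.ssubset_of_ne hne)
    · exact Or.inr (h.ssubset_of_ne hne.symm)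
  have hua : ∀ B ∈ M, ∀ D ∈ F, D ⊂ B → D = a B := by
    intro B hB D hD hDB
    by_contra hne
    obtain ⟨h1, h2⟩ := ha B hB
    obtain ⟨h3, h4⟩ := hc B hB
    exact hF ⟨D, a B, B, c B, hD, h1, ((hM B).1 hB).1, h3, hne, hDB.ne, (hDB.trans h4).ne, h2.ne,
      (h2.trans h4).ne, h4.ne, hDB.subset, (hDB.trans h4).subset, h2.subset, (h2.trans h4).subset⟩
  have huc : ∀ B ∈ M, ∀ D ∈ F, B ⊂ D → D = c B := by
    intro B hB D hD hDB
    by_contra hne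
    obtain ⟨h1, h2⟩ := ha B hB
    obtain ⟨h3, h4⟩ := hc B hB
    exact hF ⟨a B, B, c B, D, h1, ((hM B).1 hB).1, h3, hD, h2.ne, (h2.trans h4).ne,
      (h2.trans hDB).ne, h4.ne, hDB.ne, fun h => hne h.symm, (h2.trans h4).subset,
      (h2.trans hDB).subset, h4.subset, hDB.subset⟩
  have hno : ∀ B ∈ M, ∀ D ∈ M, ¬ B ⊂ D := by
    intro B hB D hD hBD
    obtain ⟨h1, h2⟩ := ha B hB
    obtain ⟨h3, h4⟩ := hc D hD
    have e1 := huc B hB D ((hM D).1 hD).1 hBD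
    have e2 := huc B hB _ h3 (hBD.trans h4)
    exact h4.ne (e1.trans e2.symm)
  by_cases hex : ∃ B ∈ M, P B
  · obtain ⟨B, hB, hPB⟩ := hex
    have hs : ∑ B ∈ M, ((if P B ∧ P (a B) then (1 : ℤ) else 0) +
        (if P B ∧ P (c B) then 1 else 0) - (if P B then 1 else 0)) =
        (if P (a B) then (1 : ℤ) else 0) + (if P (c B) then 1 else 0) - 1 := by
      rw [Finset.sum_eq_single_of_mem B hB]
      · simp [hPB]
      · intro D hD hne
        have : ¬ P D := fun hPD => by
          rcases hP' D B hPD hPB hne with h | h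
          · exact hno D hD B hB h
          · exact hno B hB D hD h
        simp [this]
    rw [hs]
    obtain ⟨h1, h2⟩ := ha B hB
    obtain ⟨h3, h4⟩ := hc B hB
    have hsub : ({a B, B, c B} : Finset (Finset (Fin n))) ⊆ F := by
      intro D hD
      simp only [Finset.mem_insert, Finset.mem_singleton] at hD
      rcases hD with rfl | rfl | rfl
      · exact h1
      · exact ((hM _).1 hB).1
      · exact h3
    rw [← Finset.sum_subset hsub]
    · rw [Finset.sum_insert, Finset.sum_insert, Finset.sum_singleton]
      · simp only [hPB, if_true]; linarith
      · simpa using h4.ne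
      · simp only [Finset.mem_insert, Finset.mem_singleton, not_or]
        exact ⟨h2.ne, (h2.trans h4).ne⟩
    · intro D hD hDn
      simp only [Finset.mem_insert, Finset.mem_singleton, not_or] at hDn
      rw [if_neg]
      intro hPD
      rcases hP' D B hPD hPB hDn.2.1 with h | h
      · exact hDn.1 (hua B hB D hD h)
      · exact hDn.2.2 (huc B hB D hD h)
  · push Not at hex
    rw [Finset.sum_eq_zero (s := M) (by intro B hB; simp [hex B hB]), Finset.sum_boole]
    have key : ∀ X Y Z, X ∈ F → Y ∈ F → Z ∈ F → P Y → X ⊂ Y → Y ⊂ Z → False :=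
      fun X Y Z hX hY hZ hPY h1 h2 => hex Y ((hM Y).2 ⟨hY, ⟨X, hX, h1⟩, ⟨Z, hZ, h2⟩⟩) hPY
    by_contra hlt
    have h2 : 2 < (F.filter P).card := by
      by_contra h
      apply hlt
      have : (F.filter P).card ≤ 2 := by omega
      exact_mod_cast this
    obtain ⟨X, Y, Z, hX, hY, hZ, hXY, hXZ, hYZ⟩ := Finset.two_lt_card_iff.1 h2
    rw [Finset.mem_filter] at hX hY hZ
    rcases hP' X Y hX.2 hY.2 hXY with e1 | e1 <;> rcases hP' X Z hX.2 hZ.2 hXZ with e2 | e2 <;>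
      rcases hP' Y Z hY.2 hZ.2 hYZ with e3 | e3 <;>
      first
      | exact key _ _ _ hX.1 hY.1 hZ.1 hY.2 (by assumption) (by assumption)
      | exact key _ _ _ hX.1 hZ.1 hY.1 hZ.2 (by assumption) (by assumption)
      | exact key _ _ _ hY.1 hX.1 hZ.1 hX.2 (by assumption) (by assumption)
      | exact key _ _ _ hY.1 hZ.1 hX.1 hZ.2 (by assumption) (by assumption)
      | exact key _ _ _ hZ.1 hX.1 hY.1 hX.2 (by assumption) (by assumption)
      | exact key _ _ _ hZ.1 hY.1 hX.1 hY.2 (by assumption) (by assumption)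

open Numbering in
lemma sum_prefixed_le {n : ℕ} (F : Finset (Finset (Fin n))) (hF : ButterflyFree n F)
    (h0 : ∅ ∉ F) (h1 : (Finset.univ : Finset (Fin n)) ∉ F) :
    ∑ A ∈ F, ((prefixed A).card : ℤ) ≤ 2 * (n.factorial : ℤ) := by
  classical
  let M := F.filter (fun B => (∃ A ∈ F, A ⊂ B) ∧ ∃ C ∈ F, B ⊂ C)
  have hM : ∀ B, B ∈ M ↔ B ∈ F ∧ (∃ A ∈ F, A ⊂ B) ∧ ∃ C ∈ F, B ⊂ C := fun B => Finset.mem_filter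
  have hex1 : ∀ B, ∃ A, B ∈ M → A ∈ F ∧ A ⊂ B := by
    intro B
    by_cases hB : B ∈ M
    · obtain ⟨A, hA⟩ := ((hM B).1 hB).2.1
      exact ⟨A, fun _ => hA⟩
    · exact ⟨∅, fun h => absurd h hB⟩
  have hex2 : ∀ B, ∃ A, B ∈ M → A ∈ F ∧ B ⊂ A := by
    intro B
    by_cases hB : B ∈ M
    · obtain ⟨A, hA⟩ := ((hM B).1 hB).2.2
      exact ⟨A, fun _ => hA⟩
    · exact ⟨∅, fun h => absurd h hB⟩
  choose a ha using hex1
  choose c hc using hex2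
  have hpt : ∀ f : Numbering (Fin n), _ := fun f => chain_bound F M hF hM a c ha hc
    (fun A => IsPrefix f A) (by
      intro A B hA hB
      rcases le_total A.card B.card with h | h
      · exact Or.inl (hA.subset_of_card_le_card hB h)
      · exact Or.inr (hB.subset_of_card_le_card hA h))
  have hsum := Finset.sum_le_sum (s := (Finset.univ : Finset (Numbering (Fin n))))
    (fun f _ => hpt f)
  rw [Finset.sum_comm, Finset.sum_add_distrib, Finset.sum_comm (s := Finset.univ) (t := M)] at hsum
  have hM0 : ∑ B ∈ M, ∑ f : Numbering (Fin n),
      ((if IsPrefix f B ∧ IsPrefix f (a B) then (1 : ℤ) else 0) +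
      (if IsPrefix f B ∧ IsPrefix f (c B) then 1 else 0) - (if IsPrefix f B then 1 else 0)) ≤ 0 := by
    apply Finset.sum_nonpos
    intro B hB
    rw [Finset.sum_sub_distrib, Finset.sum_add_distrib, Finset.sum_boole, Finset.sum_boole,
      Finset.sum_boole, Finset.filter_and, Finset.filter_and]
    obtain ⟨haF, haB⟩ := ha B hB
    obtain ⟨hcF, hcB⟩ := hc B hB
    have i1 : 2 * (prefixed B ∩ prefixed (a B)).card ≤ (prefixed B).card := by
      obtain ⟨x, hx⟩ : (a B).Nonempty := by
        rw [Finset.nonempty_iff_ne_empty]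
        rintro h
        exact h0 (h ▸ haF)
      obtain ⟨y, hyB, hy⟩ := Finset.exists_of_ssubset haB
      exact two_mul_prefixed_le _ _ x y hx hy (iff_of_true (haB.subset hx) hyB)
    have i2 : 2 * (prefixed B ∩ prefixed (c B)).card ≤ (prefixed B).card := by
      obtain ⟨x, hx, hxB⟩ := Finset.exists_of_ssubset hcB
      obtain ⟨y, hy⟩ : ∃ y, y ∉ c B := by
        by_contra h
        push Not at h
        exact h1 (Finset.eq_univ_of_forall h ▸ hcF)
      exact two_mul_prefixed_le _ _ x y hx hy (iff_of_false hxB (fun h => hy (hcB.subset h)))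
    unfold prefixed at i1 i2
    have i1' := (Nat.cast_le (α := ℤ)).2 i1
    have i2' := (Nat.cast_le (α := ℤ)).2 i2
    push_cast at i1' i2'
    linarith
  have e1 : ∑ A ∈ F, ∑ f : Numbering (Fin n), (if IsPrefix f A then (1 : ℤ) else 0) =
      ∑ A ∈ F, ((prefixed A).card : ℤ) := by
    refine Finset.sum_congr rfl fun A _ => ?_
    rw [Finset.sum_boole]; rfl
  have e2 : ∑ f : Numbering (Fin n), (2 : ℤ) = 2 * (n.factorial : ℤ) := by
    rw [Finset.sum_const, Finset.card_univ, Fintype.card_numbering, Fintype.card_fin]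
    simp [mul_comm]
  rw [e1, e2] at hsum
  linarith

/-- A butterfly-free family containing neither `∅` nor `[n]` has
Lubell function at most `2`. -/
theorem lubell_le_two_of_butterflyFree (n : ℕ) (hn : 1 ≤ n)
    (F : Finset (Finset (Fin n))) (hF : ButterflyFree n F)
    (h0 : ∅ ∉ F) (h1 : (Finset.univ : Finset (Fin n)) ∉ F) :
    lubell n F ≤ 2 := by
  have h := sum_prefixed_le F hF h0 h1
  have h' : ∑ A ∈ F, ((Numbering.prefixed A).card : ℝ) ≤ 2 * (n.factorial : ℝ) := by
    exact_mod_cast h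
  have hpos : (0 : ℝ) < n.factorial := by exact_mod_cast n.factorial_pos
  have he : lubell n F = (∑ A ∈ F, ((Numbering.prefixed A).card : ℝ)) / n.factorial := by
    unfold lubell
    rw [Finset.sum_div]
    refine Finset.sum_congr rfl fun A _ => ?_
    have hA : A.card ≤ n := by simpa using A.card_le_univ
    rw [Numbering.card_prefixed, Fintype.card_fin, Nat.cast_choose ℝ hA]
    push_cast
    rw [one_div_div]
  rw [he, div_le_iff₀ hpos]
  exact h'
end

section
/- For every n ≥ 7, every diamond-free family F of subsets of [n] satisfies |F| < 2.296 · C(n, ⌊n/2⌋). -/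
open Finset

section core
variable {X : Type*} [Fintype X] [DecidableEq X]
open Numbering Nat

lemma card_prefixed_pair (A Y : Finset X) (h : A ⊆ Y) :
    #{f ∈ prefixed Y | IsPrefix f A} * (#Y).choose #A = #(prefixed Y) := by
  have hA : #(A.subtype (· ∈ Y)) = #A := by
    rw [← Finset.card_map (Function.Embedding.subtype _), Finset.subtype_map_of_mem]
    exact fun x hx => h hx
  have e1 : #{f ∈ prefixed Y | IsPrefix f A} =
      Fintype.card {f : prefixed Y // IsPrefix f.1 A} := by
    rw [Fintype.card_subtype, ← Finset.card_map (Function.Embedding.subtype _)]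
    congr 1
    ext f
    simp [and_comm]
  have e2 : Fintype.card {f : prefixed Y // IsPrefix f.1 A} =
      Fintype.card {p : Numbering Y × Numbering ↑(Yᶜ) // IsPrefix p.1 (A.subtype (· ∈ Y))} := by
    refine Fintype.card_congr ((prefixedEquiv Y).subtypeEquiv ?_)
    intro f
    have hf := f.2
    rw [mem_prefixed] at hf
    have key : ∀ x : Y, (((prefixedEquiv Y f).1 x : Fin _) : ℕ) = (f.1 x : ℕ) := fun x => rfl
    unfold IsPrefix
    constructor
    · intro H x
      rw [key, hA, Finset.mem_subtype]
      exact H x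
    · intro H x
      by_cases hx : x ∈ Y
      · have := H ⟨x, hx⟩
        rw [key, hA, Finset.mem_subtype] at this
        exact this
      · have h1 : ¬ ((f.1 x : ℕ) < #Y) := fun h' => hx ((hf x).2 h')
        have h2 : #A ≤ #Y := Finset.card_le_card h
        constructor
        · intro hxA; exact absurd (h hxA) hx
        · intro h'; omega
  have e3 : Fintype.card {p : Numbering Y × Numbering ↑(Yᶜ) // IsPrefix p.1 (A.subtype (· ∈ Y))} =
      #(prefixed (A.subtype (· ∈ Y))) * Fintype.card (Numbering ↑(Yᶜ)) := by
    rw [Fintype.card_subtype, ← Finset.card_univ (α := Numbering ↑(Yᶜ)), ← Finset.card_product]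
    congr 1
    ext p
    simp
  rw [e1, e2, e3, card_prefixed, card_prefixed, hA, Fintype.card_numbering]
  simp only [Fintype.card_coe, Finset.card_compl]
  have := Nat.choose_mul_factorial_mul_factorial (Finset.card_le_card h)
  rw [← this]
  ring

lemma first_three (hm : 3 ≤ Fintype.card X) : ∃ K : ℝ, 0 < K ∧
    ∀ g : X → X → X → ℝ,
    ∑ f : Numbering X, g (f.symm ⟨0, by omega⟩) (f.symm ⟨1, by omega⟩) (f.symm ⟨2, by omega⟩)
      = K * ∑ a : X, ∑ b ∈ univ.erase a, ∑ c ∈ (univ.erase a).erase b, g a b c := by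
  classical
  set i0 : Fin (Fintype.card X) := ⟨0, by omega⟩
  set i1 : Fin (Fintype.card X) := ⟨1, by omega⟩
  set i2 : Fin (Fintype.card X) := ⟨2, by omega⟩
  let cnt : X × X × X → ℕ := fun t =>
    #{f : Numbering X | (f.symm i0, f.symm i1, f.symm i2) = t}
  have h01 : i0 ≠ i1 := by simp [i0, i1]
  have h02 : i0 ≠ i2 := by simp [i0, i2]
  have h12 : i1 ≠ i2 := by simp [i1, i2]
  let f0 : Numbering X := Fintype.equivFin X
  let t0 : X × X × X := (f0.symm i0, f0.symm i1, f0.symm i2)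
  have hcnt : ∀ a b c : X, b ≠ a → c ≠ b → c ≠ a → cnt (a, b, c) = cnt t0 := by
    intro a b c hba hcb hca
    obtain ⟨τ, hτ⟩ : ∃ τ : Equiv.Perm X, τ (f0.symm i0) = a ∧ τ (f0.symm i1) = b ∧
        τ (f0.symm i2) = c := by
      have hinj1 : Function.Injective (![f0.symm i0, f0.symm i1, f0.symm i2]) := by
        intro i j hij
        fin_cases i <;> fin_cases j <;> simp_all
      have hinj2 : Function.Injective (![a, b, c]) := by
        intro i j hij
        fin_cases i <;> fin_cases j <;> simp_all
      obtain ⟨τ, hτ⟩ := Equiv.Perm.exists_extending_pair _ _ hinj1 hinj2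
      exact ⟨τ, by simpa using hτ 0, by simpa using hτ 1, by simpa using hτ 2⟩
    obtain ⟨h0, h1, h2⟩ := hτ
    symm
    refine Finset.card_bij (fun f _ => τ.symm.trans f) ?_ ?_ ?_
    · intro f hf
      simp only [Finset.mem_filter, Finset.mem_univ, true_and, t0, Prod.mk.injEq] at hf ⊢
      simp [hf, h0, h1, h2]
    · intro f _ f' _ h
      ext x
      have := DFunLike.congr_fun h (τ x)
      simp at this
      rw [this]
    · intro f hf
      refine ⟨τ.trans f, ?_, ?_⟩
      · simp only [Finset.mem_filter, Finset.mem_univ, true_and, t0, Prod.mk.injEq] at hf ⊢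
        simp [hf, ← h0, ← h1, ← h2]
      · ext x; simp
  refine ⟨cnt t0, ?_, ?_⟩
  · have : 0 < cnt t0 := Finset.card_pos.2 ⟨f0, by simp [t0]⟩
    exact_mod_cast this
  intro g
  have e1 : ∑ f : Numbering X, g (f.symm i0) (f.symm i1) (f.symm i2) =
      ∑ t : X × X × X, (cnt t : ℝ) * g t.1 t.2.1 t.2.2 := by
    rw [← Finset.sum_fiberwise (s := univ)
      (g := fun f : Numbering X => (f.symm i0, f.symm i1, f.symm i2))]
    refine Finset.sum_congr rfl fun t _ => ?_
    rw [← nsmul_eq_mul, ← Finset.sum_const]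
    refine Finset.sum_congr rfl fun f hf => ?_
    simp only [Finset.mem_filter, Finset.mem_univ, true_and] at hf
    rw [← hf]
  rw [e1, Fintype.sum_prod_type, Finset.mul_sum]
  refine Finset.sum_congr rfl fun a _ => ?_
  rw [Fintype.sum_prod_type, Finset.mul_sum]
  have z : ∀ a b c : X, (b = a ∨ c = b ∨ c = a) → cnt (a, b, c) = 0 := by
    intro a b c h
    rw [Finset.card_eq_zero, Finset.filter_eq_empty_iff]
    intro f _ hf
    simp only [Prod.mk.injEq] at hf
    obtain ⟨rfl, rfl, rfl⟩ := hf
    simp only [EmbeddingLike.apply_eq_iff_eq] at h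
    rcases h with h | h | h
    · exact h01 h.symm
    · exact h12 h.symm
    · exact h02 h.symm
  rw [← Finset.sum_erase (s := univ) (a := a)]
  · refine Finset.sum_congr rfl fun b hb => ?_
    rw [Finset.mul_sum]
    symm
    refine Finset.sum_subset_zero_on_sdiff (Finset.subset_univ _) ?_ ?_
    · intro c hc
      simp only [Finset.mem_sdiff, Finset.mem_univ, true_and, Finset.mem_erase, not_and_or, and_true, not_not] at hc
      rw [z a b c (by tauto)]; simp
    · intro c hc
      simp only [Finset.mem_erase, Finset.mem_univ, and_true] at hc hb
      rw [hcnt a b c hb hc.1 hc.2]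
  · refine Finset.sum_eq_zero fun c _ => ?_
    rw [z a a c (by tauto)]; simp
end core


section core2
variable {X : Type*} [Fintype X] [DecidableEq X]
open Numbering Nat

/-- weight bound for the larger set of a comparable pair -/
noncomputable def omg (k : ℕ) : ℝ := if k = 2 then 1/2 else if k = 3 then 1/3 else 1/4

lemma le_choose_mid : ∀ y a : ℕ, 0 < a → a < y → y ≤ y.choose a := by
  intro y
  induction y with
  | zero => intro a h1 h2; omega
  | succ y ih =>
    intro a h1 h2
    obtain ⟨b, rfl⟩ : ∃ b, a = b + 1 := ⟨a - 1, by omega⟩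
    rw [Nat.choose_succ_succ']
    rcases Nat.lt_or_ge (b + 1) y with h | h
    · have := ih (b+1) (by omega) h
      have := Nat.choose_pos (n := y) (k := b) (by omega)
      omega
    · have : y = b + 1 := by omega
      subst this
      simp

lemma omg_mul {y : ℕ} (hy : 2 ≤ y) : 1 ≤ omg y * y := by
  unfold omg
  have : (2:ℝ) ≤ y := by exact_mod_cast hy
  split_ifs with h1 h2
  · subst h1; norm_num
  · subst h2; norm_num
  · have : 4 ≤ y := by omega
    have : (4:ℝ) ≤ y := by exact_mod_cast this
    linarith

noncomputable def cpairs (H : Finset (Finset X)) : Finset (Finset X × Finset X) :=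
  (H ×ˢ H).filter fun p => p.1 ⊂ p.2

noncomputable def Wf (H : Finset (Finset X)) (f : Numbering X) : ℝ :=
  ∑ p ∈ (cpairs H).filter (fun p => IsPrefix f p.2), omg #p.2

open Classical in
noncomputable def Zf (H : Finset (Finset X)) (f : Numbering X) : ℝ :=
  if ∃ Y ∈ H, IsPrefix f Y then 0 else 1

lemma pointwise_hits (H : Finset (Finset X)) (f : Numbering X) :
    (#(H.filter (fun Y => IsPrefix f Y)) : ℝ) - 1 ≤
      #((cpairs H).filter (fun p => IsPrefix f p.2 ∧ IsPrefix f p.1)) - Zf H f := by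
  classical
  unfold Zf
  by_cases hne : ∃ Y ∈ H, IsPrefix f Y
  · rw [if_pos hne]
    have hne' : (H.filter (fun Y => IsPrefix f Y)).Nonempty := by
      obtain ⟨Y, h1, h2⟩ := hne
      exact ⟨Y, by simp [h1, h2]⟩
    obtain ⟨A, hA, hmin⟩ := Finset.exists_min_image _ (fun Y => #Y) hne'
    have : #((H.filter (fun Y => IsPrefix f Y)).erase A) ≤
        #((cpairs H).filter (fun p => IsPrefix f p.2 ∧ IsPrefix f p.1)) := by
      refine Finset.card_le_card_of_injOn (fun Y => (A, Y)) ?_ ?_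
      · intro Y hY
        have hY' := Finset.mem_erase.1 (Finset.mem_coe.1 hY)
        have h3 := hmin Y hY'.2
        simp only [Finset.mem_filter] at hA hY'
        have hs := hA.2.subset_of_card_le_card hY'.2.2 h3
        simp only [cpairs, Finset.coe_filter, Finset.mem_filter, Finset.mem_product, Set.mem_ofPred_eq]
        exact ⟨⟨⟨hA.1, hY'.2.1⟩, hs.ssubset_of_ne (Ne.symm hY'.1)⟩, hY'.2.2, hA.2⟩
      · intro Y _ Y' _ h
        simpa using h
    rw [Finset.card_erase_of_mem hA] at this
    have h2 : #(H.filter (fun Y => IsPrefix f Y)) ≤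
      #((cpairs H).filter (fun p => IsPrefix f p.2 ∧ IsPrefix f p.1)) + 1 := by omega
    have : (#(H.filter (fun Y => IsPrefix f Y)) : ℝ) ≤
      #((cpairs H).filter (fun p => IsPrefix f p.2 ∧ IsPrefix f p.1)) + 1 := by exact_mod_cast h2
    linarith
  · rw [if_neg hne]
    have : H.filter (fun Y => IsPrefix f Y) = ∅ := by
      rw [Finset.filter_eq_empty_iff]
      intro Y hY h
      exact hne ⟨Y, hY, h⟩
    rw [this]
    simp

lemma sum_hits_le (H : Finset (Finset X)) (h0 : ∅ ∉ H) :
    ∑ Y ∈ H, (#(prefixed Y) : ℝ) - (Fintype.card X)! ≤ ∑ f : Numbering X, (Wf H f - Zf H f) := by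
  classical
  have e1 : ∑ Y ∈ H, (#(prefixed Y) : ℝ) =
      ∑ f : Numbering X, (#(H.filter (fun Y => IsPrefix f Y)) : ℝ) := by
    simp only [prefixed, Finset.card_filter]
    push_cast
    rw [Finset.sum_comm]
  have e2 : ((Fintype.card X)! : ℝ) = ∑ f : Numbering X, (1:ℝ) := by
    simp
  have e3 : ∑ f : Numbering X, (#((cpairs H).filter (fun p => IsPrefix f p.2 ∧ IsPrefix f p.1)) : ℝ)
      = ∑ p ∈ cpairs H, (#{f ∈ prefixed p.2 | IsPrefix f p.1} : ℝ) := by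
    simp only [prefixed, Finset.card_filter, Finset.filter_filter]
    push_cast
    rw [Finset.sum_comm]
  have e4 : ∑ f : Numbering X, Wf H f = ∑ p ∈ cpairs H, omg #p.2 * #(prefixed p.2) := by
    simp only [Wf, prefixed, Finset.card_filter, Finset.sum_filter]
    rw [Finset.sum_comm]
    refine Finset.sum_congr rfl fun p _ => ?_
    push_cast
    rw [Finset.mul_sum]
    refine Finset.sum_congr rfl fun f _ => ?_
    split_ifs <;> simp
  have e5 : ∑ p ∈ cpairs H, (#{f ∈ prefixed p.2 | IsPrefix f p.1} : ℝ) ≤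
      ∑ p ∈ cpairs H, omg #p.2 * #(prefixed p.2) := by
    refine Finset.sum_le_sum fun p hp => ?_
    simp only [cpairs, Finset.mem_filter, Finset.mem_product] at hp
    obtain ⟨⟨h1, h2⟩, h3⟩ := hp
    have hc := card_prefixed_pair p.1 p.2 h3.subset
    have hA : 0 < #p.1 := by
      rw [Finset.card_pos, Finset.nonempty_iff_ne_empty]
      rintro h; exact h0 (h ▸ h1)
    have hlt := Finset.card_lt_card h3
    have hch := le_choose_mid _ _ hA hlt
    have ho := omg_mul (y := #p.2) (by omega)
    rw [← hc]
    push_cast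
    have hch' : (#p.2 : ℝ) ≤ ((#p.2).choose #p.1 : ℝ) := by exact_mod_cast hch
    have hop : 0 ≤ omg #p.2 := by unfold omg; split_ifs <;> norm_num
    have : 1 ≤ omg #p.2 * ((#p.2).choose #p.1 : ℝ) := ho.trans (by gcongr)
    have hn : (0:ℝ) ≤ #{f ∈ prefixed p.2 | IsPrefix f p.1} := by positivity
    nlinarith
  rw [e1, e2, ← Finset.sum_sub_distrib]
  calc _ ≤ ∑ f : Numbering X, ((#((cpairs H).filter
        (fun p => IsPrefix f p.2 ∧ IsPrefix f p.1)) : ℝ) - Zf H f) :=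
        Finset.sum_le_sum fun f _ => pointwise_hits H f
    _ ≤ _ := by
        rw [Finset.sum_sub_distrib, Finset.sum_sub_distrib, e3, e4]
        linarith

open Classical in
/-- upper bound by the first three elements -/
noncomputable def Phi (H : Finset (Finset X)) (a b c : X) : ℝ :=
  if {a} ∈ H then
    if {b} ∈ H then 0 else if {a, b} ∈ H then 1/2 else if {c} ∈ H then 0 else
      if {a, c} ∈ H ∨ {b, c} ∈ H then 0 else 1/3
  else if {b} ∈ H then
    if {a, b} ∈ H then 1/2 else if {c} ∈ H then 0 else
      if {a, c} ∈ H ∨ {b, c} ∈ H then -1 else 1/3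
  else if {c} ∈ H then
    if {a, b} ∈ H then 0 else if {a, c} ∈ H ∨ {b, c} ∈ H then -1 else 1/3
  else if {a, b} ∈ H then (if {a, c} ∈ H ∨ {b, c} ∈ H then 0 else 1/3)
  else if {a, c} ∈ H then (if {b, c} ∈ H then 0 else 1/3)
  else if {b, c} ∈ H then 1/3 else 1/4

lemma Wf_cases (H : Finset (Finset X)) (h0 : ∅ ∉ H)
    (hL : ∀ Y ∈ H, ∀ A ∈ H, ∀ B ∈ H, A ⊂ Y → B ⊂ Y → A = B) (f : Numbering X) :
    Wf H f = 0 ∨ ∃ A ∈ H, ∃ Y ∈ H, A ⊂ Y ∧ IsPrefix f Y ∧ Wf H f = omg #Y := by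
  classical
  have hcard : #((cpairs H).filter (fun p => IsPrefix f p.2)) ≤ 1 := by
    rw [Finset.card_le_one]
    have key : ∀ p ∈ (cpairs H).filter (fun p => IsPrefix f p.2),
        ∀ q ∈ (cpairs H).filter (fun p => IsPrefix f p.2), #p.2 ≤ #q.2 → p = q := by
      rintro ⟨A, Y⟩ hp ⟨A', Y'⟩ hq hle
      simp only [cpairs, Finset.mem_filter, Finset.mem_product] at hp hq hle
      have hs := hp.2.subset_of_card_le_card hq.2 hle
      rcases hs.eq_or_ssubset with h | h
      · subst h
        rw [hL Y hp.1.1.2 A hp.1.1.1 A' hq.1.1.1 hp.1.2 hq.1.2]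
      · exfalso
        have := hL Y' hq.1.1.2 A hp.1.1.1 Y hp.1.1.2 (hp.1.2.trans h) h
        exact hp.1.2.ne this
    intro p hp q hq
    rcases Nat.le_total #p.2 #q.2 with h | h
    · exact key p hp q hq h
    · exact (key q hq p hp h).symm
  rcases Nat.eq_zero_or_pos (#((cpairs H).filter (fun p => IsPrefix f p.2))) with h | h
  · left
    rw [Finset.card_eq_zero] at h
    unfold Wf
    rw [h]; simp
  · right
    have h1 : #((cpairs H).filter (fun p => IsPrefix f p.2)) = 1 := by omega
    obtain ⟨⟨A, Y⟩, hp⟩ := Finset.card_eq_one.1 h1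
    have hm : (A, Y) ∈ (cpairs H).filter (fun p => IsPrefix f p.2) := by rw [hp]; simp
    simp only [cpairs, Finset.mem_filter, Finset.mem_product] at hm
    refine ⟨A, hm.1.1.1, Y, hm.1.1.2, hm.1.2, hm.2, ?_⟩
    unfold Wf
    rw [hp]; simp

lemma ssub_three (A : Finset X) (a b c : X) (hA : A ≠ ∅) (hs : A ⊂ {a, b, c}) :
    A = {a} ∨ A = {b} ∨ A = {c} ∨ A = {a, b} ∨ A = {a, c} ∨ A = {b, c} := by
  have hsub := hs.subset
  have hne := hs.ne
  have hx : ∀ x, x ∈ A → x = a ∨ x = b ∨ x = c := fun x hx => by simpa using hsub hx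
  by_cases ia : a ∈ A <;> by_cases ib : b ∈ A <;> by_cases ic : c ∈ A
  · exact absurd (Finset.Subset.antisymm hsub (by simp [Finset.insert_subset_iff, ia, ib, ic])) hne
  · right; right; right; left; ext x; simp; grind
  · right; right; right; right; left; ext x; simp; grind
  · left; ext x; simp; grind
  · right; right; right; right; right; ext x; simp; grind
  · right; left; ext x; simp; grind
  · right; right; left; ext x; simp; grind
  · exfalso; apply hA; ext x; simp; grind

lemma phi_logic (Big pa pb pc pab pac pbc : Prop) [Decidable pa] [Decidable pb] [Decidable pc]
    [Decidable pab] [Decidable pac] [Decidable pbc] (W Z : ℝ) (Z0 : 0 ≤ Z)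
    (Z1 : ¬ Big → ¬ pa → ¬ pab → Z = 1)
    (W1 : W = 0 ∨ (W = 1/2 ∧ pab ∧ (pa ∨ pb)) ∨
      (Big ∧ W ≤ 1/3 ∧ (W ≤ 1/4 ∨ pa ∨ pb ∨ pc ∨ pab ∨ pac ∨ pbc)))
    (n1 : pa → pb → ¬ pab)
    (d_a_b : pa → pb → ¬ Big) (d_a_c : pa → pc → ¬ Big) (d_b_c : pb → pc → ¬ Big)
    (d1 : (pa ∨ pb ∨ pc) → (pab ∨ pac ∨ pbc) → ¬ Big)
    (dd1 : pab → pac → ¬ Big) (dd2 : pab → pbc → ¬ Big) (dd3 : pac → pbc → ¬ Big) :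
    W - Z ≤ (if pa then
    if pb then 0 else if pab then 1/2 else if pc then 0 else
      if pac ∨ pbc then 0 else 1/3
  else if pb then
    if pab then 1/2 else if pc then 0 else
      if pac ∨ pbc then -1 else 1/3
  else if pc then
    if pab then 0 else if pac ∨ pbc then -1 else 1/3
  else if pab then (if pac ∨ pbc then 0 else 1/3)
  else if pac then (if pbc then 0 else 1/3)
  else if pbc then 1/3 else 1/4) := by
  by_cases ha : pa <;> by_cases hb : pb <;> by_cases hc : pc <;> by_cases hab : pab <;>
    by_cases hac : pac <;> by_cases hbc : pbc <;> by_cases hB : Big <;>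
    simp only [ha, hb, hc, hab, hac, hbc, hB, if_true, if_false, true_or, or_true, false_or, or_false,
      true_and, and_true, false_and, and_false, not_true_eq_false, not_false_eq_true, forall_const,
      imp_false, or_self, and_self, IsEmpty.forall_iff] at * <;>
    first
      | linarith
      | (rcases W1 with h | h <;> linarith)
      | (rcases W1 with h | ⟨h, h'⟩ <;> linarith)
      | (rcases W1 with h | h | h <;> linarith)

set_option maxHeartbeats 2000000 in
lemma pointwise_Phi (H : Finset (Finset X)) (h0 : ∅ ∉ H)
    (hL : ∀ Y ∈ H, ∀ A ∈ H, ∀ B ∈ H, A ⊂ Y → B ⊂ Y → A = B) (f : Numbering X)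
    (hm : 3 ≤ Fintype.card X) :
    Wf H f - Zf H f ≤ Phi H (f.symm ⟨0, by omega⟩) (f.symm ⟨1, by omega⟩) (f.symm ⟨2, by omega⟩) := by
  classical
  set a := f.symm ⟨0, by omega⟩ with ha
  set b := f.symm ⟨1, by omega⟩ with hb
  set c := f.symm ⟨2, by omega⟩ with hc
  have fa : (f a : ℕ) = 0 := by simp [ha]
  have fb : (f b : ℕ) = 1 := by simp [hb]
  have fc : (f c : ℕ) = 2 := by simp [hc]
  have hab : a ≠ b := by intro h; rw [h] at fa; omega
  have hac : a ≠ c := by intro h; rw [h] at fa; omega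
  have hbc : b ≠ c := by intro h; rw [h] at fb; omega
  have c1 : ∀ x : X, #({x} : Finset X) = 1 := fun x => Finset.card_singleton x
  have c2 : ∀ {x y : X}, x ≠ y → #({x, y} : Finset X) = 2 := fun h => Finset.card_pair h
  have c3 : #({a, b, c} : Finset X) = 3 := Finset.card_eq_three.2 ⟨a, b, c, hab, hac, hbc, rfl⟩
  have Y1 : ∀ Y, IsPrefix f Y → 1 ≤ #Y → a ∈ Y := fun Y h hY => (h a).2 (by omega)
  have Y2 : ∀ Y, IsPrefix f Y → 2 ≤ #Y → b ∈ Y := fun Y h hY => (h b).2 (by omega)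
  have Y3 : ∀ Y, IsPrefix f Y → 3 ≤ #Y → c ∈ Y := fun Y h hY => (h c).2 (by omega)
  have Y3' : ∀ Y, IsPrefix f Y → 3 ≤ #Y → {a, b, c} ⊆ Y := by
    intro Y h hY
    simp only [Finset.insert_subset_iff, Finset.singleton_subset_iff]
    exact ⟨Y1 Y h (by omega), Y2 Y h (by omega), Y3 Y h hY⟩
  have Ye2 : ∀ Y, IsPrefix f Y → #Y = 2 → Y = {a, b} := by
    intro Y h hY
    symm
    refine Finset.eq_of_subset_of_card_le ?_ (by rw [c2 hab, hY])
    simp only [Finset.insert_subset_iff, Finset.singleton_subset_iff]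
    exact ⟨Y1 Y h (by omega), Y2 Y h (by omega)⟩
  have Ye1 : ∀ Y, IsPrefix f Y → #Y = 1 → Y = {a} := by
    intro Y h hY
    symm
    refine Finset.eq_of_subset_of_card_le ?_ (by rw [c1, hY])
    simp only [Finset.singleton_subset_iff]
    exact Y1 Y h (by omega)
  obtain ⟨Big, hBig⟩ : ∃ P : Prop, P ↔ ∃ Y ∈ H, IsPrefix f Y ∧ 3 ≤ #Y := ⟨_, Iff.rfl⟩
  have dead : ∀ U ∈ H, ∀ V ∈ H, U ⊆ {a, b, c} → V ⊆ {a, b, c} → #U ≤ 2 → #V ≤ 2 → U ≠ V → ¬ Big := by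
    intro U hU V hV hUs hVs hU2 hV2 hne hB
    obtain ⟨Y, hY, hp, h3⟩ := hBig.1 hB
    have hs := Y3' Y hp h3
    have key : ∀ U : Finset X, U ⊆ {a, b, c} → #U ≤ 2 → U ⊂ Y := by
      intro U hU h2
      refine (hU.trans hs).ssubset_of_ne ?_
      rintro rfl; omega
    exact hne (hL Y hY U hU V hV (key U hUs hU2) (key V hVs hV2))
  have Z0 : 0 ≤ Zf H f := by unfold Zf; split_ifs <;> norm_num
  have Z1 : ¬ Big → {a} ∉ H → {a, b} ∉ H → Zf H f = 1 := by
    intro hB h1 h2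
    unfold Zf
    rw [if_neg]
    rintro ⟨Y, hY, hp⟩
    have hpos : 0 < #Y := by
      rw [Finset.card_pos, Finset.nonempty_iff_ne_empty]
      rintro rfl; exact h0 hY
    rcases Nat.lt_or_ge #Y 3 with h | h
    · have : #Y = 1 ∨ #Y = 2 := by omega
      rcases this with h' | h'
      · exact h1 (Ye1 Y hp h' ▸ hY)
      · exact h2 (Ye2 Y hp h' ▸ hY)
    · exact hB (hBig.2 ⟨Y, hY, hp, h⟩)
  have sub3 : ∀ A : Finset X, A ≠ ∅ → A ⊂ {a, b, c} → A = {a} ∨ A = {b} ∨ A = {c} ∨ A = {a, b} ∨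
      A = {a, c} ∨ A = {b, c} := fun A => ssub_three A a b c
  have W1 : Wf H f = 0 ∨ (Wf H f = 1/2 ∧ {a, b} ∈ H ∧ ({a} ∈ H ∨ {b} ∈ H)) ∨
      (Big ∧ Wf H f ≤ 1/3 ∧ (Wf H f ≤ 1/4 ∨ {a} ∈ H ∨ {b} ∈ H ∨ {c} ∈ H ∨ {a, b} ∈ H ∨ {a, c} ∈ H
        ∨ {b, c} ∈ H)) := by
    rcases Wf_cases H h0 hL f with h | ⟨A, hA, Y, hY, hAY, hp, hw⟩
    · exact Or.inl h
    right
    have hA0 : A ≠ ∅ := by rintro rfl; exact h0 hA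
    have hpos : 0 < #A := Finset.card_pos.2 (Finset.nonempty_iff_ne_empty.2 hA0)
    have hlt := Finset.card_lt_card hAY
    rcases Nat.lt_or_ge #Y 3 with h | h
    · left
      have h2 : #Y = 2 := by omega
      have hY2 := Ye2 Y hp h2
      refine ⟨by rw [hw, h2]; simp [omg], hY2 ▸ hY, ?_⟩
      have hA1 : #A = 1 := by omega
      obtain ⟨x, rfl⟩ := Finset.card_eq_one.1 hA1
      have hx : x ∈ Y := hAY.subset (by simp)
      rw [hY2] at hx
      simp only [Finset.mem_insert, Finset.mem_singleton] at hx
      rcases hx with rfl | rfl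
      · exact Or.inl hA
      · exact Or.inr hA
    · right
      refine ⟨hBig.2 ⟨Y, hY, hp, h⟩, ?_, ?_⟩
      · rw [hw]; unfold omg; split_ifs with h1 h2
        · omega
        · norm_num
        · norm_num
      · by_cases h3 : #Y = 3
        · right
          have : Y = {a, b, c} := (Finset.eq_of_subset_of_card_le (Y3' Y hp h) (by omega)).symm
          rw [this] at hAY
          rcases sub3 A hA0 hAY with r | r | r | r | r | r <;> rw [r] at hA <;> simp [hA]
        · left
          rw [hw]; unfold omg; rw [if_neg (by omega), if_neg h3]
  have n1 : {a} ∈ H → {b} ∈ H → {a, b} ∉ H := by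
    intro h1 h2 h3
    have := hL _ h3 _ h1 _ h2 (by
      refine Finset.ssubset_iff_subset_ne.2 ⟨by simp, fun h => ?_⟩
      have := congrArg Finset.card h
      rw [c1, c2 hab] at this; omega) (by
      refine Finset.ssubset_iff_subset_ne.2 ⟨by simp, fun h => ?_⟩
      have := congrArg Finset.card h
      rw [c1, c2 hab] at this; omega)
    exact hab (Finset.singleton_injective this)
  have sa : ({a} : Finset X) ⊆ {a, b, c} := by simp
  have sb : ({b} : Finset X) ⊆ {a, b, c} := by simp
  have sc : ({c} : Finset X) ⊆ {a, b, c} := by simp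
  have sab : ({a, b} : Finset X) ⊆ {a, b, c} := by intro x; simp; tauto
  have sac : ({a, c} : Finset X) ⊆ {a, b, c} := by intro x; simp; tauto
  have sbc : ({b, c} : Finset X) ⊆ {a, b, c} := by intro x; simp; tauto
  have k1 : ∀ x : X, #({x} : Finset X) ≤ 2 := fun x => by rw [c1]; omega
  have k2 : ∀ x y : X, #({x, y} : Finset X) ≤ 2 := fun x y => Finset.card_le_two
  have nn : ∀ x y z : X, y ≠ z → ({x} : Finset X) ≠ {y, z} := by
    intro x y z h h'
    have := congrArg Finset.card h'
    rw [c1, c2 h] at this; omega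
  have d_a_b : {a} ∈ H → {b} ∈ H → ¬ Big := fun h1 h2 =>
    dead _ h1 _ h2 sa sb (k1 _) (k1 _) (by simpa using hab)
  have d_a_c : {a} ∈ H → {c} ∈ H → ¬ Big := fun h1 h2 =>
    dead _ h1 _ h2 sa sc (k1 _) (k1 _) (by simpa using hac)
  have d_b_c : {b} ∈ H → {c} ∈ H → ¬ Big := fun h1 h2 =>
    dead _ h1 _ h2 sb sc (k1 _) (k1 _) (by simpa using hbc)
  have d1 : ({a} ∈ H ∨ {b} ∈ H ∨ {c} ∈ H) → ({a, b} ∈ H ∨ {a, c} ∈ H ∨ {b, c} ∈ H) → ¬ Big := by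
    rintro (h1 | h1 | h1) (h2 | h2 | h2)
    · exact dead _ h1 _ h2 sa sab (k1 _) (k2 _ _) (nn _ _ _ hab)
    · exact dead _ h1 _ h2 sa sac (k1 _) (k2 _ _) (nn _ _ _ hac)
    · exact dead _ h1 _ h2 sa sbc (k1 _) (k2 _ _) (nn _ _ _ hbc)
    · exact dead _ h1 _ h2 sb sab (k1 _) (k2 _ _) (nn _ _ _ hab)
    · exact dead _ h1 _ h2 sb sac (k1 _) (k2 _ _) (nn _ _ _ hac)
    · exact dead _ h1 _ h2 sb sbc (k1 _) (k2 _ _) (nn _ _ _ hbc)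
    · exact dead _ h1 _ h2 sc sab (k1 _) (k2 _ _) (nn _ _ _ hab)
    · exact dead _ h1 _ h2 sc sac (k1 _) (k2 _ _) (nn _ _ _ hac)
    · exact dead _ h1 _ h2 sc sbc (k1 _) (k2 _ _) (nn _ _ _ hbc)
  have dd1 : {a, b} ∈ H → {a, c} ∈ H → ¬ Big := fun h1 h2 =>
    dead _ h1 _ h2 sab sac (k2 _ _) (k2 _ _) (by
      intro h; have : b ∈ ({a, c} : Finset X) := h ▸ (by simp)
      simp at this; rcases this with h | h
      · exact hab h.symm
      · exact hbc h)
  have dd2 : {a, b} ∈ H → {b, c} ∈ H → ¬ Big := fun h1 h2 =>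
    dead _ h1 _ h2 sab sbc (k2 _ _) (k2 _ _) (by
      intro h; have : a ∈ ({b, c} : Finset X) := h ▸ (by simp)
      simp at this; rcases this with h | h
      · exact hab h
      · exact hac h)
  have dd3 : {a, c} ∈ H → {b, c} ∈ H → ¬ Big := fun h1 h2 =>
    dead _ h1 _ h2 sac sbc (k2 _ _) (k2 _ _) (by
      intro h; have : a ∈ ({b, c} : Finset X) := h ▸ (by simp)
      simp at this; rcases this with h | h
      · exact hab h
      · exact hac h)
  clear_value a b c
  clear dead sub3 Y1 Y2 Y3 Y3' Ye1 Ye2 c1 c2 c3 sa sb sc sab sac sbc k1 k2 nn hBig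
  generalize Wf H f = W at *
  generalize Zf H f = Z at *
  unfold Phi
  exact phi_logic Big _ _ _ _ _ _ W Z Z0 Z1 W1 n1 d_a_b d_a_c d_b_c d1 dd1 dd2 dd3

end core2


section core3
variable {X : Type*} [Fintype X] [DecidableEq X]

lemma Ts_num (e p q : ℝ) (k l : ℕ) (hk : 1 ≤ k) (hl : 1 ≤ l) (he : 0 ≤ e) (hp : 0 ≤ p) (hq : 0 ≤ q)
    (h1 : q ≤ p * (l - 1)) (h2 : q ≤ l * (l - 1) - e) :
    (k ≤ l → e + l * (k - 1) - p * (2 * l + k - 3) + 3 * q ≤ l * (l - 1) + e * k / l) ∧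
    (l < k → e + l * (k - 1) - p * (2 * l + k - 3) + 3 * q ≤ e + l * (k - 1)) := by
  have hk' : (1:ℝ) ≤ k := by exact_mod_cast hk
  have hl' : (1:ℝ) ≤ l := by exact_mod_cast hl
  constructor
  · intro h
    have hkl : (k:ℝ) ≤ l := by exact_mod_cast h
    rcases Nat.lt_or_ge 1 l with h3 | h3
    · have hl2 : (2:ℝ) ≤ l := by exact_mod_cast h3
      rw [← sub_nonneg]
      have h4 : (e + l * (k - 1) - p * (2 * l + k - 3) + 3 * q) * (l - 1) ≤
          l * (l - 1) * (l - 1) + e * (k - 1) := by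
        nlinarith [mul_le_mul_of_nonneg_right h1 (by linarith : (0:ℝ) ≤ 2 * l + k - 3),
          mul_le_mul_of_nonneg_right h2 (by linarith : (0:ℝ) ≤ l - k)]
      have h5 : e * (k - 1) ≤ (e * k / l) * (l - 1) := by
        rw [div_mul_eq_mul_div, le_div_iff₀ (by linarith)]
        nlinarith
      have h6 : (e + l * (k - 1) - p * (2 * l + k - 3) + 3 * q) * (l - 1) ≤
          (l * (l - 1) + e * k / l) * (l - 1) := by linarith
      have := le_of_mul_le_mul_right h6 (by linarith)
      linarith
    · have : l = 1 := by omega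
      have : k = 1 := by omega
      subst l k
      norm_num at *
      linarith
  · intro h
    have hkl : (l:ℝ) < k := by exact_mod_cast h
    nlinarith

lemma Ts_bound (T : Finset X) (ep : X → X → ℝ) (nn : X → ℝ) (hn : ∀ b, nn b = 0 ∨ nn b = 1)
    (hep : ∀ a b, ep a b = 0 ∨ ep a b = 1) (hd : ∀ a, ep a a = 0) (k : ℕ) (hk : 1 ≤ k) (hl : 1 ≤ #T) :
    let e := ∑ b ∈ T, ∑ c ∈ T, ep b c
    let t := ∑ b ∈ T, (k - 1 : ℝ) * (1 - nn b) + ∑ b ∈ T, ∑ c ∈ T, 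
      (if b ≠ c then ep b c - 2 * nn b + 3 * (nn b * nn c * (1 - ep b c)) else 0)
    (k ≤ #T → t ≤ #T * (#T - 1) + e * k / #T) ∧ (#T < k → t ≤ e + #T * (k - 1)) := by
  intro e t
  have n0 : ∀ b, 0 ≤ nn b := fun b => by rcases hn b with h | h <;> rw [h] <;> norm_num
  have n1 : ∀ b, nn b ≤ 1 := fun b => by rcases hn b with h | h <;> rw [h] <;> norm_num
  have e0 : ∀ a b, 0 ≤ ep a b := fun a b => by rcases hep a b with h | h <;> rw [h] <;> norm_num
  have e1 : ∀ a b, ep a b ≤ 1 := fun a b => by rcases hep a b with h | h <;> rw [h] <;> norm_num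
  set q := ∑ b ∈ T, ∑ c ∈ T, (if b ≠ c then nn b * nn c * (1 - ep b c) else 0) with hq
  set p := ∑ b ∈ T, nn b with hp
  have hcount : ∀ (w : X → ℝ), ∑ b ∈ T, ∑ c ∈ T, (if b ≠ c then w b else 0) = (∑ b ∈ T, w b) * (#T - 1) := by
    intro w
    rw [Finset.sum_mul]
    refine Finset.sum_congr rfl fun b hb => ?_
    have : ∀ c, (if b ≠ c then w b else 0) = w b - (if b = c then w b else 0) := by
      intro c; split_ifs <;> simp_all
    simp only [this, Finset.sum_sub_distrib, Finset.sum_ite_eq, hb, if_true, Finset.sum_const, nsmul_eq_mul]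
    ring
  have ht : t = e + #T * (k - 1) - p * (2 * #T + k - 3) + 3 * q := by
    have a1 : ∑ b ∈ T, (k - 1 : ℝ) * (1 - nn b) = (k - 1) * (#T - p) := by
      rw [← Finset.mul_sum, Finset.sum_sub_distrib]; simp [hp]
    have a2 : ∑ b ∈ T, ∑ c ∈ T, 
      (if b ≠ c then ep b c - 2 * nn b + 3 * (nn b * nn c * (1 - ep b c)) else 0) =
      e - 2 * (p * (#T - 1)) + 3 * q := by
      rw [hp, ← hcount, hq]
      simp only [e, Finset.mul_sum, ← Finset.sum_sub_distrib, ← Finset.sum_add_distrib]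
      refine Finset.sum_congr rfl fun b _ => Finset.sum_congr rfl fun c _ => ?_
      split_ifs with h
      · ring
      · have : b = c := by simpa using h
        subst this
        simp [hd]
    simp only [t, a1, a2]
    ring
  have q1 : q ≤ p * (#T - 1) := by
    rw [hp, ← hcount]
    refine Finset.sum_le_sum fun b _ => Finset.sum_le_sum fun c _ => ?_
    split_ifs
    · have : nn c * (1 - ep b c) ≤ 1 := by nlinarith [n0 c, n1 c, e0 b c, e1 b c]
      nlinarith [n0 b]
    · rfl
  have q2 : q ≤ #T * (#T - 1) - e := by
    have := hcount (fun _ => 1)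
    simp only [Finset.sum_const, nsmul_eq_mul, mul_one] at this
    simp only [← this, e, ← Finset.sum_sub_distrib]
    refine Finset.sum_le_sum fun b _ => Finset.sum_le_sum fun c _ => ?_
    split_ifs with h
    · have : nn b * nn c ≤ 1 := by nlinarith [n0 c, n1 c, n0 b, n1 b]
      nlinarith [e1 b c]
    · have : b = c := by simpa using h
      subst this
      simp [hd]
  have q0 : 0 ≤ q := Finset.sum_nonneg fun b _ => Finset.sum_nonneg fun c _ => by
    split_ifs
    · exact mul_nonneg (mul_nonneg (n0 b) (n0 c)) (by linarith [e1 b c])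
    · rfl
  have := Ts_num e p q k #T hk hl (Finset.sum_nonneg fun b _ => Finset.sum_nonneg fun c _ => e0 b c)
    (Finset.sum_nonneg fun b _ => n0 b) q0 q1 q2
  rw [ht]
  exact this

lemma TTT_sum (T : Finset X) (ep : X → X → ℝ) (hs : ∀ a b, ep a b = ep b a) :
    ∑ a ∈ T, ∑ b ∈ T, ∑ c ∈ T, (1/4 + (ep a b + ep a c + ep b c) / 12
      - (ep a b * ep a c + ep a b * ep b c + ep a c * ep b c) / 6
      - 1/4 * ((if a = b then 1 else 0) + (if a = c then 1 else 0) + (if b = c then 1 else 0))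
      + 1/2 * (if a = b then (if a = c then 1 else 0) else 0)) =
    (#T : ℝ) * (#T - 1) * (#T - 2) / 4 + #T * (∑ a ∈ T, ∑ b ∈ T, ep a b) / 4
      - (∑ a ∈ T, (∑ b ∈ T, ep a b) ^ 2) / 2 := by
  set e := ∑ a ∈ T, ∑ b ∈ T, ep a b with he
  set Q := ∑ a ∈ T, (∑ b ∈ T, ep a b) ^ 2 with hQ
  have s1 : ∑ a ∈ T, ∑ b ∈ T, ∑ c ∈ T, ep a b = #T * e := by
    simp only [Finset.sum_const, nsmul_eq_mul, ← Finset.mul_sum]; rfl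
  have s2 : ∑ a ∈ T, ∑ b ∈ T, ∑ c ∈ T, ep a c = #T * e := by
    simp only [Finset.sum_const, nsmul_eq_mul, ← Finset.mul_sum]; rfl
  have s3 : ∑ a ∈ T, ∑ b ∈ T, ∑ c ∈ T, ep b c = #T * e := by
    simp only [Finset.sum_const, nsmul_eq_mul]; rfl
  have r1 : ∑ a ∈ T, ∑ b ∈ T, ∑ c ∈ T, ep a b * ep a c = Q := by
    rw [hQ]
    refine Finset.sum_congr rfl fun a _ => ?_
    rw [sq, Finset.sum_mul_sum]
  have r2 : ∑ a ∈ T, ∑ b ∈ T, ∑ c ∈ T, ep a b * ep b c = Q := by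
    rw [Finset.sum_comm, hQ]
    refine Finset.sum_congr rfl fun a _ => ?_
    rw [sq, Finset.sum_mul_sum]
    simp only [hs]
  have r3 : ∑ a ∈ T, ∑ b ∈ T, ∑ c ∈ T, ep a c * ep b c = Q := by
    have : ∀ a ∈ T, ∑ b ∈ T, ∑ c ∈ T, ep a c * ep b c = ∑ c ∈ T, ∑ b ∈ T, ep a c * ep b c :=
      fun a _ => Finset.sum_comm
    rw [Finset.sum_congr rfl this, Finset.sum_comm, hQ]
    refine Finset.sum_congr rfl fun a _ => ?_
    rw [sq, Finset.sum_mul_sum]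
    refine Finset.sum_congr rfl fun b _ => Finset.sum_congr rfl fun c _ => ?_
    rw [hs b a, hs c a]
  have i1 : ∑ a ∈ T, ∑ b ∈ T, ∑ c ∈ T, (if a = b then (1:ℝ) else 0) = #T * #T := by
    simp
  have i2 : ∑ a ∈ T, ∑ b ∈ T, ∑ c ∈ T, (if a = c then (1:ℝ) else 0) = #T * #T := by
    simp
  have i3 : ∑ a ∈ T, ∑ b ∈ T, ∑ c ∈ T, (if b = c then (1:ℝ) else 0) = #T * #T := by
    simp
  have i4 : ∑ a ∈ T, ∑ b ∈ T, ∑ c ∈ T, (if a = b then (if a = c then (1:ℝ) else 0) else 0) = #T := by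
    have : ∀ a ∈ T, ∑ b ∈ T, ∑ c ∈ T, (if a = b then (if a = c then (1:ℝ) else 0) else 0) = 1 := by
      intro a ha
      have : ∀ b ∈ T, ∑ c ∈ T, (if a = b then (if a = c then (1:ℝ) else 0) else 0) = if a = b then 1 else 0 := by
        intro b hb
        split_ifs <;> simp [ha]
      rw [Finset.sum_congr rfl this]
      simp [ha]
    rw [Finset.sum_congr rfl this]; simp
  have i0 : ∑ a ∈ T, ∑ b ∈ T, ∑ c ∈ T, (1/4:ℝ) = #T * (#T * (#T * (1/4))) := by
    simp only [Finset.sum_const, nsmul_eq_mul]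
  simp only [Finset.sum_add_distrib, Finset.sum_sub_distrib, ← Finset.sum_div, ← Finset.mul_sum]
  simp only [Finset.sum_add_distrib, Finset.sum_sub_distrib, ← Finset.sum_div, ← Finset.mul_sum] at s1 s2 s3 r1 r2 r3 i1 i2 i3 i4 i0
  rw [s1, s2, s3, r1, r2, r3, i1, i2, i3, i4, i0]
  ring

lemma fin_num1 (k l : ℕ) (hkl : k ≤ l) (hm : 3 ≤ k + l) (e Q : ℝ) (hQ : e ^ 2 ≤ l * Q) :
    (l:ℝ) * (l - 1) * (l - 2) / 4 + l * e / 4 - Q / 2 + k * (l * (l - 1) + e * k / l) <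
      0.296 * (((k:ℝ) + l) * (k + l + 1) * (k + l - 2)) := by
  have hl2 : (2:ℝ) ≤ l := by exact_mod_cast (by omega : 2 ≤ l)
  have hk0 : (0:ℝ) ≤ k := by positivity
  have hkl' : (k:ℝ) ≤ l := by exact_mod_cast hkl
  have hm' : (3:ℝ) ≤ k + l := by exact_mod_cast hm
  obtain ⟨t, rfl⟩ : ∃ t, e = l * t := ⟨e / l, by field_simp⟩
  have hQ' : l * t ^ 2 ≤ Q := by
    have : l * (l * t ^ 2) ≤ l * Q := by nlinarith
    exact le_of_mul_le_mul_left this (by linarith)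
  have h1 : (l:ℝ) * t * k / l = t * k := by field_simp
  rw [h1]
  have h2 : l * (l * t) / 4 - l * t ^ 2 / 2 + k * (t * k) ≤ (l:ℝ)^3/32 + k^2*l/4 + k^3/2 := by
    have h3 : (l * (l * t) / 4 - l * t ^ 2 / 2 + k * (t * k)) * l ≤ ((l:ℝ)^3/32 + k^2*l/4 + k^3/2) * l := by
      have : 0 ≤ (k:ℝ)^3 * (l - k) := by
        have : (0:ℝ) ≤ l - k := by linarith
        positivity
      nlinarith [sq_nonneg ((l:ℝ) * t - (l^2/4 + k^2))]
    exact le_of_mul_le_mul_right h3 (by linarith)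
  have h4 : (l:ℝ) * (l - 1) * (l - 2) / 4 + ((l:ℝ)^3/32 + k^2*l/4 + k^3/2) + k * (l * (l - 1)) <
      0.296 * (((k:ℝ) + l) * (k + l + 1) * (k + l - 2)) := by
    rcases Nat.eq_zero_or_pos k with h | h
    · subst h
      have hl3 : (3:ℝ) ≤ l := by exact_mod_cast (by omega : 3 ≤ l)
      clear hm' hkl' hQ hQ' h1 h2 hk0
      push_cast
      nlinarith [mul_nonneg (by linarith : (0:ℝ) ≤ l) (by linarith : (0:ℝ) ≤ l - 3),
        mul_nonneg (mul_nonneg (by linarith : (0:ℝ) ≤ l) (by linarith : (0:ℝ) ≤ l - 3)) (by linarith : (0:ℝ) ≤ l)]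
    · have hk1 : (1:ℝ) ≤ k := by exact_mod_cast h
      obtain ⟨x, hx⟩ : ∃ x : ℝ, x = k - 1 := ⟨_, rfl⟩
      have hc : (0:ℝ) ≤ l * (0.01475 * l^2 - 0.112 * k * l + 0.22 * k^2) := by
        apply mul_nonneg (by linarith)
        nlinarith [sq_nonneg (0.12 * (l:ℝ) - 0.46 * k)]
      have hc2 : (0:ℝ) ≤ k^2 * (l - k) := by
        apply mul_nonneg (by positivity); linarith
      nlinarith [mul_nonneg (by linarith : (0:ℝ) ≤ k - 1) (by linarith : (0:ℝ) ≤ l - 2),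
        mul_nonneg (by linarith : (0:ℝ) ≤ k) (by linarith : (0:ℝ) ≤ l - k),
        mul_nonneg (by linarith : (0:ℝ) ≤ k) (mul_nonneg (by linarith : (0:ℝ) ≤ k - 1) (by linarith : (0:ℝ) ≤ l - 2)), sq_nonneg ((l:ℝ)-2), sq_nonneg ((k:ℝ)-1)]
  linarith

lemma fin_num2 (k l : ℕ) (hl : 1 ≤ l) (hkl : l < k) (hm : 3 ≤ k + l) (e Q : ℝ) (hQ : e ^ 2 ≤ l * Q)
    (he : e ≤ l * (l - 1)) :
    (l:ℝ) * (l - 1) * (l - 2) / 4 + l * e / 4 - Q / 2 + k * (e + l * (k - 1)) <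
      0.296 * (((k:ℝ) + l) * (k + l + 1) * (k + l - 2)) := by
  have hl2 : (1:ℝ) ≤ l := by exact_mod_cast hl
  have hkl' : (l:ℝ) + 1 ≤ k := by exact_mod_cast hkl
  have hm' : (3:ℝ) ≤ k + l := by exact_mod_cast hm
  obtain ⟨t, rfl⟩ : ∃ t, e = l * t := ⟨e / l, by field_simp⟩
  have hQ' : l * t ^ 2 ≤ Q := by
    have : l * (l * t ^ 2) ≤ l * Q := by nlinarith
    exact le_of_mul_le_mul_left this (by linarith)
  have ht : t ≤ l - 1 := le_of_mul_le_mul_left he (by linarith)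
  have h1 : l * (l * t) / 4 - l * t ^ 2 / 2 + k * (l * t) ≤
      (l:ℝ) * (l * (l - 1)) / 4 - l * (l - 1) ^ 2 / 2 + k * (l * (l - 1)) := by
    have : 0 ≤ ((l:ℝ) - 1 - t) * (l / 4 + k - (t + (l - 1)) / 2) := by
      apply mul_nonneg <;> linarith
    nlinarith
  have h2 : (k:ℝ) * l * (k + l - 2) < 0.296 * (((k:ℝ) + l) * (k + l + 1) * (k + l - 2)) := by
    have : (k:ℝ) * l < 0.296 * (((k:ℝ) + l) * (k + l + 1)) := by nlinarith [sq_nonneg ((k:ℝ) - l)]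
    nlinarith
  nlinarith

end core3


section core4
variable {X : Type*} [Fintype X] [DecidableEq X]

open Classical in
noncomputable def epsH (H : Finset (Finset X)) (a b : X) : ℝ := if a ≠ b ∧ {a, b} ∈ H then 1 else 0

noncomputable def DPhi (H : Finset (Finset X)) (a b c : X) : ℝ :=
  if a ≠ b ∧ a ≠ c ∧ b ≠ c then Phi H a b c else 0

lemma DPhi_TTT (H : Finset (Finset X)) (a b c : X) (ha : {a} ∉ H) (hb : {b} ∉ H) (hc : {c} ∉ H) :
    DPhi H a b c ≤ 1/4 + (epsH H a b + epsH H a c + epsH H b c) / 12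
      - (epsH H a b * epsH H a c + epsH H a b * epsH H b c + epsH H a c * epsH H b c) / 6
      - 1/4 * ((if a = b then 1 else 0) + (if a = c then 1 else 0) + (if b = c then 1 else 0))
      + 1/2 * (if a = b then (if a = c then 1 else 0) else 0) := by
  classical
  have hcomm : ∀ x y : X, ({x, y} : Finset X) = {y, x} := fun x y => Finset.pair_comm x y
  unfold DPhi
  by_cases hab : a = b
  · subst hab
    by_cases hac : a = c
    · subst hac
      simp [epsH]; norm_num
    · by_cases h : {a, c} ∈ H <;> simp [epsH, hac, h] <;> norm_num
  · by_cases hac : a = c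
    · subst hac
      by_cases h : {a, b} ∈ H <;> simp [epsH, hab, h, hcomm b a, Ne.symm hab] <;> norm_num
    · by_cases hbc : b = c
      · subst hbc
        by_cases h : {a, b} ∈ H <;> simp [epsH, hab, h] <;> norm_num
      · rw [if_pos ⟨hab, hac, hbc⟩]
        unfold Phi
        by_cases h1 : {a, b} ∈ H <;> by_cases h2 : {a, c} ∈ H <;> by_cases h3 : {b, c} ∈ H <;>
          simp [epsH, ha, hb, hc, hab, hac, hbc, h1, h2, h3] <;> norm_num

lemma DPhi_SS (H : Finset (Finset X)) (a b c : X) (ha : {a} ∈ H) (hb : {b} ∈ H) :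
    DPhi H a b c = 0 := by
  simp [DPhi, Phi, ha, hb]

lemma DPhi_STS (H : Finset (Finset X)) (s b s' : X) (hs : {s} ∈ H) (hb : {b} ∉ H) (hs' : {s'} ∈ H) :
    DPhi H s b s' + DPhi H b s s' = if s = s' then 0 else epsH H s b := by
  classical
  have hsb : s ≠ b := by rintro rfl; exact hb hs
  have hsb' : b ≠ s' := by rintro rfl; exact hb hs'
  unfold DPhi
  by_cases h : s = s'
  · simp [h]
  · by_cases h2 : {s, b} ∈ H <;>
    simp [Phi, epsH, hs, hb, hs', hsb, Ne.symm hsb, hsb', h, h2, Finset.pair_comm b s] <;> norm_num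

lemma DPhi_STT (H : Finset (Finset X)) (s b c : X) (hs : {s} ∈ H) (hb : {b} ∉ H) (hc : {c} ∉ H) :
    DPhi H s b c + DPhi H b s c + DPhi H b c s = if b ≠ c then epsH H b c - 2 * (1 - epsH H s b) +
      3 * ((1 - epsH H s b) * (1 - epsH H s c) * (1 - epsH H b c)) else 0 := by
  classical
  have hsb : s ≠ b := by rintro rfl; exact hb hs
  have hsc : s ≠ c := by rintro rfl; exact hc hs
  unfold DPhi
  by_cases h : b = c
  · simp [h]
  · by_cases h1 : {s, b} ∈ H <;> by_cases h2 : {s, c} ∈ H <;> by_cases h3 : {b, c} ∈ H <;>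
    simp [Phi, epsH, hs, hb, hc, hsb, Ne.symm hsb, hsc, Ne.symm hsc, h, h1, h2, h3,
      Finset.pair_comm b s, Finset.pair_comm c s] <;> norm_num

lemma sum_Phi_lt (H : Finset (Finset X)) (hm : 3 ≤ Fintype.card X) :
    ∑ a : X, ∑ b ∈ univ.erase a, ∑ c ∈ (univ.erase a).erase b, Phi H a b c <
      0.296 * ((Fintype.card X : ℝ) * (Fintype.card X + 1) * (Fintype.card X - 2)) := by
  classical
  have e0 : ∑ a : X, ∑ b ∈ univ.erase a, ∑ c ∈ (univ.erase a).erase b, Phi H a b c =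
      ∑ a : X, ∑ b : X, ∑ c : X, DPhi H a b c := by
    refine Finset.sum_congr rfl fun a _ => ?_
    have : univ.erase a = univ.filter (fun b => a ≠ b) := by ext; simp [eq_comm]
    rw [this, Finset.sum_filter]
    refine Finset.sum_congr rfl fun b _ => ?_
    have h2 : (univ.filter (fun b => a ≠ b)).erase b = univ.filter (fun c => a ≠ c ∧ b ≠ c) := by
      ext; simp [eq_comm, and_comm]
    rw [h2, Finset.sum_filter]
    split_ifs with h
    · refine Finset.sum_congr rfl fun c _ => ?_
      simp [DPhi, h]
    · simp only [DPhi]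
      simp [h]
  rw [e0]
  set S : Finset X := univ.filter (fun x => {x} ∈ H) with hS
  set T : Finset X := univ.filter (fun x => ¬ {x} ∈ H) with hT
  have memS : ∀ x, x ∈ S → {x} ∈ H := fun x hx => by simpa [hS] using hx
  have memT : ∀ x, x ∈ T → {x} ∉ H := fun x hx => by simpa [hT] using hx
  have split : ∀ g : X → ℝ, ∑ x, g x = ∑ x ∈ S, g x + ∑ x ∈ T, g x := by
    intro g
    rw [hS, hT, Finset.sum_filter_add_sum_filter_not]
  have hcard : #S + #T = Fintype.card X := by
    rw [hS, hT, Finset.card_filter_add_card_filter_not]; rfl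
  set D := DPhi H with hD
  have e1 : ∑ a : X, ∑ b : X, ∑ c : X, D a b c =
      ∑ s ∈ S, (∑ b ∈ T, ∑ s' ∈ S, (D s b s' + D b s s') +
        ∑ b ∈ T, ∑ c ∈ T, (D s b c + D b s c + D b c s)) +
      ∑ a ∈ T, ∑ b ∈ T, ∑ c ∈ T, D a b c := by
    simp only [split, Finset.sum_add_distrib]
    have z1 : ∑ a ∈ S, ∑ b ∈ S, ∑ c ∈ S, D a b c = 0 :=
      Finset.sum_eq_zero fun a ha => Finset.sum_eq_zero fun b hb => Finset.sum_eq_zero fun c _ =>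
        DPhi_SS H a b c (memS a ha) (memS b hb)
    have z2 : ∑ a ∈ S, ∑ b ∈ S, ∑ c ∈ T, D a b c = 0 :=
      Finset.sum_eq_zero fun a ha => Finset.sum_eq_zero fun b hb => Finset.sum_eq_zero fun c _ =>
        DPhi_SS H a b c (memS a ha) (memS b hb)
    have w1 : ∑ a ∈ T, ∑ b ∈ S, ∑ c ∈ S, D a b c = ∑ s ∈ S, ∑ b ∈ T, ∑ s' ∈ S, D b s s' :=
      Finset.sum_comm
    have w2 : ∑ a ∈ T, ∑ b ∈ S, ∑ c ∈ T, D a b c = ∑ s ∈ S, ∑ b ∈ T, ∑ c ∈ T, D b s c :=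
      Finset.sum_comm
    have w3 : ∑ a ∈ T, ∑ b ∈ T, ∑ c ∈ S, D a b c = ∑ s ∈ S, ∑ b ∈ T, ∑ c ∈ T, D b c s := by
      rw [Finset.sum_congr rfl (fun a _ => Finset.sum_comm (s := T) (t := S)), Finset.sum_comm]
    rw [z1, z2, w1, w2, w3]
    ring
  rw [e1]
  set ep := epsH H with hep
  have ep01 : ∀ a b, ep a b = 0 ∨ ep a b = 1 := by
    intro a b; simp only [hep, epsH]; split_ifs <;> simp
  have epd : ∀ a, ep a a = 0 := by intro a; simp [hep, epsH]
  have eps : ∀ a b, ep a b = ep b a := by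
    intro a b; simp only [hep, epsH, Finset.pair_comm a b, ne_comm (a := a)]
  set e := ∑ a ∈ T, ∑ b ∈ T, ep a b with he
  set Q := ∑ a ∈ T, (∑ b ∈ T, ep a b) ^ 2 with hQdef
  have hQ : e ^ 2 ≤ #T * Q := by
    have := sq_sum_le_card_mul_sum_sq (s := T) (f := fun a => ∑ b ∈ T, ep a b)
    exact_mod_cast this
  have hTTT : ∑ a ∈ T, ∑ b ∈ T, ∑ c ∈ T, D a b c ≤
      (#T : ℝ) * (#T - 1) * (#T - 2) / 4 + #T * e / 4 - Q / 2 := by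
    rw [← TTT_sum T ep eps]
    refine Finset.sum_le_sum fun a ha => Finset.sum_le_sum fun b hb => Finset.sum_le_sum fun c hc => ?_
    exact DPhi_TTT H a b c (memT a ha) (memT b hb) (memT c hc)
  have hTs : ∀ s ∈ S, (∑ b ∈ T, ∑ s' ∈ S, (D s b s' + D b s s') +
        ∑ b ∈ T, ∑ c ∈ T, (D s b c + D b s c + D b c s)) =
      ∑ b ∈ T, (#S - 1 : ℝ) * (1 - (1 - ep s b)) + ∑ b ∈ T, ∑ c ∈ T, 
      (if b ≠ c then ep b c - 2 * (1 - ep s b) + 3 * ((1 - ep s b) * (1 - ep s c) * (1 - ep b c)) else 0) := by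
    intro s hs
    congr 1
    · refine Finset.sum_congr rfl fun b hb => ?_
      rw [Finset.sum_congr rfl (fun s' hs' => DPhi_STS H s b s' (memS s hs) (memT b hb) (memS s' hs'))]
      have : ∀ s', (if s = s' then 0 else epsH H s b) = ep s b - (if s = s' then ep s b else 0) := by
        intro s'; split_ifs <;> simp [hep]
      simp only [this, Finset.sum_sub_distrib, Finset.sum_ite_eq, hs, if_true, Finset.sum_const, nsmul_eq_mul]
      ring
    · refine Finset.sum_congr rfl fun b hb => Finset.sum_congr rfl fun c hc => ?_
      exact DPhi_STT H s b c (memS s hs) (memT b hb) (memT c hc)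
  have hmR : (Fintype.card X : ℝ) = #S + #T := by rw [← hcard]; push_cast; ring
  rcases Nat.eq_zero_or_pos #T with hT0 | hT0
  · have hTe : T = ∅ := Finset.card_eq_zero.1 hT0
    rw [hTe]
    simp only [Finset.sum_empty, add_zero, Finset.sum_const_zero]
    have : (3:ℝ) ≤ Fintype.card X := by exact_mod_cast hm
    have h2 : (0:ℝ) < Fintype.card X - 2 := by linarith
    positivity
  have hB : ∀ s ∈ S, _ := fun s hs => Ts_bound T ep (fun b => 1 - ep s b)
    (fun b => by rcases ep01 s b with h | h <;> simp [h]) ep01 epd #S (Finset.card_pos.2 ⟨s, hs⟩) hT0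
  rw [Finset.sum_congr rfl hTs, hmR]
  rcases Nat.lt_or_ge #T #S with h | h
  · have h1 : ∀ s ∈ S, _ := fun s hs => (hB s hs).2 h
    have h2 := Finset.sum_le_card_nsmul S _ _ h1
    rw [nsmul_eq_mul] at h2
    have he2 : e ≤ #T * (#T - 1) := by
      have : e ≤ ∑ a ∈ T, ∑ b ∈ T, (1 - if a = b then (1:ℝ) else 0) := by
        refine Finset.sum_le_sum fun a _ => Finset.sum_le_sum fun b _ => ?_
        split_ifs with h
        · subst h; rw [epd]; simp
        · rcases ep01 a b with h | h <;> rw [h] <;> norm_num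
      refine this.trans (le_of_eq ?_)
      simp
      ring
    have := fin_num2 #S #T hT0 h (by omega) e Q hQ he2
    linarith
  · have h1 : ∀ s ∈ S, _ := fun s hs => (hB s hs).1 h
    have h2 := Finset.sum_le_card_nsmul S _ _ h1
    rw [nsmul_eq_mul] at h2
    have := fin_num1 #S #T h (by omega) e Q hQ
    linarith

open Numbering Nat in
/-- The core local inequality. -/
lemma core_ineq (H : Finset (Finset X)) (h0 : ∅ ∉ H)
    (hL : ∀ Y ∈ H, ∀ A ∈ H, ∀ B ∈ H, A ⊂ Y → B ⊂ Y → A = B) (hm : 3 ≤ Fintype.card X) :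
    ∑ Y ∈ H, 1 / ((Fintype.card X).choose #Y : ℝ) <
      1 + 0.296 * (Fintype.card X + 1) / (Fintype.card X - 1) := by
  classical
  obtain ⟨K, hK, hg⟩ := first_three (X := X) hm
  have h1 := sum_hits_le H h0
  have h2 : ∑ f : Numbering X, (Wf H f - Zf H f) ≤ K * _ :=
    (Finset.sum_le_sum fun f _ => pointwise_Phi H h0 hL f hm).trans_eq (hg (Phi H))
  have h3 := hg (fun _ _ _ => 1)
  have h4 := mul_lt_mul_of_pos_left (sum_Phi_lt H hm) hK
  set m := Fintype.card X with hmdef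
  have hm' : (3:ℝ) ≤ m := by exact_mod_cast hm
  have h5 : ((m)! : ℝ) = K * (m * (m - 1) * (m - 2)) := by
    have e : ∑ f : Numbering X, (1:ℝ) = (m)! := by simp [hmdef]
    rw [← e, h3]
    congr 1
    have c1 : ∀ a : X, ∀ b ∈ univ.erase a, ∑ c ∈ (univ.erase a).erase b, (1:ℝ) = m - 2 := by
      intro a b hb
      rw [Finset.sum_const, Finset.card_erase_of_mem hb, Finset.card_erase_of_mem (by simp), nsmul_eq_mul,
        Finset.card_univ, ← hmdef, Nat.sub_sub, Nat.cast_sub (by omega)]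
      norm_num
    have c2 : ∀ a : X, ∑ b ∈ univ.erase a, ∑ c ∈ (univ.erase a).erase b, (1:ℝ) = (m - 1) * (m - 2) := by
      intro a
      rw [Finset.sum_congr rfl (c1 a), Finset.sum_const, Finset.card_erase_of_mem (by simp), nsmul_eq_mul,
        Finset.card_univ, ← hmdef, Nat.cast_sub (by omega)]
      norm_num
    rw [Finset.sum_congr rfl (fun a _ => c2 a), Finset.sum_const, Finset.card_univ, nsmul_eq_mul, ← hmdef]
    ring
  have h6 : ∑ Y ∈ H, (#(prefixed Y) : ℝ) = (m)! * ∑ Y ∈ H, 1 / ((m).choose #Y : ℝ) := by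
    rw [Finset.mul_sum]
    refine Finset.sum_congr rfl fun Y _ => ?_
    have hle : #Y ≤ m := Finset.card_le_univ Y
    rw [card_prefixed, ← hmdef, ← Nat.choose_mul_factorial_mul_factorial hle]
    have : ((m.choose #Y : ℕ) : ℝ) ≠ 0 := by exact_mod_cast (Nat.choose_pos hle).ne'
    push_cast
    field_simp
  have hf : (0:ℝ) < (m)! := by positivity
  rw [h6] at h1
  have h7 : ((m)! : ℝ) * ∑ Y ∈ H, 1 / ((m).choose #Y : ℝ) < (m)! * (1 + 0.296 * (m + 1) / (m - 1)) := by
    have e : K * (0.296 * ((m:ℝ) * (m + 1) * (m - 2))) = (m)! * (0.296 * (m + 1) / (m - 1)) := by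
      rw [h5]
      have : (m:ℝ) - 1 ≠ 0 := by linarith
      field_simp
    rw [mul_add, ← e, mul_one]
    linarith
  exact lt_of_mul_lt_mul_left h7 hf.le

end core4

section glob

lemma local_core (n : ℕ) (F : Finset (Finset (Fin n))) (hF : DkFree n 2 F) (A : Finset (Fin n))
    (hA : A ∈ F) (hm : 3 ≤ n - #A) :
    ∑ Y ∈ F.filter (fun Y => A ⊂ Y), 1 / ((n - #A).choose (#Y - #A) : ℝ) <
      1 + 0.296 * (((n - #A : ℕ) : ℝ) + 1) / (((n - #A : ℕ) : ℝ) - 1) := by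
  classical
  let X := {x : Fin n // x ∉ A}
  have hX : Fintype.card X = n - #A := by
    simp only [X]
    rw [Fintype.card_subtype_compl]; simp
  let up : Finset X → Finset (Fin n) := fun Z => A ∪ Z.map (Function.Embedding.subtype _)
  have up_mono : ∀ Z Z' : Finset X, Z ⊆ Z' → up Z ⊆ up Z' := fun Z Z' h =>
    Finset.union_subset_union_right (Finset.map_subset_map.2 h)
  have up_disj : ∀ Z : Finset X, Disjoint A (Z.map (Function.Embedding.subtype _)) := by
    intro Z
    rw [Finset.disjoint_left]
    intro x hx hx'
    rw [Finset.mem_map] at hx'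
    obtain ⟨y, _, rfl⟩ := hx'
    exact y.2 hx
  have up_card : ∀ Z : Finset X, #(up Z) = #A + #Z := by
    intro Z
    rw [Finset.card_union_of_disjoint (up_disj Z), Finset.card_map]
  have up_sub : ∀ Z : Finset X, (up Z).subtype (fun x => x ∉ A) = Z := by
    intro Z
    ext x
    simp only [up, Finset.mem_subtype, Finset.mem_union, Finset.mem_map,
      Function.Embedding.coe_subtype]
    constructor
    · rintro (h | ⟨y, hy, h⟩)
      · exact absurd h x.2
      · rwa [← Subtype.ext h]
    · intro h; exact Or.inr ⟨x, h, rfl⟩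
  have up_inj : Function.Injective up := fun Z Z' h => by rw [← up_sub Z, h, up_sub]
  have sub_up : ∀ Y : Finset (Fin n), A ⊆ Y → up (Y.subtype (fun x => x ∉ A)) = Y := by
    intro Y h
    ext x
    simp only [up, Finset.mem_union, Finset.mem_map, Finset.mem_subtype, Function.Embedding.coe_subtype]
    constructor
    · rintro (h' | ⟨y, hy, rfl⟩)
      · exact h h'
      · exact hy
    · intro hx
      by_cases hxA : x ∈ A
      · exact Or.inl hxA
      · exact Or.inr ⟨⟨x, hxA⟩, hx, rfl⟩
  let H : Finset (Finset X) := univ.filter (fun Z => Z ≠ ∅ ∧ up Z ∈ F)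
  have hH : ∀ Z, Z ∈ H ↔ Z ≠ ∅ ∧ up Z ∈ F := fun Z => by simp [H]
  have up0 : up ∅ = A := by simp [up]
  have h0 : ∅ ∉ H := by rw [hH]; simp
  have hL : ∀ Y ∈ H, ∀ P ∈ H, ∀ Q ∈ H, P ⊂ Y → Q ⊂ Y → P = Q := by
    intro Y hY P hP Q hQ h1 h2
    by_contra hne
    rw [hH] at hY hP hQ
    apply hF
    refine ⟨A, up Y, ![up P, up Q], hA, hY.2, ?_, ?_, ?_, ?_, ?_⟩
    · intro i; fin_cases i
      · exact hP.2
      · exact hQ.2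
    · intro i j h
      fin_cases i <;> fin_cases j
      · rfl
      · exact absurd (up_inj h) hne
      · exact absurd (up_inj h) (Ne.symm hne)
      · rfl
    · intro i; fin_cases i
      · exact ⟨fun h => hP.1 (up_inj (h.trans up0.symm)), fun h => h1.ne (up_inj h)⟩
      · exact ⟨fun h => hQ.1 (up_inj (h.trans up0.symm)), fun h => h2.ne (up_inj h)⟩
    · intro h; exact hY.1 (up_inj (h.symm.trans up0.symm))
    · intro i; fin_cases i
      · exact ⟨Finset.subset_union_left, up_mono _ _ h1.subset⟩
      · exact ⟨Finset.subset_union_left, up_mono _ _ h2.subset⟩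
  have main := core_ineq H h0 hL (by rw [hX]; exact hm)
  rw [hX] at main
  refine lt_of_eq_of_lt ?_ main
  symm
  refine Finset.sum_bij (fun Z _ => up Z) ?_ ?_ ?_ ?_
  · intro Z hZ
    rw [hH] at hZ
    rw [Finset.mem_filter]
    refine ⟨hZ.2, Finset.subset_union_left.ssubset_of_ne ?_⟩
    intro h; exact hZ.1 (up_inj (h.symm.trans up0.symm))
  · intro Z _ Z' _ h; exact up_inj h
  · intro Y hY
    rw [Finset.mem_filter] at hY
    refine ⟨Y.subtype (fun x => x ∉ A), ?_, sub_up Y hY.2.subset⟩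
    rw [hH, sub_up Y hY.2.subset]
    refine ⟨?_, hY.1⟩
    intro h
    have := sub_up Y hY.2.subset
    rw [h, up0] at this
    exact hY.2.ne this
  · intro Z _
    rw [up_card, Nat.add_sub_cancel_left]

lemma level_le (n : ℕ) (F : Finset (Finset (Fin n))) (A : Finset (Fin n)) (j : ℕ) :
    ∑ Y ∈ F.filter (fun Y => A ⊆ Y ∧ #Y = j), 1 / ((n - #A).choose (#Y - #A) : ℝ) ≤ 1 := by
  classical
  have h1 : ∑ Y ∈ F.filter (fun Y => A ⊆ Y ∧ #Y = j), 1 / ((n - #A).choose (#Y - #A) : ℝ) =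
      #(F.filter (fun Y => A ⊆ Y ∧ #Y = j)) * (1 / ((n - #A).choose (j - #A) : ℝ)) := by
    rw [← nsmul_eq_mul, ← Finset.sum_const]
    refine Finset.sum_congr rfl fun Y hY => ?_
    rw [(Finset.mem_filter.1 hY).2.2]
  have h2 : #(F.filter (fun Y => A ⊆ Y ∧ #Y = j)) ≤ (n - #A).choose (j - #A) := by
    have : #(Finset.powersetCard (j - #A) Aᶜ) = (n - #A).choose (j - #A) := by
      rw [Finset.card_powersetCard, Finset.card_compl, Fintype.card_fin]
    rw [← this]
    refine Finset.card_le_card_of_injOn (fun Y => Y \ A) ?_ ?_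
    · intro Y hY
      have hY' := (Finset.mem_filter.1 (Finset.mem_coe.1 hY)).2
      rw [Finset.mem_coe, Finset.mem_powersetCard]
      refine ⟨?_, ?_⟩
      · intro x hx
        rw [Finset.mem_compl]; exact (Finset.mem_sdiff.1 hx).2
      · rw [Finset.card_sdiff_of_subset hY'.1, hY'.2]
    · intro Y hY Y' hY' h
      have hY1 := (Finset.mem_filter.1 (Finset.mem_coe.1 hY)).2.1
      have hY2 := (Finset.mem_filter.1 (Finset.mem_coe.1 hY')).2.1
      simp only at h
      rw [← Finset.sdiff_union_of_subset hY1, h, Finset.sdiff_union_of_subset hY2]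
  rw [h1, mul_one_div]
  apply div_le_one_of_le₀ _ (by positivity)
  exact_mod_cast h2

/-- normalised level size -/
noncomputable def wt (n j : ℕ) : ℝ := (n.choose j : ℝ) / (n.choose (n / 2) : ℝ)

lemma mid_pos (n : ℕ) : (0:ℝ) < (n.choose (n / 2) : ℝ) := by
  exact_mod_cast Nat.choose_pos (Nat.div_le_self n 2)

lemma wt_nonneg (n j : ℕ) : 0 ≤ wt n j := by unfold wt; positivity

lemma wt_le_one (n j : ℕ) : wt n j ≤ 1 := by
  unfold wt
  rw [div_le_one (mid_pos n)]
  exact_mod_cast Nat.choose_le_middle j n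

lemma wt_succ (n j : ℕ) (hj : j ≤ n) : wt n (j + 1) * (j + 1) = wt n j * (n - j) := by
  unfold wt
  have := Nat.choose_succ_right_eq n j
  have h : (n.choose (j+1) : ℝ) * (j + 1) = n.choose j * (n - j) := by
    rw [← Nat.cast_sub hj]; exact_mod_cast this
  rw [div_mul_eq_mul_div, h, div_mul_eq_mul_div]

lemma wt_anti (n i j : ℕ) (hi : n / 2 ≤ i) (hij : i ≤ j) : wt n j ≤ wt n i := by
  induction j, hij using Nat.le_induction with
  | base => rfl
  | succ j hj ih =>
    refine le_trans ?_ ih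
    rcases Nat.lt_or_ge n j with h | h
    · unfold wt
      rw [Nat.choose_eq_zero_of_lt (by omega)]
      simp; positivity
    · have h1 := wt_succ n j h
      have h2 : ((n:ℝ) - j) ≤ j + 1 := by
        have : n ≤ j + 1 + j := by omega
        have : (n:ℝ) ≤ j + 1 + j := by exact_mod_cast this
        linarith
      have h3 : wt n (j+1) * (j+1) ≤ wt n j * (j + 1) := by
        rw [h1]; exact mul_le_mul_of_nonneg_left h2 (wt_nonneg n j)
      exact le_of_mul_le_mul_right h3 (by positivity)

lemma wt_symm (n j : ℕ) (hj : j ≤ n) : wt n (n - j) = wt n j := by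
  unfold wt; rw [Nat.choose_symm hj]

noncomputable def UU (n : ℕ) (F : Finset (Finset (Fin n))) (A : Finset (Fin n)) : ℝ :=
  ∑ Y ∈ F.filter (fun Y => A ⊆ Y), wt n #Y * (1 / ((n - #A).choose (#Y - #A) : ℝ))

lemma UU_rec (n : ℕ) (F : Finset (Finset (Fin n))) (A : Finset (Fin n)) (hA : A ∉ F) :
    ((n - #A : ℕ) : ℝ) * UU n F A = ∑ x ∈ Aᶜ, UU n F (insert x A) := by
  classical
  have hAn : #A ≤ n := by simpa using Finset.card_le_univ A
  have e1 : ∑ x ∈ Aᶜ, UU n F (insert x A) =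
      ∑ x ∈ Aᶜ, ∑ Y ∈ F.filter (fun Y => A ⊆ Y), (if x ∈ Y then
        wt n #Y * (1 / ((n - #A - 1).choose (#Y - #A - 1) : ℝ)) else 0) := by
    refine Finset.sum_congr rfl fun x hx => ?_
    unfold UU
    rw [← Finset.sum_filter, Finset.filter_filter]
    rw [Finset.card_insert_of_notMem (Finset.mem_compl.1 hx)]
    refine Finset.sum_congr ?_ fun Y _ => by rw [Nat.sub_sub, Nat.sub_sub]
    ext Y
    simp only [Finset.mem_filter, Finset.insert_subset_iff]
    tauto
  rw [e1, Finset.sum_comm]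
  unfold UU
  rw [Finset.mul_sum]
  refine Finset.sum_congr rfl fun Y hY => ?_
  rw [Finset.mem_filter] at hY
  have hne : A ≠ Y := by rintro rfl; exact hA hY.1
  have hlt := Finset.card_lt_card (hY.2.ssubset_of_ne hne)
  have hYn : #Y ≤ n := by simpa using Finset.card_le_univ Y
  rw [← Finset.sum_filter, Finset.sum_const, nsmul_eq_mul]
  have hc : #(Aᶜ.filter (fun x => x ∈ Y)) = #Y - #A := by
    rw [← Finset.card_sdiff_of_subset hY.2]
    congr 1
    ext x
    simp [and_comm]
  rw [hc]
  obtain ⟨u, hu⟩ : ∃ u, n - #A = u + 1 := ⟨n - #A - 1, by omega⟩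
  obtain ⟨v, hv⟩ : ∃ v, #Y - #A = v + 1 := ⟨#Y - #A - 1, by omega⟩
  rw [hu, hv]
  simp only [Nat.add_sub_cancel]
  have hvu : v ≤ u := by omega
  have k1 := Nat.add_one_mul_choose_eq u v
  have k2 : ((u + 1 : ℕ) : ℝ) * (u.choose v : ℝ) = ((u+1).choose (v+1) : ℝ) * ((v + 1 : ℕ) : ℝ) := by
    exact_mod_cast k1
  have p1 : (u.choose v : ℝ) ≠ 0 := by exact_mod_cast (Nat.choose_pos hvu).ne'
  have p2 : ((u+1).choose (v+1) : ℝ) ≠ 0 := by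
    exact_mod_cast (Nat.choose_pos (by omega : v + 1 ≤ u + 1)).ne'
  field_simp
  linear_combination (wt n #Y) * k2

lemma UU_mem (n : ℕ) (F : Finset (Finset (Fin n))) (A : Finset (Fin n)) (hA : A ∈ F) (g : ℕ → ℝ) :
    ∑ Y ∈ F.filter (fun Y => A ⊆ Y), g #Y * (1 / ((n - #A).choose (#Y - #A) : ℝ)) = g #A +
      ∑ Y ∈ F.filter (fun Y => A ⊂ Y), g #Y * (1 / ((n - #A).choose (#Y - #A) : ℝ)) := by
  classical
  have : F.filter (fun Y => A ⊆ Y) = insert A (F.filter (fun Y => A ⊂ Y)) := by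
    ext Y
    simp only [Finset.mem_filter, Finset.mem_insert]
    constructor
    · rintro ⟨h1, h2⟩
      rcases h2.eq_or_ssubset with h | h
      · exact Or.inl h.symm
      · exact Or.inr ⟨h1, h⟩
    · rintro (h | h)
      · rw [h]; exact ⟨hA, Finset.Subset.refl _⟩
      · exact ⟨h.1, h.2.subset⟩
  rw [this, Finset.sum_insert (by simp)]
  simp

/-- The total of the strict upper part is at most the number of levels. -/
lemma strict_le (n : ℕ) (F : Finset (Finset (Fin n))) (A : Finset (Fin n)) :
    ∑ Y ∈ F.filter (fun Y => A ⊂ Y), 1 / ((n - #A).choose (#Y - #A) : ℝ) ≤ ((n - #A : ℕ) : ℝ) := by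
  classical
  have h : ∑ Y ∈ F.filter (fun Y => A ⊂ Y), 1 / ((n - #A).choose (#Y - #A) : ℝ) =
      ∑ j ∈ Finset.Ioc #A n, ∑ Y ∈ (F.filter (fun Y => A ⊂ Y)).filter (fun Y => #Y = j),
        1 / ((n - #A).choose (#Y - #A) : ℝ) := by
    symm
    apply Finset.sum_fiberwise_of_maps_to
    intro Y hY
    rw [Finset.mem_Ioc]
    exact ⟨Finset.card_lt_card (Finset.mem_filter.1 hY).2, by simpa using Finset.card_le_univ Y⟩
  rw [h]
  have : ((n - #A : ℕ) : ℝ) = ∑ j ∈ Finset.Ioc #A n, (1:ℝ) := by simp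
  rw [this]
  refine Finset.sum_le_sum fun j _ => ?_
  refine le_trans ?_ (level_le n F A j)
  refine Finset.sum_le_sum_of_subset_of_nonneg ?_ ?_
  · intro Y
    simp only [Finset.mem_filter]
    rintro ⟨⟨h1, h2⟩, h3⟩
    exact ⟨h1, h2.subset, h3⟩
  · intro Y _ _; positivity

lemma UU_lt_B (n : ℕ) (hn : 7 ≤ n) (F : Finset (Finset (Fin n))) (hF : DkFree n 2 F)
    (A : Finset (Fin n)) (hA : A ∈ F) (hc : n ≤ 2 * #A) : UU n F A < 2.296 := by
  have hAn : #A ≤ n := by simpa using Finset.card_le_univ A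
  have e1 : UU n F A = _ := UU_mem n F A hA (wt n)
  set E := ∑ Y ∈ F.filter (fun Y => A ⊂ Y), 1 / ((n - #A).choose (#Y - #A) : ℝ) with hE
  have hE0 : 0 ≤ E := Finset.sum_nonneg fun Y _ => by positivity
  have e2 : ∑ Y ∈ F.filter (fun Y => A ⊂ Y), wt n #Y * (1 / ((n - #A).choose (#Y - #A) : ℝ)) ≤
      wt n (#A + 1) * E := by
    rw [hE, Finset.mul_sum]
    refine Finset.sum_le_sum fun Y hY => ?_
    have := Finset.card_lt_card (Finset.mem_filter.1 hY).2
    exact mul_le_mul_of_nonneg_right (wt_anti n _ _ (by omega) (by omega)) (by positivity)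
  have e3 := wt_succ n #A hAn
  have e4 := wt_le_one n #A
  have e5 := wt_nonneg n (#A + 1)
  obtain ⟨m, hm⟩ : ∃ m, n - #A = m := ⟨_, rfl⟩
  have hmR : (n:ℝ) - #A = m := by rw [← hm, Nat.cast_sub hAn]
  rw [hmR] at e3
  have hma : (m:ℝ) ≤ #A := by exact_mod_cast (by omega : m ≤ #A)
  have e6 : wt n (#A + 1) * (#A + 1) ≤ m := by
    rw [e3]; have : (0:ℝ) ≤ m := by positivity
    nlinarith
  rcases Nat.lt_or_ge m 3 with h | h
  · have e7 : E ≤ ((n - #A : ℕ) : ℝ) := strict_le n F A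
    rw [hm] at e7
    have hm2 : (m:ℝ) ≤ 2 := by exact_mod_cast (by omega : m ≤ 2)
    have ha5 : (5:ℝ) ≤ #A := by exact_mod_cast (by omega : 5 ≤ #A)
    have : wt n (#A + 1) ≤ 1/3 := by nlinarith
    have : wt n (#A + 1) * E ≤ 1/3 * 2 := mul_le_mul this (by linarith) hE0 (by norm_num)
    rw [e1]; linarith
  · have e7 := local_core n F hF A hA (by omega)
    rw [← hE, hm] at e7
    have hm3 : (3:ℝ) ≤ m := by exact_mod_cast h
    have e8 : wt n (#A + 1) ≤ m / (m + 1) := by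
      rw [le_div_iff₀ (by linarith)]
      nlinarith
    have e9 : (m:ℝ) / (m + 1) * (1 + 0.296 * (m + 1) / (m - 1)) ≤ 1.296 := by
      have : (0:ℝ) < m - 1 := by linarith
      have : (m:ℝ) / (m + 1) * (1 + 0.296 * (m + 1) / (m - 1)) = 
        (m * ((m - 1) + 0.296 * (m + 1))) / ((m + 1) * (m - 1)) := by field_simp
      rw [this, div_le_iff₀ (by positivity)]
      nlinarith
    have e10 : wt n (#A + 1) * E < 1.296 := by
      refine lt_of_lt_of_le ?_ e9
      refine lt_of_le_of_lt (mul_le_mul_of_nonneg_right e8 hE0) ?_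
      exact mul_lt_mul_of_pos_left e7 (by positivity)
    rw [e1]; norm_num at *; linarith

lemma UU_lt_A (n : ℕ) (hn : 7 ≤ n) (F : Finset (Finset (Fin n))) (hF : DkFree n 2 F)
    (A : Finset (Fin n)) (hA : A ∈ F) (hc : 2 * #A < n) : UU n F A < 2.296 := by
  classical
  have e1 := UU_mem n F A hA (fun _ => 1)
  simp only [one_mul] at e1
  have e7 := local_core n F hF A hA (by omega)
  obtain ⟨m, hm⟩ : ∃ m, n - #A = m := ⟨_, rfl⟩
  set E := ∑ Y ∈ F.filter (fun Y => A ⊂ Y), 1 / ((n - #A).choose (#Y - #A) : ℝ) with hE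
  have lev : ∀ j, ∑ Y ∈ F.filter (fun Y => A ⊆ Y),
      (if #Y = j then (1:ℝ) else 0) * (1 / ((n - #A).choose (#Y - #A) : ℝ)) ≤ 1 := by
    intro j
    refine le_trans (le_of_eq ?_) (level_le n F A j)
    rw [← Finset.filter_filter, Finset.sum_filter _ (s := F.filter (fun Y => A ⊆ Y))]
    refine Finset.sum_congr rfl fun Y _ => ?_
    split_ifs <;> simp
  rw [hm] at e7
  rcases Nat.even_or_odd' n with ⟨q, hq | hq⟩
  · have hq4 : (4:ℝ) ≤ q := by exact_mod_cast (by omega : 4 ≤ q)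
    have hmq : (q:ℝ) + 1 ≤ m := by exact_mod_cast (by omega : q + 1 ≤ m)
    set r : ℝ := q / (q + 1) with hr
    have hr0 : 0 < r := by positivity
    have hr1 : r ≤ 1 := by rw [hr, div_le_one (by linarith)]; linarith
    have hw1 : wt n (q + 1) ≤ r := by
      have h1 := wt_succ n q (by omega)
      have h2 := wt_le_one n q
      have h3 : (n:ℝ) - q = q := by rw [hq]; push_cast; ring
      rw [h3] at h1
      rw [hr, le_div_iff₀ (by linarith)]
      nlinarith
    have hw : ∀ j ≤ n, wt n j ≤ r + (1 - r) * (if j = q then 1 else 0) := by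
      intro j hj
      split_ifs with h
      · linarith [wt_le_one n j]
      · rw [mul_zero, add_zero]
        refine le_trans ?_ hw1
        rcases Nat.lt_or_ge q j with h' | h'
        · exact wt_anti n _ _ (by omega) (by omega)
        · rw [← wt_symm n j hj]
          exact wt_anti n _ _ (by omega) (by omega)
    have b1 : UU n F A ≤ r * (1 + E) + (1 - r) * 1 := by
      have : UU n F A ≤ ∑ Y ∈ F.filter (fun Y => A ⊆ Y), (r * (1 / ((n - #A).choose (#Y - #A) : ℝ)) +
          (1 - r) * ((if #Y = q then (1:ℝ) else 0) * (1 / ((n - #A).choose (#Y - #A) : ℝ)))) := by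
        unfold UU
        refine Finset.sum_le_sum fun Y _ => ?_
        have := mul_le_mul_of_nonneg_right (hw #Y (by simpa using Finset.card_le_univ Y))
          (by positivity : 0 ≤ 1 / ((n - #A).choose (#Y - #A) : ℝ))
        linarith
      refine this.trans ?_
      rw [Finset.sum_add_distrib, ← Finset.mul_sum, ← Finset.mul_sum, e1]
      have := mul_le_mul_of_nonneg_left (lev q) (by linarith : 0 ≤ 1 - r)
      linarith
    have b2 : ((m:ℝ) + 1) / (m - 1) ≤ (q + 2) / q := by
      rw [div_le_div_iff₀ (by linarith) (by linarith)]
      nlinarith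
    have b3 : E < 1 + 0.296 * ((q + 2) / q) := by
      rw [mul_div_assoc] at e7; linarith
    have b4 : r * E < r * (1 + 0.296 * ((q + 2) / q)) := mul_lt_mul_of_pos_left b3 hr0
    have b5 : r * (1 + 0.296 * ((q + 2) / q)) ≤ 1.296 := by
      have : r * (1 + 0.296 * ((q + 2) / q)) = (q + 0.296 * (q + 2)) / (q + 1) := by
        rw [hr]; field_simp
      rw [this, div_le_iff₀ (by linarith)]
      linarith
    norm_num at *; linarith
  · have hq4 : (3:ℝ) ≤ q := by exact_mod_cast (by omega : 3 ≤ q)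
    have hmq : (q:ℝ) + 1 ≤ m := by exact_mod_cast (by omega : q + 1 ≤ m)
    set r : ℝ := q / (q + 2) with hr
    have hr0 : 0 < r := by positivity
    have hr1 : r ≤ 1 := by rw [hr, div_le_one (by linarith)]; linarith
    have hw1 : wt n (q + 2) ≤ r := by
      have h1 := wt_succ n (q + 1) (by omega)
      have h2 := wt_le_one n (q + 1)
      have h3 : (n:ℝ) - (q + 1 : ℕ) = q := by rw [hq]; push_cast; ring
      rw [h3] at h1
      push_cast at h1
      rw [hr, le_div_iff₀ (by linarith)]
      have h4 : wt n (q + 1 + 1) = wt n (q + 2) := rfl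
      rw [h4] at h1
      nlinarith
    have hw : ∀ j ≤ n, wt n j ≤ r + (1 - r) * (if j = q then 1 else 0) +
        (1 - r) * (if j = q + 1 then 1 else 0) := by
      intro j hj
      split_ifs with h h2 h2
      · omega
      · linarith [wt_le_one n j]
      · linarith [wt_le_one n j]
      · rw [mul_zero, add_zero, add_zero]
        refine le_trans ?_ hw1
        rcases Nat.lt_or_ge q j with h' | h'
        · exact wt_anti n _ _ (by omega) (by omega)
        · rw [← wt_symm n j hj]
          exact wt_anti n _ _ (by omega) (by omega)
    have b1 : UU n F A ≤ r * (1 + E) + (1 - r) * 1 + (1 - r) * 1 := by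
      have : UU n F A ≤ ∑ Y ∈ F.filter (fun Y => A ⊆ Y), (r * (1 / ((n - #A).choose (#Y - #A) : ℝ)) +
          (1 - r) * ((if #Y = q then (1:ℝ) else 0) * (1 / ((n - #A).choose (#Y - #A) : ℝ))) +
          (1 - r) * ((if #Y = q + 1 then (1:ℝ) else 0) * (1 / ((n - #A).choose (#Y - #A) : ℝ)))) := by
        unfold UU
        refine Finset.sum_le_sum fun Y _ => ?_
        have := mul_le_mul_of_nonneg_right (hw #Y (by simpa using Finset.card_le_univ Y))
          (by positivity : 0 ≤ 1 / ((n - #A).choose (#Y - #A) : ℝ))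
        linarith
      refine this.trans ?_
      rw [Finset.sum_add_distrib, Finset.sum_add_distrib, ← Finset.mul_sum, ← Finset.mul_sum,
        ← Finset.mul_sum, e1]
      have := mul_le_mul_of_nonneg_left (lev q) (by linarith : 0 ≤ 1 - r)
      have := mul_le_mul_of_nonneg_left (lev (q + 1)) (by linarith : 0 ≤ 1 - r)
      linarith
    have b2 : ((m:ℝ) + 1) / (m - 1) ≤ (q + 2) / q := by
      rw [div_le_div_iff₀ (by linarith) (by linarith)]
      nlinarith
    have b3 : E < 1 + 0.296 * ((q + 2) / q) := by
      rw [mul_div_assoc] at e7; linarith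
    have b4 : r * E < r * (1 + 0.296 * ((q + 2) / q)) := mul_lt_mul_of_pos_left b3 hr0
    have b5 : r * (1 + 0.296 * ((q + 2) / q)) = r + 0.296 := by
      rw [hr]; field_simp
    norm_num at *; linarith

lemma UU_lt (n : ℕ) (hn : 7 ≤ n) (F : Finset (Finset (Fin n))) (hF : DkFree n 2 F) :
    ∀ (d : ℕ) (A : Finset (Fin n)), n - #A = d → UU n F A < 2.296 := by
  classical
  intro d
  induction d with
  | zero =>
    intro A hd
    have hAn : #A ≤ n := by simpa using Finset.card_le_univ A
    by_cases hA : A ∈ F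
    · exact UU_lt_B n hn F hF A hA (by omega)
    · have hu : A = univ := by
        rw [← Finset.card_eq_iff_eq_univ, Fintype.card_fin]; omega
      unfold UU
      rw [Finset.sum_eq_zero]
      · norm_num
      · intro Y hY
        exfalso
        rw [Finset.mem_filter, hu, Finset.univ_subset_iff] at hY
        rw [hY.2, ← hu] at hY
        exact hA hY.1
  | succ d ih =>
    intro A hd
    by_cases hA : A ∈ F
    · rcases Nat.lt_or_ge (2 * #A) n with h | h
      · exact UU_lt_A n hn F hF A hA h
      · exact UU_lt_B n hn F hF A hA h
    · have h1 := UU_rec n F A hA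
      have hcard : #(Aᶜ) = d + 1 := by rw [Finset.card_compl, Fintype.card_fin, hd]
      have h2 : ∑ x ∈ Aᶜ, UU n F (insert x A) < ∑ x ∈ Aᶜ, (2.296 : ℝ) := by
        refine Finset.sum_lt_sum_of_nonempty (Finset.card_pos.1 (by omega)) fun x hx => ih _ ?_
        rw [Finset.card_insert_of_notMem (Finset.mem_compl.1 hx)]; omega
      rw [Finset.sum_const, hcard, nsmul_eq_mul, ← h1, hd] at h2
      exact lt_of_mul_lt_mul_left h2 (by positivity)

end glob

/-- For `n ≥ 7`, every diamond-free family of subsets of `[n]` has size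
less than `2.296 · C(n, ⌊n/2⌋)`. -/
theorem diamondFree_card_lt (n : ℕ) (hn : 7 ≤ n)
    (F : Finset (Finset (Fin n))) (hF : DkFree n 2 F) :
    (F.card : ℝ) < 2.296 * (n.choose (n / 2)) := by
  have h := UU_lt n hn F hF _ ∅ rfl
  have e : UU n F ∅ = (F.card : ℝ) / (n.choose (n / 2)) := by
    unfold UU
    have h2 : ∀ Y ∈ F.filter (fun Y => ∅ ⊆ Y), wt n #Y *
        (1 / ((n - #(∅ : Finset (Fin n))).choose (#Y - #(∅ : Finset (Fin n))) : ℝ)) =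
        1 / (n.choose (n / 2) : ℝ) := by
      intro Y _
      have hYn : #Y ≤ n := by simpa using Finset.card_le_univ Y
      have : (n.choose #Y : ℝ) ≠ 0 := by exact_mod_cast (Nat.choose_pos hYn).ne'
      simp only [Finset.card_empty, Nat.sub_zero, wt]
      field_simp
    rw [Finset.sum_congr rfl h2, Finset.sum_const, nsmul_eq_mul]
    simp [div_eq_mul_inv]
  rw [e, div_lt_iff₀ (mid_pos n)] at h
  exact h
end

section
/- There exists N such that for all n ≥ N, every diamond-free family F of subsets of [n] satisfies |F| ≤ (25/11 + 2/n²) · C(n, ⌊n/2⌋). -/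
open Finset

section Lubell
variable {α : Type*} [Fintype α] [DecidableEq α]

/-- Weighted Lubell function of the up-set of `A`. -/
noncomputable def Lub (w : Finset α → ℝ) (A : Finset α) : ℝ :=
  ∑ S ∈ univ.filter (fun S => A ⊆ S), w S / ((Fintype.card α - #A).choose (#S - #A) : ℕ)

lemma Lub_rec (w : Finset α → ℝ) (A : Finset α) :
    ((Fintype.card α - #A : ℕ) : ℝ) * Lub w A =
      ((Fintype.card α - #A : ℕ) : ℝ) * w A + ∑ x ∈ Aᶜ, Lub w (insert x A) := by
  have h1 : ∑ x ∈ Aᶜ, Lub w (insert x A) =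
      ∑ S ∈ univ.filter (fun S => A ⊆ S), ((#S - #A : ℕ) : ℝ) *
        (w S / ((Fintype.card α - (#A + 1)).choose (#S - (#A + 1)) : ℕ)) := by
    have : ∀ x ∈ Aᶜ, Lub w (insert x A) =
        ∑ S ∈ univ.filter (fun S => A ⊆ S), if x ∈ S then
          (w S / ((Fintype.card α - (#A + 1)).choose (#S - (#A + 1)) : ℕ)) else 0 := by
      intro x hx
      have hx' : x ∉ A := by simpa using hx
      unfold Lub
      rw [← Finset.sum_filter, Finset.filter_filter, card_insert_of_notMem hx']
      refine Finset.sum_congr ?_ (fun _ _ => rfl)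
      ext S
      simp [insert_subset_iff, and_comm]
    rw [Finset.sum_congr rfl this, Finset.sum_comm]
    refine Finset.sum_congr rfl fun S hS => ?_
    have hAS : A ⊆ S := by simpa using hS
    rw [← Finset.sum_filter, Finset.sum_const, nsmul_eq_mul]
    congr 2
    rw [← card_sdiff_of_subset hAS]
    congr 1
    ext x
    simp [and_comm]
  rw [h1]
  unfold Lub
  rw [Finset.mul_sum]
  have hA : A ∈ univ.filter (fun S => A ⊆ S) := by simp
  rw [← Finset.add_sum_erase _ _ hA, ← Finset.add_sum_erase _ _ hA]
  simp only [Nat.sub_self, Nat.choose_zero_right, Nat.cast_zero, zero_mul, zero_add, Nat.cast_one,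
    div_one]
  congr 1
  refine Finset.sum_congr rfl fun S hS => ?_
  have hAS : A ⊂ S := by
    simp only [mem_erase, mem_filter, mem_univ, true_and] at hS
    exact lt_of_le_of_ne hS.2 (Ne.symm hS.1)
  have h2 := card_lt_card hAS
  have h3 : #S ≤ Fintype.card α := card_le_univ S
  obtain ⟨s, hs⟩ : ∃ s, #S = #A + 1 + s := ⟨#S - #A - 1, by omega⟩
  obtain ⟨m, hm⟩ : ∃ m, Fintype.card α = #A + 1 + m := ⟨Fintype.card α - #A - 1, by omega⟩
  have e1 : Fintype.card α - #A = m + 1 := by omega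
  have e2 : #S - #A = s + 1 := by omega
  have e3 : Fintype.card α - (#A + 1) = m := by omega
  have e4 : #S - (#A + 1) = s := by omega
  rw [e1, e2, e3, e4]
  have h4 := Nat.add_one_mul_choose_eq m s
  have p1 : (0:ℝ) < m.choose s := by exact_mod_cast Nat.choose_pos (by omega)
  have p2 : (0:ℝ) < (m+1).choose (s+1) := by exact_mod_cast Nat.choose_pos (by omega)
  have h5 : ((m + 1 : ℕ) : ℝ) * m.choose s = (m+1).choose (s+1) * ((s + 1 : ℕ) : ℝ) := by
    exact_mod_cast h4
  field_simp
  linear_combination w S * h5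

lemma Lub_univ (w : Finset α → ℝ) : Lub w univ = w univ := by
  unfold Lub
  have : univ.filter (fun S : Finset α => univ ⊆ S) = {univ} := by
    ext S; simp [univ_subset_iff]
  rw [this]; simp

lemma Lub_le_of (w : Finset α → ℝ) {κ : ℝ} (hκ : 0 ≤ κ) :
    ∀ (m : ℕ) (A : Finset α), Fintype.card α - #A = m →
      (∀ B, A ⊆ B → w B ≠ 0 → Lub w B ≤ κ) → Lub w A ≤ κ := by
  intro m
  induction m with
  | zero =>
    intro A hA h
    have : A = univ := by
      rw [← Finset.card_eq_iff_eq_univ]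
      have := card_le_univ A
      omega
    by_cases hw : w A = 0
    · subst this; rw [Lub_univ, hw]; exact hκ
    · exact h A le_rfl hw
  | succ m ih =>
    intro A hA h
    by_cases hw : w A = 0
    · have hr := Lub_rec w A
      rw [hw, mul_zero, zero_add] at hr
      have : ∑ x ∈ Aᶜ, Lub w (insert x A) ≤ ∑ x ∈ Aᶜ, κ := by
        refine Finset.sum_le_sum fun x hx => ih _ ?_ ?_
        · rw [card_insert_of_notMem (by simpa using hx)]; omega
        · intro B hB; exact h B ((subset_insert _ _).trans hB)
      rw [Finset.sum_const, card_compl, nsmul_eq_mul, ← hr, hA] at this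
      exact le_of_mul_le_mul_left this (by positivity)
    · exact h A le_rfl hw

lemma Lub_le (w : Finset α → ℝ) {κ : ℝ} (hκ : 0 ≤ κ) (A : Finset α)
    (h : ∀ B, A ⊆ B → w B ≠ 0 → Lub w B ≤ κ) : Lub w A ≤ κ :=
  Lub_le_of w hκ _ A rfl h

lemma Lub_congr {w w' : Finset α → ℝ} {A : Finset α} (h : ∀ B, A ⊆ B → w B = w' B) :
    Lub w A = Lub w' A := by
  unfold Lub
  refine Finset.sum_congr rfl fun S hS => ?_
  rw [h S (by simpa using hS)]

lemma Lub_mono {w w' : Finset α → ℝ} {A : Finset α} (h : ∀ B, A ⊆ B → w B ≤ w' B) :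
    Lub w A ≤ Lub w' A := by
  unfold Lub
  refine Finset.sum_le_sum fun S hS => ?_
  have := h S (by simpa using hS)
  gcongr

lemma Lub_sub (w w' : Finset α → ℝ) (A : Finset α) :
    Lub (fun S => w S - w' S) A = Lub w A - Lub w' A := by
  unfold Lub
  rw [← Finset.sum_sub_distrib]
  exact Finset.sum_congr rfl fun S _ => by rw [sub_div]

lemma Lub_nonneg {w : Finset α → ℝ} (A : Finset α) (h : ∀ B, A ⊆ B → 0 ≤ w B) :
    0 ≤ Lub w A := by
  unfold Lub
  refine Finset.sum_nonneg fun S hS => ?_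
  have := h S (by simpa using hS)
  positivity

lemma Lub_eq_zero {w : Finset α → ℝ} (A : Finset α) (h : ∀ B, A ⊆ B → w B = 0) :
    Lub w A = 0 := by
  unfold Lub
  refine Finset.sum_eq_zero fun S hS => ?_
  rw [h S (by simpa using hS), zero_div]

lemma Lub_eq_self {w : Finset α → ℝ} (A : Finset α) (h : ∀ B, A ⊂ B → w B = 0) :
    Lub w A = w A := by
  unfold Lub
  rw [Finset.sum_eq_single A]
  · simp
  · intro B hB hne
    rw [h B (lt_of_le_of_ne (by simpa using hB) (Ne.symm hne)), zero_div]
  · intro h; simp at h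

/-- Indicator weight. -/
noncomputable def ind (F : Finset (Finset α)) (S : Finset α) : ℝ := if S ∈ F then 1 else 0

lemma ind_nonneg (F : Finset (Finset α)) (S : Finset α) : 0 ≤ ind F S := by
  unfold ind; split_ifs <;> norm_num

/-- LYM above `A`. -/
lemma Lub_antichain (F : Finset (Finset α)) (A : Finset α)
    (h : ∀ B ∈ F, ∀ C ∈ F, A ⊆ B → ¬ B ⊂ C) : Lub (ind F) A ≤ 1 := by
  refine Lub_le _ zero_le_one A fun B hAB hB => ?_
  have hBF : B ∈ F := by
    by_contra hn; exact hB (by simp [ind, hn])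
  rw [Lub_eq_self]
  · simp [ind, hBF]
  · intro C hC
    have : C ∉ F := fun hCF => h B hBF C hCF hAB hC
    simp [ind, this]

/-- Weight counting the comparable pairs with a given bottom. -/
noncomputable def dw (F : Finset (Finset α)) (B : Finset α) : ℝ :=
  ind F B * (Lub (ind F) B - ind F B)

lemma Lub_sub_self_nonneg (F : Finset (Finset α)) (B : Finset α) :
    0 ≤ Lub (ind F) B - ind F B := by
  unfold Lub
  have hB : B ∈ univ.filter (fun S => B ⊆ S) := by simp
  rw [← Finset.add_sum_erase _ _ hB]
  simp only [Nat.sub_self, Nat.choose_zero_right, Nat.cast_one, div_one, add_sub_cancel_left]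
  exact Finset.sum_nonneg fun S _ => div_nonneg (ind_nonneg _ _) (by positivity)

lemma dw_nonneg (F : Finset (Finset α)) (B : Finset α) : 0 ≤ dw F B :=
  mul_nonneg (ind_nonneg _ _) (Lub_sub_self_nonneg _ _)

lemma Lub_le_one_add (F : Finset (Finset α)) (A : Finset α) :
    Lub (ind F) A ≤ 1 + Lub (dw F) A := by
  have : Lub (fun S => ind F S - dw F S) A ≤ 1 := by
    refine Lub_le _ zero_le_one A fun B hAB hB => ?_
    have hBF : B ∈ F := by
      by_contra hn; exact hB (by simp [dw, ind, hn])
    rw [Lub_sub]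
    have h1 : dw F B ≤ Lub (dw F) B := by
      have : Lub (fun S => if S = B then dw F B else 0) B = dw F B := by
        rw [Lub_eq_self]
        · simp
        · intro C hC; simp [hC.ne']
      rw [← this]
      refine Lub_mono fun C _ => ?_
      split_ifs with h
      · rw [h]
      · exact dw_nonneg _ _
    have h2 : ind F B = 1 := by simp [ind, hBF]
    unfold dw at h1 ⊢
    rw [h2] at h1
    linarith
  rw [Lub_sub] at this
  linarith

end Lubell
lemma cubA (b : ℝ) (h0 : 0 ≤ b) (h1 : b ≤ 1) : b*((1-b) + 3/8*(11*b/6-1)^2) ≤ 27/100 := by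
  nlinarith [mul_nonneg h0 (sub_nonneg.2 h1), sq_nonneg (b-1/2), mul_nonneg h0 (sq_nonneg (b-1/2)), mul_nonneg (sub_nonneg.2 h1) (sq_nonneg (b-1/2)), mul_nonneg (sub_nonneg.2 h1) (sq_nonneg (b-2/5)), mul_nonneg (sub_nonneg.2 h1) (sq_nonneg (b-3/5))]
lemma polyP2 (b Q : ℝ) (h0 : 0 ≤ b) (h1 : b ≤ 1)  :
    b*((1-b)*(1-Q) + 5/6*(b-Q)*Q + Q^2/6) ≤ 27/100 := by
  have := cubA b h0 h1
  have : 0 ≤ b * (Q - 3/4*(11*b/6-1))^2 := by positivity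
  nlinarith
lemma polyP1 (b Q : ℝ) (h0 : 0 ≤ b) (h1 : b ≤ 1) (hQ : 0 ≤ Q) (hb : Q ≤ b) :
    b*((1-b)*(1-Q) + 5/6*(b-Q)*Q + Q^3/4) ≤ 27/100 := by
  rcases le_total Q (2/3) with h | h
  · have h2 := polyP2 b Q h0 h1
    have : 0 ≤ b * (Q^2 * (2/3 - Q)) := mul_nonneg h0 (mul_nonneg (sq_nonneg _) (by linarith))
    nlinarith
  · have e1 : 5/6*(1-Q)*Q + Q^3/4 ≤ 27/100 := by
      nlinarith [mul_nonneg (sub_nonneg.2 (hb.trans h1)) (sq_nonneg (Q-3/4)), sq_nonneg (Q-3/4)]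
    have e2 : 0 ≤ 5/6*Q*(1+b) - 5/6*Q^2 + Q^3/4 - b*(1-Q) := by
      have : 0 ≤ Q^3 := by positivity
      nlinarith [mul_nonneg hQ (sub_nonneg.2 hb)]
    nlinarith [mul_nonneg (sub_nonneg.2 h1) e2]
lemma polyP3 (b Q : ℝ) (h0 : 0 ≤ b) (h1 : b ≤ 1) (hQ : 0 ≤ Q) (hb : Q ≤ b) :
    b*((1-b)*(2*Q-1) + 5/6*(b-Q)*Q + Q^3/4) ≤ 27/100 := by
  nlinarith [mul_nonneg h0 (sub_nonneg.2 h1), mul_nonneg hQ (sub_nonneg.2 hb), mul_nonneg h0 (sub_nonneg.2 hb), mul_nonneg hQ (sub_nonneg.2 h1), mul_nonneg (mul_nonneg h0 (sub_nonneg.2 h1)) (sub_nonneg.2 hb), mul_nonneg (sub_nonneg.2 hb) (sq_nonneg (Q-3/4)), mul_nonneg (sub_nonneg.2 h1) (sq_nonneg (Q-3/4)), sq_nonneg (Q-3/4)]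
lemma polyP4 (b Q : ℝ) (h0 : 0 ≤ b) (h1 : b ≤ 1) (hQ : 0 ≤ Q) (hb : Q ≤ b) :
    b*((1-b)*(2*Q-1) + 5/6*(b-Q)*Q + Q^2/6) ≤ 27/100 := by
  nlinarith [mul_nonneg h0 (sub_nonneg.2 h1), mul_nonneg hQ (sub_nonneg.2 hb), mul_nonneg h0 (sub_nonneg.2 hb), mul_nonneg hQ (sub_nonneg.2 h1), mul_nonneg (mul_nonneg h0 (sub_nonneg.2 h1)) (sub_nonneg.2 hb), mul_nonneg h0 (sq_nonneg (Q-5/8)), mul_nonneg (sub_nonneg.2 h1) (sq_nonneg (Q-5/8)), sq_nonneg (Q-5/8)]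

lemma local_ineq (a b D Q S e : ℝ) (ha : 0 ≤ a) (hb : 0 ≤ b) (hab : a + b = 1) (hD : 0 ≤ D)
    (hQ : 0 ≤ Q) (hDQ : D + Q = b) (hS : 0 ≤ S) (hSa : S ≤ a) (he : 0 ≤ e) (heQ : e ≤ Q^2) :
    b * (a*(2*S-a) + D*(2*S-a) + Q*(a-S) + 1/6*e + 5/6*D*Q + 1/4*(Q*(Q^2-e))) ≤ 27/100 := by
  have h1 : b ≤ 1 := by linarith
  have hQb : Q ≤ b := by linarith
  have p1 := polyP1 b Q hb h1 hQ hQb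
  have p2 := polyP2 b Q hb h1
  have p3 := polyP3 b Q hb h1 hQ hQb
  have p4 := polyP4 b Q hb h1 hQ hQb
  obtain rfl : a = 1 - b := by linarith
  obtain rfl : D = b - Q := by linarith
  -- linear in e
  have key : ∀ S', S' = 0 ∨ S' = 1 - b → b * ((1-b)*(2*S'-(1-b)) + (b-Q)*(2*S'-(1-b)) + Q*((1-b)-S')
      + 1/6*e + 5/6*(b-Q)*Q + 1/4*(Q*(Q^2-e))) ≤ 27/100 := by
    intro S' hS'
    rcases le_total Q (2/3) with h | h
    · have : 0 ≤ b * ((Q^2 - e) * (2/3 - Q)) :=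
        mul_nonneg hb (mul_nonneg (by linarith) (by linarith))
      rcases hS' with rfl | rfl <;> nlinarith
    · have : 0 ≤ b * (e * (Q - 2/3)) :=
        mul_nonneg hb (mul_nonneg (by linarith) (by linarith))
      rcases hS' with rfl | rfl <;> nlinarith
  have k0 := key 0 (Or.inl rfl)
  have k1 := key (1-b) (Or.inr rfl)
  rcases le_total 0 (2*(1-b) + 2*(b-Q) - Q) with h | h
  · have : 0 ≤ b * ((1 - b - S) * (2*(1-b) + 2*(b-Q) - Q)) :=
      mul_nonneg hb (mul_nonneg (by linarith) h)
    nlinarith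
  · have : 0 ≤ b * (S * (-(2*(1-b) + 2*(b-Q) - Q))) :=
      mul_nonneg hb (mul_nonneg (by linarith) (by linarith))
    nlinarith

section Count
variable {α : Type*} [Fintype α]

/-- Pointwise excess bound for the first three elements of a chain. -/
def gg (χ : α → ℝ) (s ε : α → α → ℝ) (p q r : α) : ℝ :=
  χ p * (1 - χ q) * χ r * s p q
  + (1 - χ p) * χ q * χ r * (s q p - 1)
  + χ p * (1 - χ q) * (1 - χ r) * (ε q r * s p q + (1 - ε q r))
  + (1 - χ p) * χ q * (1 - χ r) * (ε p r * (s q p - 1))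
  + (1 - χ p) * (1 - χ q) * χ r * (-((1 - ε p q) * s r p))
  + (1 - χ p) * (1 - χ q) * (1 - χ r) * (ε p q * (1 - ε p r) * (1 - ε q r))

/-- Indicator of an independent quadruple. -/
def ii (χ : α → ℝ) (ε : α → α → ℝ) (p q r t : α) : ℝ :=
  (1 - χ p) * (1 - χ q) * (1 - χ r) * (1 - χ t) *
    ((1 - ε p q) * (1 - ε p r) * (1 - ε p t) * (1 - ε q r) * (1 - ε q t) * (1 - ε r t))

set_option maxHeartbeats 1000000 in
lemma count_bound (χ : α → ℝ) (s ε : α → α → ℝ)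
    (hχ0 : ∀ p, 0 ≤ χ p) (hχ1 : ∀ p, χ p ≤ 1) (hs0 : ∀ p q, 0 ≤ s p q) (hs1 : ∀ p q, s p q ≤ 1)
    (he0 : ∀ p q, 0 ≤ ε p q) (he1 : ∀ p q, ε p q ≤ 1) (hes : ∀ p q, ε p q = ε q p)
    (n : ℝ) (hn : n = Fintype.card α) (hn0 : 0 < n) :
    n * ∑ p, ∑ q, ∑ r, gg χ s ε p q r + 1/4 * ∑ p, ∑ q, ∑ r, ∑ t, ii χ ε p q r t
      ≤ 27/100 * n^4 := by
  set A : ℝ := ∑ x, χ x with hA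
  set B : ℝ := ∑ x, (1 - χ x) with hB
  set S : α → ℝ := fun y => ∑ x, χ x * s x y with hS
  set D : α → ℝ := fun y => ∑ z, (1 - χ z) * ε y z with hD
  set Q : α → ℝ := fun y => ∑ z, (1 - χ z) * (1 - ε y z) with hQ
  set e : α → ℝ := fun y => ∑ v, ∑ w, ((1 - χ v) * (1 - χ w)) * ((1 - ε y v) * (1 - ε y w) * ε v w)
    with he
  have hψ : ∀ p, 0 ≤ 1 - χ p := fun p => by linarith [hχ1 p]
  have hε : ∀ p q, 0 ≤ 1 - ε p q := fun p q => by linarith [he1 p q]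
  have hA0 : 0 ≤ A := Finset.sum_nonneg fun x _ => hχ0 x
  have hB0 : 0 ≤ B := Finset.sum_nonneg fun x _ => hψ x
  have hAB : A + B = n := by
    rw [hA, hB, ← Finset.sum_add_distrib, hn]; simp
  have hDQ : ∀ y, D y + Q y = B := fun y => by
    simp only [hD, hQ, hB]
    rw [← Finset.sum_add_distrib]
    exact Finset.sum_congr rfl fun z _ => by ring
  have hD0 : ∀ y, 0 ≤ D y := fun y => Finset.sum_nonneg fun z _ => mul_nonneg (hψ z) (he0 _ _)
  have hQ0 : ∀ y, 0 ≤ Q y := fun y => Finset.sum_nonneg fun z _ => mul_nonneg (hψ z) (hε _ _)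
  have hS0 : ∀ y, 0 ≤ S y := fun y => Finset.sum_nonneg fun z _ => mul_nonneg (hχ0 z) (hs0 _ _)
  have hSA : ∀ y, S y ≤ A := fun y => Finset.sum_le_sum fun z _ =>
    mul_le_of_le_one_right (hχ0 z) (hs1 _ _)
  have hee0 : ∀ y, 0 ≤ e y := fun y => Finset.sum_nonneg fun v _ => Finset.sum_nonneg fun w _ => by
    have := hψ v; have := hψ w; have := hε y v; have := hε y w; have := he0 v w
    positivity
  have hQe : ∀ y, Q y ^ 2 - e y = ∑ v, ∑ w, ((1 - χ v) * (1 - χ w)) *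
      ((1 - ε y v) * (1 - ε y w) * (1 - ε v w)) := fun y => by
    simp only [hQ, he]
    rw [sq, Finset.sum_mul_sum, ← Finset.sum_sub_distrib]
    refine Finset.sum_congr rfl fun v _ => ?_
    rw [← Finset.sum_sub_distrib]
    exact Finset.sum_congr rfl fun w _ => by ring
  have heQ : ∀ y, e y ≤ Q y ^ 2 := fun y => by
    rw [← sub_nonneg, hQe]
    refine Finset.sum_nonneg fun v _ => Finset.sum_nonneg fun w _ => ?_
    have := hψ v; have := hψ w; have := hε y v; have := hε y w; have := hε v w
    positivity
  -- the individual sums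
  have t1 : ∑ p, ∑ q, ∑ r, χ p * (1 - χ q) * χ r * s p q = ∑ y, (1 - χ y) * (A * S y) := by
    rw [Finset.sum_comm]
    refine Finset.sum_congr rfl fun y _ => ?_
    simp only [hA, hS]
    rw [mul_comm (∑ x, χ x), Finset.sum_mul_sum, Finset.mul_sum]
    refine Finset.sum_congr rfl fun x _ => ?_
    rw [Finset.mul_sum]
    exact Finset.sum_congr rfl fun w _ => by ring
  have t2 : ∑ p, ∑ q, ∑ r, (1 - χ p) * χ q * χ r * (s q p - 1)
      = ∑ y, (1 - χ y) * (A * (S y - A)) := by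
    refine Finset.sum_congr rfl fun y _ => ?_
    have : S y - A = ∑ x, χ x * (s x y - 1) := by
      simp only [hA, hS]
      rw [← Finset.sum_sub_distrib]
      exact Finset.sum_congr rfl fun w _ => by ring
    rw [this]
    simp only [hA]
    rw [mul_comm (∑ x, χ x), Finset.sum_mul_sum, Finset.mul_sum]
    refine Finset.sum_congr rfl fun x _ => ?_
    rw [Finset.mul_sum]
    exact Finset.sum_congr rfl fun w _ => by ring
  have t3 : ∑ p, ∑ q, ∑ r, χ p * (1 - χ q) * (1 - χ r) * (ε q r * s p q + (1 - ε q r))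
      = ∑ y, (1 - χ y) * (S y * D y + A * Q y) := by
    rw [Finset.sum_comm]
    refine Finset.sum_congr rfl fun y _ => ?_
    simp only [hA, hS, hD, hQ]
    rw [Finset.sum_mul_sum, Finset.sum_mul_sum, ← Finset.sum_add_distrib, Finset.mul_sum]
    refine Finset.sum_congr rfl fun x _ => ?_
    rw [← Finset.sum_add_distrib, Finset.mul_sum]
    exact Finset.sum_congr rfl fun w _ => by ring
  have t4 : ∑ p, ∑ q, ∑ r, (1 - χ p) * χ q * (1 - χ r) * (ε p r * (s q p - 1))
      = ∑ y, (1 - χ y) * (S y * D y - A * D y) := by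
    refine Finset.sum_congr rfl fun y _ => ?_
    simp only [hA, hS, hD]
    rw [Finset.sum_mul_sum, Finset.sum_mul_sum, ← Finset.sum_sub_distrib, Finset.mul_sum]
    refine Finset.sum_congr rfl fun x _ => ?_
    rw [← Finset.sum_sub_distrib, Finset.mul_sum]
    exact Finset.sum_congr rfl fun w _ => by ring
  have t5 : ∑ p, ∑ q, ∑ r, (1 - χ p) * (1 - χ q) * χ r * (-((1 - ε p q) * s r p))
      = ∑ y, (1 - χ y) * (-(Q y * S y)) := by
    refine Finset.sum_congr rfl fun y _ => ?_
    simp only [hS, hQ]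
    rw [Finset.sum_mul_sum, mul_neg, Finset.mul_sum, ← Finset.sum_neg_distrib]
    refine Finset.sum_congr rfl fun x _ => ?_
    rw [Finset.mul_sum, ← Finset.sum_neg_distrib]
    exact Finset.sum_congr rfl fun w _ => by ring
  have t6 : ∑ p, ∑ q, ∑ r, (1 - χ p) * (1 - χ q) * (1 - χ r) *
      (ε p q * (1 - ε p r) * (1 - ε q r)) = ∑ y, (1 - χ y) * e y := by
    have : ∀ p, ∑ q, ∑ r, (1 - χ p) * (1 - χ q) * (1 - χ r) *
      (ε p q * (1 - ε p r) * (1 - ε q r)) = ∑ r, ∑ q, (1 - χ p) * (1 - χ q) * (1 - χ r) *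
      (ε p q * (1 - ε p r) * (1 - ε q r)) := fun p => Finset.sum_comm
    simp only [this]
    rw [Finset.sum_comm]
    refine Finset.sum_congr rfl fun y _ => ?_
    simp only [he]
    rw [Finset.mul_sum]
    refine Finset.sum_congr rfl fun x _ => ?_
    rw [Finset.mul_sum]
    exact Finset.sum_congr rfl fun w _ => by rw [hes y x, hes y w]; ring
  have t7 : ∑ p, ∑ q, ∑ r, (1 - χ p) * (1 - χ q) * (1 - χ r) *
      (ε p q * (1 - ε p r) * (1 - ε q r)) ≤ ∑ y, (1 - χ y) * (D y * Q y) := by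
    refine Finset.sum_le_sum fun y _ => ?_
    simp only [hD, hQ]
    rw [Finset.sum_mul_sum, Finset.mul_sum]
    refine Finset.sum_le_sum fun x _ => ?_
    rw [Finset.mul_sum]
    refine Finset.sum_le_sum fun w _ => ?_
    have h : 0 ≤ (1 - χ y) * (1 - χ x) * (1 - χ w) * (ε y x * (1 - ε y w)) := by
      have := hψ y; have := hψ x; have := hψ w; have := hε y w; have := he0 y x
      positivity
    refine le_trans (le_of_eq ?_) ((mul_le_of_le_one_right h
      (show 1 - ε x w ≤ 1 by linarith [he0 x w])).trans (le_of_eq ?_)) <;> ring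
  have t8 : ∑ p, ∑ q, ∑ r, ∑ t, ii χ ε p q r t ≤ ∑ y, (1 - χ y) * (Q y * (Q y ^ 2 - e y)) := by
    refine Finset.sum_le_sum fun y _ => ?_
    rw [hQe y, mul_comm (Q y), Finset.sum_mul, Finset.mul_sum]
    refine Finset.sum_le_sum fun v _ => ?_
    rw [Finset.sum_mul, Finset.mul_sum]
    refine Finset.sum_le_sum fun w _ => ?_
    simp only [hQ]
    rw [Finset.mul_sum, Finset.mul_sum]
    refine Finset.sum_le_sum fun t _ => ?_
    unfold ii
    have h : 0 ≤ (1 - χ y) * (1 - χ v) * (1 - χ w) * (1 - χ t) *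
        ((1 - ε y v) * (1 - ε y w) * (1 - ε y t) * (1 - ε v w)) := by
      have := hψ y; have := hψ v; have := hψ w; have := hψ t
      have := hε y v; have := hε y w; have := hε y t; have := hε v w
      positivity
    have h2 : (1 - ε v t) * (1 - ε w t) ≤ 1 :=
      mul_le_one₀ (by linarith [he0 v t]) (hε _ _) (by linarith [he0 w t])
    have := mul_le_of_le_one_right h h2
    refine le_trans (le_of_eq ?_) (this.trans (le_of_eq ?_)) <;> ring
  have hg : ∑ p, ∑ q, ∑ r, gg χ s ε p q r ≤ ∑ y, (1 - χ y) * (A * (2 * S y - A)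
      + D y * (2 * S y - A) + Q y * (A - S y) + 1/6 * e y + 5/6 * D y * Q y) := by
    unfold gg
    simp only [Finset.sum_add_distrib]
    rw [t1, t2, t3, t4, t5]
    have : ∑ y, (1 - χ y) * (A * (2 * S y - A)
      + D y * (2 * S y - A) + Q y * (A - S y) + 1/6 * e y + 5/6 * D y * Q y)
      = ∑ y, (1 - χ y) * (A * S y) + ∑ y, (1 - χ y) * (A * (S y - A))
        + ∑ y, (1 - χ y) * (S y * D y + A * Q y) + ∑ y, (1 - χ y) * (S y * D y - A * D y)
        + ∑ y, (1 - χ y) * (-(Q y * S y)) + 1/6 * ∑ y, (1 - χ y) * e y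
        + 5/6 * ∑ y, (1 - χ y) * (D y * Q y) := by
      simp only [Finset.mul_sum, ← Finset.sum_add_distrib]
      exact Finset.sum_congr rfl fun y _ => by ring
    rw [this]
    linarith
  -- combine
  set R : α → ℝ := fun y => n * (A * (2 * S y - A)
      + D y * (2 * S y - A) + Q y * (A - S y) + 1/6 * e y + 5/6 * D y * Q y)
      + 1/4 * (Q y * (Q y ^ 2 - e y)) with hR
  have hL : n * ∑ p, ∑ q, ∑ r, gg χ s ε p q r + 1/4 * ∑ p, ∑ q, ∑ r, ∑ t, ii χ ε p q r t
      ≤ ∑ y, (1 - χ y) * R y := by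
    have : ∑ y, (1 - χ y) * R y = n * ∑ y, (1 - χ y) * (A * (2 * S y - A)
      + D y * (2 * S y - A) + Q y * (A - S y) + 1/6 * e y + 5/6 * D y * Q y)
      + 1/4 * ∑ y, (1 - χ y) * (Q y * (Q y ^ 2 - e y)) := by
      simp only [Finset.mul_sum, ← Finset.sum_add_distrib, hR]
      exact Finset.sum_congr rfl fun y _ => by ring
    rw [this]
    have := mul_le_mul_of_nonneg_left hg hn0.le
    linarith
  refine hL.trans ?_
  have hRy : ∀ y, B * R y ≤ 27/100 * n^4 := by
    intro y
    have := local_ineq (A/n) (B/n) (D y/n) (Q y/n) (S y/n) (e y/n^2) (by positivity) (by positivity)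
      (by rw [← add_div, hAB, div_self hn0.ne']) (div_nonneg (hD0 y) hn0.le)
      (div_nonneg (hQ0 y) hn0.le)
      (by rw [← add_div, hDQ]) (div_nonneg (hS0 y) hn0.le)
      (by gcongr; exact hSA y) (div_nonneg (hee0 y) (by positivity))
      (by rw [div_pow]; gcongr; exact heQ y)
    have h2 : B * R y = n^4 * (B/n * (A/n*(2*(S y/n)-A/n) + D y/n*(2*(S y/n)-A/n)
        + Q y/n*(A/n-S y/n) + 1/6*(e y/n^2) + 5/6*(D y/n)*(Q y/n)
        + 1/4*(Q y/n*((Q y/n)^2-e y/n^2)))) := by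
      simp only [hR]
      field_simp
    rw [h2]
    rw [mul_comm (27/100 : ℝ)]
    exact mul_le_mul_of_nonneg_left this (by positivity)
  rcases hB0.eq_or_lt with h | h
  · have hz : ∀ y, 1 - χ y = 0 := by
      intro y
      exact (Finset.sum_eq_zero_iff_of_nonneg (fun x _ => hψ x)).1 h.symm y (Finset.mem_univ y)
    rw [Finset.sum_eq_zero fun y _ => by rw [hz y, zero_mul]]
    positivity
  · have : B * ∑ y, (1 - χ y) * R y ≤ B * (27/100 * n^4) := by
      calc B * ∑ y, (1 - χ y) * R y = ∑ y, (1 - χ y) * (B * R y) := by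
            rw [Finset.mul_sum]; exact Finset.sum_congr rfl fun y _ => by ring
        _ ≤ ∑ y, (1 - χ y) * (27/100 * n^4) :=
            Finset.sum_le_sum fun y _ => mul_le_mul_of_nonneg_left (hRy y) (hψ y)
        _ = B * (27/100 * n^4) := by rw [← Finset.sum_mul]
    exact le_of_mul_le_mul_left this h

end Count

section Local
variable {α : Type*} [Fintype α] [DecidableEq α]

lemma Lub_exp3 (w : Finset α → ℝ) (h0 : w ∅ = 0) (hn : 3 ≤ Fintype.card α) :
    ((Fintype.card α : ℝ) * (Fintype.card α - 1) * (Fintype.card α - 2)) * Lub w ∅ =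
      ∑ p, ∑ q ∈ ({p} : Finset α)ᶜ, ∑ r ∈ ({q, p} : Finset α)ᶜ,
        (w {p} + w {q, p} + Lub w {r, q, p}) := by
  have e0 := Lub_rec w ∅
  rw [h0, mul_zero, zero_add, compl_empty, card_empty, Nat.sub_zero] at e0
  have e1 : ∀ p : α, ((Fintype.card α : ℝ) - 1) * Lub w {p} =
      ((Fintype.card α : ℝ) - 1) * w {p} + ∑ q ∈ ({p} : Finset α)ᶜ, Lub w {q, p} := by
    intro p
    have := Lub_rec w {p}
    rw [card_singleton, Nat.cast_sub (by omega), Nat.cast_one] at this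
    exact this
  have e2 : ∀ p : α, ∀ q ∈ ({p} : Finset α)ᶜ, ((Fintype.card α : ℝ) - 2) * Lub w {q, p} =
      ((Fintype.card α : ℝ) - 2) * w {q, p} + ∑ r ∈ ({q, p} : Finset α)ᶜ, Lub w {r, q, p} := by
    intro p q hq
    have := Lub_rec w {q, p}
    rw [card_pair (by simpa using hq), Nat.cast_sub (by omega), Nat.cast_ofNat] at this
    exact this
  have c1 : ∀ p : α, ((#(({p} : Finset α)ᶜ) : ℕ) : ℝ) = Fintype.card α - 1 := by
    intro p
    rw [card_compl, card_singleton, Nat.cast_sub (by omega), Nat.cast_one]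
  have c2 : ∀ p : α, ∀ q ∈ ({p} : Finset α)ᶜ,
      ((#(({q, p} : Finset α)ᶜ) : ℕ) : ℝ) = Fintype.card α - 2 := by
    intro p q hq
    rw [card_compl, card_pair (by simpa using hq), Nat.cast_sub (by omega), Nat.cast_ofNat]
  have e3 : ∀ p : α, ∀ q ∈ ({p} : Finset α)ᶜ, ∑ r ∈ ({q, p} : Finset α)ᶜ,
        (w {p} + w {q, p} + Lub w {r, q, p}) =
        ((Fintype.card α : ℝ) - 2) * (w {p} + Lub w {q, p}) := by
    intro p q hq
    rw [Finset.sum_add_distrib, Finset.sum_const, nsmul_eq_mul, c2 p q hq, mul_add _ _ (Lub w _),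
      e2 p q hq]
    ring
  have e4 : ∀ p : α, ∑ q ∈ ({p} : Finset α)ᶜ, ∑ r ∈ ({q, p} : Finset α)ᶜ,
        (w {p} + w {q, p} + Lub w {r, q, p}) =
        ((Fintype.card α : ℝ) - 2) * (((Fintype.card α : ℝ) - 1) * Lub w {p}) := by
    intro p
    rw [Finset.sum_congr rfl (e3 p), ← Finset.mul_sum, Finset.sum_add_distrib, Finset.sum_const,
      nsmul_eq_mul, c1, e1]
  rw [Finset.sum_congr rfl fun p _ => e4 p, ← Finset.mul_sum, ← Finset.mul_sum]
  have : ∑ p, Lub w {p} = Fintype.card α * Lub w ∅ := by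
    rw [e0]; rfl
  rw [this]; ring

lemma Lub_exp4 (w : Finset α → ℝ) (h0 : ∀ S, #S ≤ 3 → w S = 0) (hn : 4 ≤ Fintype.card α) :
    ((Fintype.card α : ℝ) * (Fintype.card α - 1) * (Fintype.card α - 2) * (Fintype.card α - 3))
        * Lub w ∅ =
      ∑ p, ∑ q ∈ ({p} : Finset α)ᶜ, ∑ r ∈ ({q, p} : Finset α)ᶜ, ∑ t ∈ ({r, q, p} : Finset α)ᶜ,
        Lub w {t, r, q, p} := by
  have h3 := Lub_exp3 w (h0 _ (by simp)) (by omega)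
  rw [mul_right_comm, h3, Finset.sum_mul]
  refine Finset.sum_congr rfl fun p _ => ?_
  rw [Finset.sum_mul]
  refine Finset.sum_congr rfl fun q hq => ?_
  rw [Finset.sum_mul]
  refine Finset.sum_congr rfl fun r hr => ?_
  have hqp : q ≠ p := by simpa using hq
  have hr' : r ≠ q ∧ r ≠ p := by simpa using hr
  have hc : #({r, q, p} : Finset α) = 3 := by
    rw [card_insert_of_notMem (by simp [hr'.1, hr'.2]), card_pair hqp]
  rw [h0 {p} (by simp), h0 {q, p} (by rw [card_pair hqp]; omega), zero_add, zero_add]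
  have := Lub_rec w {r, q, p}
  rw [h0 {r, q, p} (by omega), hc, Nat.cast_sub (by omega), mul_zero, zero_add] at this
  rw [mul_comm]
  exact_mod_cast this

lemma dist_sum_le (f : α → α → α → ℝ) (hf : ∀ p q r, -1 ≤ f p q r) :
    ∑ p, ∑ q ∈ ({p} : Finset α)ᶜ, ∑ r ∈ ({q, p} : Finset α)ᶜ, f p q r ≤
      ∑ p, ∑ q, ∑ r, f p q r + 3 * (Fintype.card α : ℝ)^2 := by
  have h1 : ∀ p q, ∑ r ∈ ({q, p} : Finset α)ᶜ, f p q r ≤ ∑ r, f p q r + 2 := by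
    intro p q
    rw [← Finset.sum_add_sum_compl ({q, p} : Finset α)]
    have : ∑ r ∈ ({q, p} : Finset α), (-1 : ℝ) ≤ ∑ r ∈ ({q, p} : Finset α), f p q r :=
      Finset.sum_le_sum fun r _ => hf p q r
    rw [Finset.sum_const, nsmul_eq_mul] at this
    have h2 : ((#({q, p} : Finset α) : ℕ) : ℝ) ≤ 2 := by exact_mod_cast card_le_two
    linarith
  have h2 : ∀ p, ∑ q ∈ ({p} : Finset α)ᶜ, ∑ r ∈ ({q, p} : Finset α)ᶜ, f p q r ≤
      ∑ q, ∑ r, f p q r + 3 * (Fintype.card α : ℝ) := by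
    intro p
    have : ∑ q ∈ ({p} : Finset α)ᶜ, ∑ r ∈ ({q, p} : Finset α)ᶜ, f p q r ≤
      ∑ q ∈ ({p} : Finset α)ᶜ, (∑ r, f p q r + 2) := Finset.sum_le_sum fun q _ => h1 p q
    refine this.trans ?_
    rw [Finset.sum_add_distrib, Finset.sum_const, nsmul_eq_mul,
      ← Finset.sum_add_sum_compl ({p} : Finset α) (fun q => ∑ r, f p q r), Finset.sum_singleton]
    have h3 : ((#(({p} : Finset α)ᶜ) : ℕ) : ℝ) ≤ Fintype.card α := by
      exact_mod_cast card_le_univ _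
    have h4 : ∑ r : α, (-1 : ℝ) ≤ ∑ r, f p p r := Finset.sum_le_sum fun r _ => hf p p r
    rw [Finset.sum_const, nsmul_eq_mul, card_univ] at h4
    linarith
  refine (Finset.sum_le_sum fun p _ => h2 p).trans ?_
  rw [Finset.sum_add_distrib, Finset.sum_const, nsmul_eq_mul, card_univ]
  apply le_of_eq; ring

lemma dw_eq (F : Finset (Finset α)) (B : Finset α) :
    dw F B = ∑ C : Finset α, if B ⊂ C then
      ind F B * ind F C / ((Fintype.card α - #B).choose (#C - #B) : ℕ) else 0 := by
  unfold dw Lub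
  have hB : B ∈ univ.filter (fun S => B ⊆ S) := by simp
  rw [← Finset.add_sum_erase _ _ hB]
  simp only [Nat.sub_self, Nat.choose_zero_right, Nat.cast_one, div_one, add_sub_cancel_left]
  rw [← Finset.sum_filter, Finset.mul_sum]
  refine Finset.sum_congr ?_ fun C _ => by rw [mul_div_assoc]
  ext C
  simp only [mem_erase, mem_filter, mem_univ, true_and]
  rw [Finset.ssubset_iff_subset_ne]
  tauto

lemma Lub_dw_le (F : Finset (Finset α)) (h3 : ∀ S ∈ F, 3 ≤ #S)
    (H : ∀ C ∈ F, ∀ B₁ ∈ F, ∀ B₂ ∈ F, B₁ ⊂ C → B₂ ⊂ C → B₁ = B₂) :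
    Lub (dw F) ∅ ≤ 1/4 * Lub (ind (F.filter fun C => ∃ B ∈ F, B ⊂ C)) ∅ := by
  have e : ∀ w : Finset α → ℝ, Lub w ∅ = ∑ S : Finset α, w S / ((Fintype.card α).choose #S : ℕ) := by
    intro w; unfold Lub; simp
  rw [e, e, Finset.mul_sum]
  simp only [dw_eq, Finset.sum_div]
  rw [Finset.sum_comm]
  refine Finset.sum_le_sum fun C _ => ?_
  by_cases hC : C ∈ F ∧ ∃ B ∈ F, B ⊂ C
  · obtain ⟨hCF, B, hB, hBC⟩ := hC
    rw [Finset.sum_eq_single B]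
    · have i1 : ind (F.filter fun C => ∃ B ∈ F, B ⊂ C) C = 1 := by
        unfold ind; rw [if_pos]; exact mem_filter.2 ⟨hCF, B, hB, hBC⟩
      rw [if_pos hBC, i1]
      simp only [ind, hB, hCF, if_true, mul_one]
      have hk := h3 B hB
      have hl := card_lt_card hBC
      have hn : #C ≤ Fintype.card α := card_le_univ C
      have hm := Nat.choose_mul (n := Fintype.card α) hl.le
      have h4 : 4 ≤ (#C).choose #B := by
        have a1 : (#B + 1).choose #B ≤ (#C).choose #B := Nat.choose_le_choose _ hl
        rw [Nat.choose_succ_self_right] at a1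
        omega
      rw [div_div]
      have p1 : (0:ℝ) < (Fintype.card α).choose #C := by exact_mod_cast Nat.choose_pos hn
      have hm' : (((Fintype.card α).choose #C : ℕ) : ℝ) * ((#C).choose #B : ℕ) =
        ((Fintype.card α).choose #B : ℕ) * ((Fintype.card α - #B).choose (#C - #B) : ℕ) := by
        exact_mod_cast hm
      rw [mul_comm (((Fintype.card α - #B).choose (#C - #B) : ℕ) : ℝ), ← hm', div_mul_div_comm]
      have h4' : (4:ℝ) ≤ ((#C).choose #B : ℕ) := by exact_mod_cast h4
      have : (4 : ℝ) * ((Fintype.card α).choose #C : ℕ) ≤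
          ((Fintype.card α).choose #C : ℕ) * ((#C).choose #B : ℕ) := by nlinarith
      rw [mul_one]
      exact one_div_le_one_div_of_le (by positivity) this
    · intro B' _ hne
      by_cases hB' : B' ∈ F
      · rw [if_neg, zero_div]
        intro h; exact hne (H C hCF B' hB' B hB h hBC)
      · simp [ind, hB']
    · intro h; exact absurd (mem_univ _) h
  · rw [Finset.sum_eq_zero]
    · exact mul_nonneg (by norm_num) (div_nonneg (ind_nonneg _ _) (by positivity))
    · intro B _
      by_cases hCF : C ∈ F
      · by_cases hB : B ∈ F
        · rw [if_neg, zero_div]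
          intro h; exact hC ⟨hCF, B, hB, h⟩
        · simp [ind, hB]
      · simp [ind, hCF]

end Local

section Main
variable {α : Type*} [Fintype α] [DecidableEq α]

/-- Members of `F` of size at least three that contain no singleton and no pair of `F`. -/
def F3 (F : Finset (Finset α)) : Finset (Finset α) :=
  F.filter fun C => 3 ≤ #C ∧ (∀ p ∈ C, {p} ∉ F) ∧ (∀ p ∈ C, ∀ q ∈ C, {p, q} ∉ F)

lemma mem_F3_of (F : Finset (Finset α))
    (H : ∀ C ∈ F, ∀ B₁ ∈ F, ∀ B₂ ∈ F, B₁ ⊂ C → B₂ ⊂ C → B₁ = B₂)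
    {B C : Finset α} (hB : B ∈ F) (hC : C ∈ F) (hBC : B ⊂ C) (h3 : 3 ≤ #B) :
    B ∈ F3 F ∧ C ∈ F3 F := by
  have hlt := card_lt_card hBC
  have key : ∀ S : Finset α, S ⊆ C → #S ≤ 2 → S ∉ F := by
    intro S hS h2 hSF
    have hSC : S ⊂ C := by
      refine lt_of_le_of_ne hS ?_
      rintro rfl; omega
    have := H C hC S hSF B hB hSC hBC
    subst this; omega
  have k1 : ∀ p ∈ C, {p} ∉ F := fun p hp => key _ (by simpa using hp) (by simp)
  have k2 : ∀ p ∈ C, ∀ q ∈ C, {p, q} ∉ F := fun p hp q hq =>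
    key _ (by simp [insert_subset_iff, hp, hq]) card_le_two
  refine ⟨mem_filter.2 ⟨hB, h3, fun p hp => k1 p (hBC.1 hp), fun p hp q hq =>
    k2 p (hBC.1 hp) q (hBC.1 hq)⟩, mem_filter.2 ⟨hC, by omega, k1, k2⟩⟩

lemma Lub_dw_F3 (F : Finset (Finset α))
    (H : ∀ C ∈ F, ∀ B₁ ∈ F, ∀ B₂ ∈ F, B₁ ⊂ C → B₂ ⊂ C → B₁ = B₂)
    (T : Finset α) (hT : 3 ≤ #T) : Lub (dw F) T ≤ Lub (dw (F3 F)) T := by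
  refine Lub_mono fun B hTB => ?_
  have h3 : 3 ≤ #B := hT.trans (card_le_card hTB)
  rw [dw_eq, dw_eq]
  refine Finset.sum_le_sum fun C _ => ?_
  split_ifs with hBC
  · gcongr ?_ / _
    by_cases hB : B ∈ F
    · by_cases hC : C ∈ F
      · obtain ⟨h1, h2⟩ := mem_F3_of F H hB hC hBC h3
        simp [ind, hB, hC, h1, h2]
      · have : C ∉ F3 F := fun h => hC (mem_filter.1 h).1
        simp [ind, hC, this]
    · have : B ∉ F3 F := fun h => hB (mem_filter.1 h).1
      simp [ind, hB, this]
  · exact le_rfl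

lemma ind_cases (F : Finset (Finset α)) (S : Finset α) :
    (ind F S = 0 ∧ S ∉ F) ∨ (ind F S = 1 ∧ S ∈ F) := by
  by_cases h : S ∈ F <;> simp [ind, h]

lemma pointwise_arith (a b c x y z L D : ℝ)
    (ha : a = 0 ∨ a = 1) (hb : b = 0 ∨ b = 1) (hc : c = 0 ∨ c = 1)
    (hx : x = 0 ∨ x = 1) (hy : y = 0 ∨ y = 1) (hz : z = 0 ∨ z = 1) (hD : 0 ≤ D)
    (hL : L ≤ 1 + D)
    (h1 : 1 ≤ a + b + c + x + y + z → L ≤ 1) (h2 : 2 ≤ a + b + c + x + y + z → L ≤ 0)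
    (hab : a + b + x ≤ 2) :
    a + x + L ≤ 1 + (a * (1 - b) * c * x
  + (1 - a) * b * c * (x - 1)
  + a * (1 - b) * (1 - c) * (z * x + (1 - z))
  + (1 - a) * b * (1 - c) * (y * (x - 1))
  + (1 - a) * (1 - b) * c * (-((1 - x) * y))
  + (1 - a) * (1 - b) * (1 - c) * (x * (1 - y) * (1 - z))) + D := by
  rcases ha with rfl | rfl <;> rcases hb with rfl | rfl <;> rcases hc with rfl | rfl <;>
  rcases hx with rfl | rfl <;> rcases hy with rfl | rfl <;> rcases hz with rfl | rfl <;>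
  norm_num at * <;> linarith

lemma gg_lower (a b c x y z : ℝ)
    (ha : a = 0 ∨ a = 1) (hb : b = 0 ∨ b = 1) (hc : c = 0 ∨ c = 1)
    (hx : x = 0 ∨ x = 1) (hy : y = 0 ∨ y = 1) (hz : z = 0 ∨ z = 1) :
    -1 ≤ (a * (1 - b) * c * x
  + (1 - a) * b * c * (x - 1)
  + a * (1 - b) * (1 - c) * (z * x + (1 - z))
  + (1 - a) * b * (1 - c) * (y * (x - 1))
  + (1 - a) * (1 - b) * c * (-((1 - x) * y))
  + (1 - a) * (1 - b) * (1 - c) * (x * (1 - y) * (1 - z))) := by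
  rcases ha with rfl | rfl <;> rcases hb with rfl | rfl <;> rcases hc with rfl | rfl <;>
  rcases hx with rfl | rfl <;> rcases hy with rfl | rfl <;> rcases hz with rfl | rfl <;>
  norm_num

/-- If at least two of six indicators are one, two of the six distinct sets are in `F`. -/
lemma pointwise (F : Finset (Finset α))
    (H : ∀ C ∈ F, ∀ B₁ ∈ F, ∀ B₂ ∈ F, B₁ ⊂ C → B₂ ⊂ C → B₁ = B₂)
    (p q r : α) (hqp : q ≠ p) (hrq : r ≠ q) (hrp : r ≠ p) :
    ind F {p} + ind F {q, p} + Lub (ind F) {r, q, p} ≤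
      1 + gg (fun x => ind F {x}) (fun x y => ind F {x, y}) (fun x y => ind F {x, y}) p q r
        + Lub (dw (F3 F)) {r, q, p} := by
  set T : Finset α := {r, q, p} with hT
  have hTc : #T = 3 := by
    rw [hT, card_insert_of_notMem (by simp [hrq, hrp]), card_pair hqp]
  have hzero : ∀ B₁ ∈ F, ∀ B₂ ∈ F, B₁ ⊆ T → B₂ ⊆ T → #B₁ ≤ 2 → #B₂ ≤ 2 → B₁ ≠ B₂ →
      Lub (ind F) T ≤ 0 := by
    intro B₁ hB₁ B₂ hB₂ h₁ h₂ c₁ c₂ hne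
    refine le_of_eq (Lub_eq_zero T fun C hC => ?_)
    have : C ∉ F := by
      intro hCF
      have hc := card_le_card hC
      refine hne (H C hCF B₁ hB₁ B₂ hB₂ ?_ ?_)
      · refine lt_of_le_of_ne (h₁.trans hC) ?_
        rintro rfl; omega
      · refine lt_of_le_of_ne (h₂.trans hC) ?_
        rintro rfl; omega
    simp [ind, this]
  have hone : ∀ B ∈ F, B ⊆ T → #B ≤ 2 → Lub (ind F) T ≤ 1 := by
    intro B hB hBT hc
    refine Lub_antichain F T fun C hC C' hC' hTC hCC' => ?_
    have h1 := card_le_card hTC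
    have h2 : B ⊂ C := by
      refine lt_of_le_of_ne (hBT.trans hTC) ?_
      rintro rfl; omega
    exact h2.ne (H C' hC' B hB C hC (h2.trans hCC') hCC')
  have hL : Lub (ind F) T ≤ 1 + Lub (dw (F3 F)) T :=
    (Lub_le_one_add F T).trans (by linarith [Lub_dw_F3 F H T hTc.ge])
  have hD : 0 ≤ Lub (dw (F3 F)) T := Lub_nonneg T fun B _ => dw_nonneg _ _
  -- the six sets
  have sub : ∀ S : Finset α, S ∈ ({{p}, {q}, {r}, {p, q}, {p, r}, {q, r}} : Finset (Finset α)) →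
      S ⊆ T ∧ #S ≤ 2 := by
    intro S hS
    simp only [mem_insert, mem_singleton] at hS
    rcases hS with rfl | rfl | rfl | rfl | rfl | rfl <;>
      simp [hT, insert_subset_iff, card_le_two]
  have hsum : ∑ S ∈ ({{p}, {q}, {r}, {p, q}, {p, r}, {q, r}} : Finset (Finset α)), ind F S =
      ind F {p} + ind F {q} + ind F {r} + ind F {p, q} + ind F {p, r} + ind F {q, r} := by
    have ne : ∀ S S' : Finset α, (∃ x, ¬ (x ∈ S ↔ x ∈ S')) → S ≠ S' := by
      rintro S S' ⟨x, hx⟩ rfl; exact hx Iff.rfl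
    have d1 : ({p} : Finset α) ∉ ({{q}, {r}, {p, q}, {p, r}, {q, r}} : Finset (Finset α)) := by
      simp only [mem_insert, mem_singleton, not_or]
      refine ⟨ne _ _ ⟨p, ?_⟩, ne _ _ ⟨p, ?_⟩, ne _ _ ⟨q, ?_⟩, ne _ _ ⟨r, ?_⟩, ne _ _ ⟨p, ?_⟩⟩ <;>
        simp [hqp, hrq, hrp, hqp.symm, hrq.symm, hrp.symm]
    have d2 : ({q} : Finset α) ∉ ({{r}, {p, q}, {p, r}, {q, r}} : Finset (Finset α)) := by
      simp only [mem_insert, mem_singleton, not_or]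
      refine ⟨ne _ _ ⟨q, ?_⟩, ne _ _ ⟨p, ?_⟩, ne _ _ ⟨q, ?_⟩, ne _ _ ⟨r, ?_⟩⟩ <;>
        simp [hqp, hrq, hrp, hqp.symm, hrq.symm, hrp.symm]
    have d3 : ({r} : Finset α) ∉ ({{p, q}, {p, r}, {q, r}} : Finset (Finset α)) := by
      simp only [mem_insert, mem_singleton, not_or]
      refine ⟨ne _ _ ⟨p, ?_⟩, ne _ _ ⟨p, ?_⟩, ne _ _ ⟨q, ?_⟩⟩ <;>
        simp [hqp, hrq, hrp, hqp.symm, hrq.symm, hrp.symm]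
    have d4 : ({p, q} : Finset α) ∉ ({{p, r}, {q, r}} : Finset (Finset α)) := by
      simp only [mem_insert, mem_singleton, not_or]
      refine ⟨ne _ _ ⟨q, ?_⟩, ne _ _ ⟨p, ?_⟩⟩ <;>
        simp [hqp, hrq, hrp, hqp.symm, hrq.symm, hrp.symm]
    have d5 : ({p, r} : Finset α) ∉ ({{q, r}} : Finset (Finset α)) := by
      simp only [mem_singleton]
      refine ne _ _ ⟨q, ?_⟩
      simp [hqp, hrq.symm]
    rw [sum_insert d1, sum_insert d2, sum_insert d3, sum_insert d4, sum_insert d5, sum_singleton]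
    ring
  have hcard : ∑ S ∈ ({{p}, {q}, {r}, {p, q}, {p, r}, {q, r}} : Finset (Finset α)), ind F S =
      #(({{p}, {q}, {r}, {p, q}, {p, r}, {q, r}} : Finset (Finset α)).filter (· ∈ F)) := by
    simp only [ind, Finset.sum_boole]
  have ic : ∀ S : Finset α, ind F S = 0 ∨ ind F S = 1 := fun S =>
    (ind_cases F S).imp And.left And.left
  have res := pointwise_arith (ind F {p}) (ind F {q}) (ind F {r}) (ind F {p, q}) (ind F {p, r})
    (ind F {q, r}) (Lub (ind F) T) (Lub (dw (F3 F)) T) (ic _) (ic _) (ic _) (ic _) (ic _) (ic _)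
    hD hL
    (by
      intro h
      rw [← hsum, hcard] at h
      have h' : 0 < #(({{p}, {q}, {r}, {p, q}, {p, r}, {q, r}} :
        Finset (Finset α)).filter (· ∈ F)) := by
        have : 1 ≤ #(({{p}, {q}, {r}, {p, q}, {p, r}, {q, r}} :
          Finset (Finset α)).filter (· ∈ F)) := by exact_mod_cast h
        omega
      obtain ⟨B, hB⟩ := card_pos.1 h'
      rw [mem_filter] at hB
      exact hone B hB.2 (sub B hB.1).1 (sub B hB.1).2)
    (by
      intro h
      rw [← hsum, hcard] at h
      have h' : 1 < #(({{p}, {q}, {r}, {p, q}, {p, r}, {q, r}} :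
        Finset (Finset α)).filter (· ∈ F)) := by
        have : 2 ≤ #(({{p}, {q}, {r}, {p, q}, {p, r}, {q, r}} :
          Finset (Finset α)).filter (· ∈ F)) := by exact_mod_cast h
        omega
      obtain ⟨B, hB, B', hB', hne⟩ := one_lt_card.1 h'
      rw [mem_filter] at hB hB'
      exact hzero B hB.2 B' hB'.2 (sub B hB.1).1 (sub B' hB'.1).1 (sub B hB.1).2 (sub B' hB'.1).2
        hne)
    (by
      rcases ind_cases F {p} with ⟨h1, _⟩ | ⟨h1, m1⟩ <;>
      rcases ind_cases F {q} with ⟨h2, _⟩ | ⟨h2, m2⟩ <;>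
      rcases ind_cases F {p, q} with ⟨h3, _⟩ | ⟨h3, m3⟩ <;> rw [h1, h2, h3] <;> norm_num
      have s1 : ({p} : Finset α) ⊂ {p, q} := by
        rw [Finset.ssubset_iff_subset_ne]
        refine ⟨by simp, fun h => ?_⟩
        have : q ∈ ({p} : Finset α) := by rw [h]; simp
        exact hqp (by simpa using this)
      have s2 : ({q} : Finset α) ⊂ {p, q} := by
        rw [Finset.ssubset_iff_subset_ne]
        refine ⟨by simp, fun h => ?_⟩
        have : p ∈ ({q} : Finset α) := by rw [h]; simp
        exact hqp.symm (by simpa using this)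
      have := H _ m3 _ m1 _ m2 s1 s2
      exact hqp.symm (by simpa using this))
  simp only [gg]
  rw [pair_comm q p, pair_comm r p]
  exact res

theorem local_bound (F : Finset (Finset α)) (h0 : ∅ ∉ F)
    (H : ∀ C ∈ F, ∀ B₁ ∈ F, ∀ B₂ ∈ F, B₁ ⊂ C → B₂ ⊂ C → B₁ = B₂)
    (hn : 3000 ≤ Fintype.card α) : Lub (ind F) ∅ ≤ 14/11 := by
  set χ : α → ℝ := fun x => ind F {x} with hχ
  set s : α → α → ℝ := fun x y => ind F {x, y} with hs
  set n : ℝ := ((Fintype.card α : ℕ) : ℝ) with hnn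
  have hn' : (3000:ℝ) ≤ n := by rw [hnn]; exact_mod_cast hn
  have ic : ∀ S : Finset α, ind F S = 0 ∨ ind F S = 1 := fun S =>
    (ind_cases F S).imp And.left And.left
  have i0 : ∀ S : Finset α, 0 ≤ ind F S := ind_nonneg F
  have i1 : ∀ S : Finset α, ind F S ≤ 1 := fun S => by rcases ic S with h | h <;> rw [h]; norm_num
  have hcount := count_bound χ s s (fun p => i0 _) (fun p => i1 _) (fun p q => i0 _)
    (fun p q => i1 _) (fun p q => i0 _) (fun p q => i1 _)
    (fun p q => by simp only [hs]; rw [pair_comm]) n hnn (by linarith)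
  set G : ℝ := ∑ p, ∑ q, ∑ r, gg χ s s p q r with hG
  set I : ℝ := ∑ p, ∑ q, ∑ r, ∑ t, ii χ s p q r t with hI
  have ggl : ∀ p q r, -1 ≤ gg χ s s p q r := by
    intro p q r
    have := gg_lower (ind F {p}) (ind F {q}) (ind F {r}) (ind F {p, q}) (ind F {p, r})
      (ind F {q, r}) (ic _) (ic _) (ic _) (ic _) (ic _) (ic _)
    simp only [gg, hχ, hs]
    rw [pair_comm q p, pair_comm r p]
    exact this
  have hGl : -n^3 ≤ G := by
    have : ∑ p : α, ∑ q : α, ∑ r : α, (-1 : ℝ) ≤ G :=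
      Finset.sum_le_sum fun p _ => Finset.sum_le_sum fun q _ => Finset.sum_le_sum fun r _ =>
        ggl p q r
    simp only [Finset.sum_const, nsmul_eq_mul, card_univ, ← hnn] at this
    linarith
  -- three level expansion
  have e1 := Lub_exp3 (ind F) (by simp [ind, h0]) (by omega)
  have e2 := Lub_exp3 (dw (F3 F)) (by
    have : (∅ : Finset α) ∉ F3 F := fun h => h0 (mem_filter.1 h).1
    simp [dw, ind, this]) (by omega)
  have dz : ∀ S : Finset α, #S ≤ 2 → dw (F3 F) S = 0 := by
    intro S hS
    have : S ∉ F3 F := fun h => by have := (mem_filter.1 h).2.1; omega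
    simp [dw, ind, this]
  have b1 : (n * (n - 1) * (n - 2)) * Lub (ind F) ∅ ≤ n * (n - 1) * (n - 2)
      + (G + 3 * n^2) + (n * (n - 1) * (n - 2)) * Lub (dw (F3 F)) ∅ := by
    rw [e1, e2]
    have d1 := dist_sum_le (gg χ s s) ggl
    have c0 : ∑ p : α, ∑ q ∈ ({p} : Finset α)ᶜ, ∑ r ∈ ({q, p} : Finset α)ᶜ, (1:ℝ)
        = n * (n - 1) * (n - 2) := by
      have a2 : ∀ p : α, ∀ q ∈ ({p} : Finset α)ᶜ, ∑ r ∈ ({q, p} : Finset α)ᶜ, (1:ℝ) = n - 2 := by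
        intro p q hq
        rw [Finset.sum_const, nsmul_eq_mul, mul_one, card_compl, card_pair (by simpa using hq),
          Nat.cast_sub (by omega), Nat.cast_ofNat]
      have a1 : ∀ p : α, ∑ q ∈ ({p} : Finset α)ᶜ, ∑ r ∈ ({q, p} : Finset α)ᶜ, (1:ℝ)
          = (n - 1) * (n - 2) := by
        intro p
        rw [Finset.sum_congr rfl (a2 p), Finset.sum_const, nsmul_eq_mul, card_compl,
          card_singleton, Nat.cast_sub (by omega), Nat.cast_one]
      rw [Finset.sum_congr rfl fun p _ => a1 p, Finset.sum_const, nsmul_eq_mul, card_univ]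
      ring
    have d2 : ∑ p : α, ∑ q ∈ ({p} : Finset α)ᶜ, ∑ r ∈ ({q, p} : Finset α)ᶜ,
        (ind F {p} + ind F {q, p} + Lub (ind F) {r, q, p}) ≤
        ∑ p : α, ∑ q ∈ ({p} : Finset α)ᶜ, ∑ r ∈ ({q, p} : Finset α)ᶜ,
        (1 + gg χ s s p q r + (dw (F3 F) {p} + dw (F3 F) {q, p} + Lub (dw (F3 F)) {r, q, p})) := by
      refine Finset.sum_le_sum fun p _ => Finset.sum_le_sum fun q hq =>
        Finset.sum_le_sum fun r hr => ?_
      have hqp : q ≠ p := by simpa using hq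
      have hr' : r ≠ q ∧ r ≠ p := by simpa using hr
      rw [dz {p} (by simp), dz {q, p} card_le_two, zero_add, zero_add]
      exact pointwise F H p q r hqp hr'.1 hr'.2
    refine d2.trans ?_
    simp only [Finset.sum_add_distrib] at d1 c0 ⊢
    rw [c0]
    linarith
  -- four level expansion
  have hF3 : ∀ S ∈ F3 F, 3 ≤ #S := fun S hS => (mem_filter.1 hS).2.1
  have hF3F : ∀ S ∈ F3 F, S ∈ F := fun S hS => (mem_filter.1 hS).1
  have H3 : ∀ C ∈ F3 F, ∀ B₁ ∈ F3 F, ∀ B₂ ∈ F3 F, B₁ ⊂ C → B₂ ⊂ C → B₁ = B₂ :=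
    fun C hC B₁ h₁ B₂ h₂ => H C (hF3F C hC) B₁ (hF3F _ h₁) B₂ (hF3F _ h₂)
  have q1 := Lub_dw_le (F3 F) hF3 H3
  set C3 := (F3 F).filter fun C => ∃ B ∈ F3 F, B ⊂ C with hC3
  have q2 := Lub_exp4 (ind C3) (by
    intro S hS
    have : S ∉ C3 := by
      intro h
      obtain ⟨_, B, hB, hBS⟩ := mem_filter.1 h
      have := card_lt_card hBS
      have := hF3 B hB
      omega
    simp [ind, this]) (by omega)
  have iin : ∀ p q r t, 0 ≤ ii χ s p q r t := by
    intro p q r t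
    have u : ∀ S, 0 ≤ 1 - ind F S := fun S => by linarith [i1 S]
    simp only [ii, hχ, hs]
    have := u {p}; have := u {q}; have := u {r}; have := u {t}
    have := u {p, q}; have := u {p, r}; have := u {p, t}
    have := u {q, r}; have := u {q, t}; have := u {r, t}
    positivity
  have q3 : n * (n - 1) * (n - 2) * (n - 3) * Lub (ind C3) ∅ ≤ I := by
    rw [q2]
    refine Finset.sum_le_sum fun p _ => ?_
    refine (Finset.sum_le_sum_of_subset_of_nonneg (subset_univ _) ?_).trans
      (Finset.sum_le_sum fun q _ => ?_)
    · intro q _ _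
      exact Finset.sum_nonneg fun r _ => Finset.sum_nonneg fun t _ =>
        Lub_nonneg _ fun _ _ => ind_nonneg _ _
    refine (Finset.sum_le_sum_of_subset_of_nonneg (subset_univ _) ?_).trans
      (Finset.sum_le_sum fun r _ => ?_)
    · intro r _ _
      exact Finset.sum_nonneg fun t _ => Lub_nonneg _ fun _ _ => ind_nonneg _ _
    refine (Finset.sum_le_sum_of_subset_of_nonneg (subset_univ _) ?_).trans
      (Finset.sum_le_sum fun t _ => ?_)
    · intro t _ _
      exact Lub_nonneg _ fun _ _ => ind_nonneg _ _
    by_cases hex : ∃ C ∈ C3, ({t, r, q, p} : Finset α) ⊆ C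
    · obtain ⟨C, hC, hTC⟩ := hex
      have hCm := (mem_filter.1 (mem_filter.1 hC).1).2.2
      have z1 : ∀ x ∈ C, ind F {x} = 0 := fun x hx => by simp [ind, hCm.1 x hx]
      have z2 : ∀ x ∈ C, ∀ y ∈ C, ind F {x, y} = 0 := fun x hx y hy => by
        simp [ind, hCm.2 x hx y hy]
      have mt : t ∈ C := hTC (by simp)
      have mr : r ∈ C := hTC (by simp)
      have mq : q ∈ C := hTC (by simp)
      have mp : p ∈ C := hTC (by simp)
      have : ii χ s p q r t = 1 := by
        simp only [ii, hχ, hs]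
        rw [z1 t mt, z1 r mr, z1 q mq, z1 p mp, z2 p mp q mq, z2 p mp r mr, z2 p mp t mt,
          z2 q mq r mr, z2 q mq t mt, z2 r mr t mt]
        norm_num
      rw [this]
      refine Lub_antichain C3 _ fun B hB C' hC' _ hBC => ?_
      obtain ⟨hB3, B0, hB0, hlt⟩ := mem_filter.1 hB
      have := H3 C' (mem_filter.1 hC').1 B hB3 B0 hB0 hBC (hlt.trans hBC)
      exact hlt.ne this.symm
    · rw [Lub_eq_zero]
      · exact iin p q r t
      · intro B hB
        have : B ∉ C3 := fun h => hex ⟨B, h, hB⟩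
        simp [ind, this]
  -- final arithmetic
  set h := Lub (ind F) ∅ with hh
  set d := Lub (dw (F3 F)) ∅ with hd
  set l := Lub (ind C3) ∅ with hl
  set N3 := n * (n - 1) * (n - 2) with hN3
  have pN3 : 0 < N3 := by
    have : 0 < n - 1 := by linarith
    have : 0 < n - 2 := by linarith
    positivity
  have pn3 : 0 < n - 3 := by linarith
  have r1 : N3 * (n - 3) * (h - 1) ≤ (n - 3) * (G + 3 * n^2) + 1/4 * I := by
    have s1 := mul_le_mul_of_nonneg_left b1 pn3.le
    have s2 := mul_le_mul_of_nonneg_left q1 (mul_nonneg pN3.le pn3.le)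
    nlinarith
  have r2 : N3 * (n - 3) * (h - 1) ≤ 27/100 * n^4 + 6 * n^3 := by
    have : 0 ≤ n^2 := by positivity
    nlinarith
  have r3 : 27/100 * n^4 + 6 * n^3 ≤ 3/11 * (N3 * (n - 3)) := by
    have e : N3 * (n - 3) = n^4 - 6 * n^3 + (11 * n^2 - 6 * n) := by rw [hN3]; ring
    have p : 0 ≤ 11 * n^2 - 6 * n := by nlinarith
    have p3 : 0 ≤ n^3 * (n - 3000) := mul_nonneg (by positivity) (by linarith)
    have : n^3 * n = n^4 := by ring
    have : 0 ≤ n^3 := by positivity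
    rw [e]
    nlinarith
  have r4 : h - 1 ≤ 3/11 := by
    have : N3 * (n - 3) * (h - 1) ≤ N3 * (n - 3) * (3/11) := by linarith
    exact le_of_mul_le_mul_left this (by positivity)
  linarith

end Main
section PartTwo

lemma transport {n : ℕ} (F : Finset (Finset (Fin n))) (hF : DkFree n 2 F)
    (A : Finset (Fin n)) (hA : A ∈ F) (hn : 3000 ≤ n - #A) : Lub (ind F) A ≤ 25 / 11 := by
  classical
  set β := {x : Fin n // x ∉ A}
  set e : β ↪ Fin n := Function.Embedding.subtype _ with he
  set F' : Finset (Finset β) := univ.filter fun T => T ≠ ∅ ∧ A ∪ T.map e ∈ F with hF'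
  have hdisj : ∀ T : Finset β, Disjoint A (T.map e) := by
    intro T
    rw [Finset.disjoint_left]
    intro x hx hT
    obtain ⟨y, _, rfl⟩ := mem_map.1 hT
    exact y.2 hx
  have hcardβ : Fintype.card β = n - #A := by
    have : Fintype.card β = #(Aᶜ) := by
      rw [Fintype.card_subtype]; congr 1; ext x; simp
    rw [this, card_compl, Fintype.card_fin]
  have hinj : ∀ T T' : Finset β, A ∪ T.map e = A ∪ T'.map e → T = T' := by
    intro T T' h
    apply Finset.map_injective e
    have h1 := Finset.union_sdiff_cancel_left (hdisj T)
    have h2 := Finset.union_sdiff_cancel_left (hdisj T')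
    rw [← h1, ← h2, h]
  have key : Lub (ind F) A = 1 + Lub (ind F') ∅ := by
    have e1 : Lub (ind F) A = Lub (fun T : Finset β => ind F (A ∪ T.map e)) ∅ := by
      unfold Lub
      symm
      refine Finset.sum_bij (fun T _ => A ∪ T.map e) ?_ ?_ ?_ ?_
      · intro T _; simp
      · intro T _ T' _ h; exact hinj T T' h
      · intro S hS
        have hAS : A ⊆ S := (mem_filter.1 hS).2
        refine ⟨S.subtype (fun x => x ∉ A), by simp, ?_⟩
        ext x
        simp only [mem_union, mem_map, he]
        constructor
        · rintro (h | ⟨y, hy, rfl⟩)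
          · exact hAS h
          · exact mem_subtype.1 hy
        · intro h
          by_cases hx : x ∈ A
          · exact Or.inl hx
          · exact Or.inr ⟨⟨x, hx⟩, mem_subtype.2 h, rfl⟩
      · intro T _
        rw [card_union_of_disjoint (hdisj T), card_map, hcardβ, Fintype.card_fin]
        simp
    have e2 : ∀ T : Finset β, ind F (A ∪ T.map e) = (if T = ∅ then 1 else 0) + ind F' T := by
      intro T
      by_cases hT : T = ∅
      · subst hT; simp [ind, hF', hA]
      · simp [ind, hF', hT]
    rw [e1]
    simp only [e2]
    unfold Lub
    simp only [add_div, Finset.sum_add_distrib]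
    congr 1
    rw [Finset.sum_eq_single ∅]
    · simp
    · intro T _ hT; simp [hT]
    · simp
  have lb := local_bound F' (by simp [hF']) (by
    intro C hC B₁ h₁ B₂ h₂ l₁ l₂
    by_contra hne
    have hC' := (mem_filter.1 hC).2
    have h₁' := (mem_filter.1 h₁).2
    have h₂' := (mem_filter.1 h₂).2
    have nA : ∀ T : Finset β, T ≠ ∅ → A ∪ T.map e ≠ A := by
      intro T hT h
      exact hT (hinj T ∅ (by simpa using h))
    refine hF ⟨A, A ∪ C.map e, ![A ∪ B₁.map e, A ∪ B₂.map e], hA, hC'.2, ?_, ?_, ?_, ?_, ?_⟩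
    · intro i; fin_cases i
      · exact h₁'.2
      · exact h₂'.2
    · intro i j hij
      fin_cases i <;> fin_cases j
      · rfl
      · exact absurd (hinj _ _ hij) hne
      · exact absurd (hinj _ _ hij).symm hne
      · rfl
    · intro i; fin_cases i
      · exact ⟨nA _ h₁'.1, fun h => l₁.ne (hinj _ _ h)⟩
      · exact ⟨nA _ h₂'.1, fun h => l₂.ne (hinj _ _ h)⟩
    · exact (nA _ hC'.1).symm
    · intro i; fin_cases i
      · exact ⟨subset_union_left, union_subset_union_right (map_subset_map.2 l₁.1)⟩
      · exact ⟨subset_union_left, union_subset_union_right (map_subset_map.2 l₂.1)⟩)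
    (by rw [hcardβ]; exact hn)
  rw [key]
  linarith

lemma card_low {n : ℕ} (F : Finset (Finset (Fin n))) (hF : DkFree n 2 F)
    (hs : ∀ S ∈ F, 3000 ≤ n - #S) : (#F : ℝ) ≤ 25 / 11 * (n.choose (n / 2)) := by
  have h1 : Lub (ind F) ∅ ≤ 25 / 11 := by
    refine Lub_le _ (by norm_num) ∅ fun B _ hB => ?_
    have hBF : B ∈ F := by
      by_contra h
      exact hB (by simp [ind, h])
    exact transport F hF B hBF (hs B hBF)
  have hpos : (0:ℝ) < n.choose (n / 2) := by
    exact_mod_cast Nat.choose_pos (Nat.div_le_self n 2)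
  have h2 : (#F : ℝ) / n.choose (n / 2) ≤ Lub (ind F) ∅ := by
    unfold Lub
    have : (#F : ℝ) = ∑ S : Finset (Fin n), ind F S := by
      simp [ind]
    rw [this, Finset.sum_div]
    simp only [empty_subset, filter_true, card_empty, Nat.sub_zero, Fintype.card_fin]
    refine Finset.sum_le_sum fun S _ => ?_
    have hS : #S ≤ n := by simpa using card_le_univ S
    refine div_le_div_of_nonneg_left (ind_nonneg F S) ?_ ?_
    · exact_mod_cast Nat.choose_pos hS
    · exact_mod_cast Nat.choose_le_middle _ _
  rw [div_le_iff₀ hpos] at h2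
  exact h2.trans (mul_le_mul_of_nonneg_right h1 hpos.le)

lemma card_high {n K : ℕ} (hn : 1 ≤ n) (F : Finset (Finset (Fin n)))
    (hs : ∀ S ∈ F, n - #S < K) : #F ≤ K * n ^ K := by
  have h1 : #F ≤ #((range K).biUnion fun j => powersetCard j (univ : Finset (Fin n))) := by
    refine card_le_card_of_injOn compl ?_ (compl_injective.injOn)
    intro S hS
    have := hs S hS
    simp only [coe_biUnion, Set.mem_iUnion, mem_coe, mem_range, mem_powersetCard]
    exact ⟨n - #S, this, subset_univ _, by rw [card_compl, Fintype.card_fin]⟩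
  refine h1.trans (card_biUnion_le.trans ?_)
  have : ∀ j ∈ range K, #(powersetCard j (univ : Finset (Fin n))) ≤ n ^ K := by
    intro j hj
    rw [card_powersetCard, card_univ, Fintype.card_fin]
    exact (Nat.choose_le_pow n j).trans (Nat.pow_le_pow_right hn (mem_range.1 hj).le)
  refine (Finset.sum_le_sum this).trans ?_
  simp

lemma two_pow_le (n : ℕ) : 2 ^ n ≤ (n + 1) * n.choose (n / 2) := by
  rw [← Nat.sum_range_choose]
  refine (Finset.sum_le_sum fun i _ => Nat.choose_le_middle i n).trans ?_
  simp

lemma eventually_small (K : ℕ) : ∃ N : ℕ, ∀ n : ℕ, N ≤ n →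
    ((K * n ^ K : ℕ) : ℝ) ≤ 2 / (n : ℝ) ^ 2 * (n.choose (n / 2)) := by
  have h := tendsto_pow_const_div_const_pow_of_one_lt (K + 3) (r := (2:ℝ)) (by norm_num)
  have h' := h.eventually (gt_mem_nhds (show (0:ℝ) < 1 / (K + 1) by positivity))
  obtain ⟨N, hN⟩ := Filter.eventually_atTop.1 h'
  refine ⟨max N 1, fun n hn => ?_⟩
  have hn1 : 1 ≤ n := (le_max_right _ _).trans hn
  have h1 := hN n ((le_max_left _ _).trans hn)
  have hn0 : (1:ℝ) ≤ n := by exact_mod_cast hn1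
  have h2 : ((2:ℝ) ^ n) ≤ (n + 1) * n.choose (n / 2) := by exact_mod_cast two_pow_le n
  set c : ℝ := ((n.choose (n / 2) : ℕ) : ℝ)
  have hc : 0 ≤ c := Nat.cast_nonneg _
  rw [div_lt_div_iff₀ (by positivity) (by positivity), one_mul] at h1
  have h3 : (n + 1) * c ≤ 2 * n * c := by nlinarith
  rw [div_mul_eq_mul_div, le_div_iff₀ (by positivity)]
  push_cast
  have h4 : (n:ℝ) * (n ^ (K + 2) * (K + 1)) ≤ n * (2 * c) := by
    calc (n:ℝ) * (n ^ (K + 2) * (K + 1)) = n ^ (K + 3) * (K + 1) := by ring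
      _ ≤ n * (2 * c) := by linarith
  have h5 := le_of_mul_le_mul_left h4 (by linarith)
  have h6 : (0:ℝ) ≤ n ^ (K + 2) := by positivity
  calc (K:ℝ) * n ^ K * n ^ 2 = n ^ (K + 2) * K := by ring
    _ ≤ 2 * c := by linarith

end PartTwo

/-- There exists `N` such that for all `n ≥ N`, every diamond-free family of
subsets of `[n]` has size at most `(25/11 + 2/n²) · C(n, ⌊n/2⌋)`. -/
theorem diamondFree_card_le_eventually :
    ∃ N : ℕ, ∀ n : ℕ, N ≤ n →
      ∀ F : Finset (Finset (Fin n)), DkFree n 2 F →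
        (F.card : ℝ) ≤ (25 / 11 + 2 / (n : ℝ) ^ 2) * (n.choose (n / 2)) := by
  obtain ⟨N, hN⟩ := eventually_small 3000
  refine ⟨max N 1, fun n hn F hF => ?_⟩
  have h1 := hN n ((le_max_left _ _).trans hn)
  have hlow := card_low (F.filter fun S => 3000 ≤ n - #S) (by
    rintro ⟨A, C, B, hA, hC, hB, hr⟩
    exact hF ⟨A, C, B, (mem_filter.1 hA).1, (mem_filter.1 hC).1,
      fun i => (mem_filter.1 (hB i)).1, hr⟩) (fun S hS => (mem_filter.1 hS).2)
  have hhigh := card_high (K := 3000) ((le_max_right _ _).trans hn)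
    (F.filter fun S => ¬ 3000 ≤ n - #S) (fun S hS => not_le.1 (mem_filter.1 hS).2)
  have hhigh' := (Nat.cast_le (α := ℝ)).2 hhigh
  have hsum := card_filter_add_card_filter_not (s := F) (fun S => 3000 ≤ n - #S)
  rw [← hsum, Nat.cast_add, add_mul]
  exact add_le_add hlow (hhigh'.trans h1)
end
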